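/- arXiv:2211.05753 — 2 statements merged into one kernel-verified Lean document; each statement's English description precedes it below -/
import Mathlib

section
/- There exists an absolute constant c > 0 such that for every integer n ≥ 2 there exists an n-point metric space M = (M,d) and a starting point s ∈ M with the following property: c·(log n)² is a distributional lower bound for MSS on M with starting point s (with request sets of size at most n−1). Consequently, the randomized competitive ratio for MSS on M is Ω(log² n). -/
open scoped Classical

/-- `d` is a metric on `M`. -/
def IsMetric {M : Type*} (d : M → M → ℝ) : Prop :=
  (∀ x y, d x y = 0 ↔ x = y) ∧ (∀ x y, d x y = d y x) ∧
    ∀ x y z, d x z ≤ d x y + d y z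

/-- The point occupied by the online algorithm `A` (with starting point `s`)
after serving the first `t` requests of `σ`. -/
def mssPoint {M : Type*} (A : List (Finset M) → M) (s : M)
    (σ : List (Finset M)) (t : ℕ) : M :=
  if t = 0 then s else A (σ.take t)

/-- The cost of the deterministic online algorithm `A` on the MSS request
sequence `σ`, starting at `s`. -/
def mssCost {M : Type*} (d : M → M → ℝ) (A : List (Finset M) → M) (s : M)
    (σ : List (Finset M)) : ℝ :=
  ∑ t ∈ Finset.range σ.length, d (mssPoint A s σ t) (mssPoint A s σ (t + 1))

/-- `A` is a valid deterministic online algorithm for MSS: after each (nonempty)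
prefix, it occupies a point of the last request. -/
def MssAlg {M : Type*} (A : List (Finset M) → M) : Prop :=
  ∀ (l : List (Finset M)) (r : Finset M), r.Nonempty → A (l ++ [r]) ∈ r

/-- `x` is a feasible (offline) point sequence serving `σ` from `s`. -/
def MssServes {M : Type*} (s : M) (σ : List (Finset M)) (x : ℕ → M) : Prop :=
  x 0 = s ∧ ∀ (t : ℕ) (h : t < σ.length), x (t + 1) ∈ σ.get ⟨t, h⟩

/-- Optimal (offline) cost of serving `σ` from `s`. -/
noncomputable def mssOpt {M : Type*} (d : M → M → ℝ) (s : M)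
    (σ : List (Finset M)) : ℝ :=
  sInf {c | ∃ x : ℕ → M, MssServes s σ x ∧
    c = ∑ t ∈ Finset.range σ.length, d (x t) (x (t + 1))}

/-- `C` is a distributional lower bound for MSS on `(M,d)` with starting point `s`
and request sets of size at most `w`. -/
def MssDLB {M : Type*} (d : M → M → ℝ) (s : M) (w : ℕ) (C : ℝ) : Prop :=
  ∀ B : ℝ, 0 ≤ B → ∃ (N : ℕ) (P : Fin N → ℝ) (ρ : Fin N → List (Finset M)),
    (∀ ω, 0 ≤ P ω) ∧ (∑ ω, P ω) = 1 ∧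
    (∀ ω, ∀ r ∈ ρ ω, r.Nonempty ∧ r.card ≤ w) ∧
    B ≤ (∑ ω, P ω * mssOpt d s (ρ ω)) ∧
    ∀ A : List (Finset M) → M, MssAlg A →
      C * (∑ ω, P ω * mssOpt d s (ρ ω)) ≤ ∑ ω, P ω * mssCost d A s (ρ ω)

/-- The expected number of hits that a fixed arm of a race still receives when the arms have `a`
and `b` progress hits left: fair coins hand out hits until one arm has no progress hits left, and
from then on both arms are hit as often as the other arm still needs. -/
noncomputable def raceValue : ℕ → ℕ → ℝ
  | 0, b => b
  | a + 1, 0 => a + 1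
  | a + 1, b + 1 => (raceValue a (b + 1) + raceValue (a + 1) b) / 2 + 1 / 2
termination_by a b => a + b

theorem raceValue_zero_left (b : ℕ) : raceValue 0 b = b := by
  rw [raceValue]

theorem raceValue_zero_right (a : ℕ) : raceValue a 0 = a := by
  cases a <;> simp [raceValue]

theorem raceValue_succ_succ (a b : ℕ) :
    raceValue (a + 1) (b + 1) = (raceValue a (b + 1) + raceValue (a + 1) b) / 2 + 1 / 2 := by
  rw [raceValue]

theorem raceValue_comm (a b : ℕ) : raceValue a b = raceValue b a := by
  induction a generalizing b with
  | zero => rw [raceValue_zero_left, raceValue_zero_right]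
  | succ a iha =>
    induction b with
    | zero => rw [raceValue_zero_left, raceValue_zero_right]
    | succ b ihb => rw [raceValue_succ_succ, raceValue_succ_succ, iha, ihb]; ring

theorem raceValue_succ_right (a b : ℕ) :
    raceValue a b ≤ raceValue a (b + 1) ∧ raceValue a (b + 1) ≤ raceValue a b + 1 := by
  induction a generalizing b with
  | zero => simp [raceValue_zero_left]
  | succ a iha =>
    induction b with
    | zero =>
      have h := iha 0
      rw [raceValue_zero_right] at h
      rw [raceValue_succ_succ, raceValue_zero_right]
      push_cast
      constructor <;> linarith
    | succ b ihb =>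
      have h := iha (b + 1)
      rw [raceValue_succ_succ a (b + 1), raceValue_succ_succ a b]
      rw [raceValue_succ_succ a b] at ihb
      constructor <;> linarith

theorem raceValue_succ_left (a b : ℕ) :
    raceValue a b ≤ raceValue (a + 1) b ∧ raceValue (a + 1) b ≤ raceValue a b + 1 := by
  rw [raceValue_comm a b, raceValue_comm (a + 1) b]
  exact raceValue_succ_right b a

/-- A polynomial martingale bounds `raceValue` from below. -/
theorem le_raceValue {u : ℝ} (hu : 1 ≤ u) (a b : ℕ) :
    ((a : ℝ) + b) / 2 + ((((a : ℝ) - b) ^ 2 + (a + b)) / (2 * u)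
      - (((a : ℝ) - b) ^ 4 + 6 * (a + b) * ((a : ℝ) - b) ^ 2 + 3 * (a + b) ^ 2 - 2 * (a + b))
        / (12 * u ^ 3)) / 2 ≤ raceValue a b := by
  have hu0 : 0 < u := by linarith
  have key : ∀ j : ℕ, ((j : ℝ) ^ 2 + j) / (2 * u)
      - ((j : ℝ) ^ 4 + 6 * j * (j : ℝ) ^ 2 + 3 * (j : ℝ) ^ 2 - 2 * j) / (12 * u ^ 3) ≤ j := by
    intro j
    rcases Nat.eq_zero_or_pos j with rfl | hj
    · simp
    have hj' : (1 : ℝ) ≤ j := by exact_mod_cast hj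
    rw [sub_le_iff_le_add, div_le_iff₀ (by positivity)]
    have e : ((j : ℝ) + ((j : ℝ) ^ 4 + 6 * j * (j : ℝ) ^ 2 + 3 * (j : ℝ) ^ 2 - 2 * j) / (12 * u ^ 3))
        * (2 * u) = j * (2 * u + ((j : ℝ) ^ 3 + 6 * (j : ℝ) ^ 2 + 3 * j - 2) / (6 * u ^ 2)) := by
      field_simp
      ring
    rw [e, show (j : ℝ) ^ 2 + j = j * (j + 1) by ring]
    refine mul_le_mul_of_nonneg_left ?_ (by positivity)
    have h3 : (j : ℝ) ^ 3 / (6 * u ^ 2) ≤ ((j : ℝ) ^ 3 + 6 * (j : ℝ) ^ 2 + 3 * j - 2) / (6 * u ^ 2) := by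
      gcongr
      nlinarith
    have h4 : (j : ℝ) ≤ u + (j : ℝ) ^ 3 / (6 * u ^ 2) := by
      rw [← sub_le_iff_le_add', le_div_iff₀ (by positivity)]
      nlinarith [mul_nonneg hu0.le (sq_nonneg ((j : ℝ) - 7 / 5 * u)),
        mul_nonneg (by positivity : (0 : ℝ) ≤ j) (sq_nonneg ((j : ℝ) - 7 / 5 * u)), pow_pos hu0 3]
    linarith
  induction a generalizing b with
  | zero =>
    rw [raceValue_zero_left]
    have := key b
    push_cast
    have e : ∀ x y : ℝ, x = y → y ≤ b → (0 + (b : ℝ)) / 2 + x / 2 ≤ b := by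
      intro x y h1 h2; linarith
    refine e _ _ ?_ this
    ring
  | succ a iha =>
    induction b with
    | zero =>
      rw [raceValue_zero_right]
      have := key (a + 1)
      have e : ∀ x y : ℝ, x = y → y ≤ (a + 1 : ℕ) →
          (((a + 1 : ℕ) : ℝ) + (0 : ℕ)) / 2 + x / 2 ≤ (a + 1 : ℕ) := by
        intro x y h1 h2; push_cast at *; linarith
      refine e _ _ ?_ this
      push_cast
      ring
    | succ b ihb =>
      rw [raceValue_succ_succ]
      have h := iha (b + 1)
      push_cast at *
      refine le_of_eq_of_le ?_ (add_le_add_left (div_le_div_of_nonneg_right (add_le_add h ihb)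
        zero_le_two) _)
      field_simp
      ring

theorem add_sqrt_le_raceValue {N : ℕ} (hN : 1 ≤ N) :
    (N : ℝ) + √(2 * N) / 8 ≤ raceValue N N := by
  have hN' : (1 : ℝ) ≤ N := by exact_mod_cast hN
  set u := √(2 * (N : ℝ)) with hu
  have hsq : u ^ 2 = 2 * N := Real.sq_sqrt (by positivity)
  have hu1 : 1 ≤ u := by
    rw [hu, Real.one_le_sqrt]; linarith
  have h := le_raceValue hu1 N N
  have hn : (N : ℝ) = u ^ 2 / 2 := by linarith
  refine le_trans ?_ h
  rw [hn]
  have hu0 : 0 < u := by linarith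
  have e : (u ^ 2 / 2 + u ^ 2 / 2) / 2 + (((u ^ 2 / 2 - u ^ 2 / 2) ^ 2 + (u ^ 2 / 2 + u ^ 2 / 2)) / (2 * u)
      - ((u ^ 2 / 2 - u ^ 2 / 2) ^ 4 + 6 * (u ^ 2 / 2 + u ^ 2 / 2) * (u ^ 2 / 2 - u ^ 2 / 2) ^ 2
        + 3 * (u ^ 2 / 2 + u ^ 2 / 2) ^ 2 - 2 * (u ^ 2 / 2 + u ^ 2 / 2)) / (12 * u ^ 3)) / 2
      = u ^ 2 / 2 + u / 8 + 1 / (12 * u) := by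
    field_simp
    ring
  rw [e]
  have : 0 < 1 / (12 * u) := by positivity
  linarith

/-- A gadget: a pseudometric with a source `s`, a sink `t` and a potential `lam` rising from `0` at
`s` to `1` at `t` at most as fast as the distance. -/
structure Gadget (M : Type) where
  /-- The pseudometric. -/
  d : M → M → ℝ
  /-- The potential measuring offline progress. -/
  lam : M → ℝ
  /-- The source. -/
  s : M
  /-- The sink. -/
  t : M
  d_self : ∀ p, d p p = 0
  d_comm : ∀ p q, d p q = d q p
  d_tri : ∀ p q r, d p r ≤ d p q + d q r
  lam_le : ∀ p q, lam q - lam p ≤ d p q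
  lam_s : lam s = 0
  lam_t : lam t = 1

namespace Gadget

variable {M : Type} (G : Gadget M)

theorem d_nonneg (p q : M) : 0 ≤ G.d p q := by
  have h := G.d_tri p q p
  rw [G.d_self, G.d_comm q p] at h
  linarith

theorem one_le_d : 1 ≤ G.d G.s G.t := by
  have h := G.lam_le G.s G.t
  rw [G.lam_s, G.lam_t] at h
  linarith

/-- A game state: the last request `r` (of at most `k` points), the offline positions `S` that are
still optimal, and a lower bound `φ` on the future online cost, confined to a window below `h`. -/
structure State (k : ℕ) (h : ℝ) (r S : Finset M) (φ : M → ℝ) : Prop where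
  nonempty : r.Nonempty
  card_le : r.card ≤ k
  subset : S ⊆ r
  lower : ∀ p ∈ r, h - 1 ≤ φ p
  upper : ∀ p ∈ r, φ p ≤ h
  lip : ∀ p ∈ r, ∀ q ∈ r, φ p ≤ φ q + G.d p q

/-- `Win` states have a randomized continuation that ends at the sink, keeps every position of
`S` on a geodesic to the sink, and costs an online player at `p` at least `φ p`. -/
inductive Win (k : ℕ) : ℝ → Finset M → Finset M → (M → ℝ) → Prop
  | done {r S φ} (st : G.State k 0 r S φ) (ht : G.t ∈ S) : Win k 0 r S φ
  | req {h r S φ h' r' S' φ'} (st : G.State k h r S φ) (hle : h' ≤ h) (hge : h - 1 ≤ h')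
      (cert : ∀ p ∈ r, ∀ q ∈ r', φ p ≤ G.d p q + φ' q)
      (off : ∀ q ∈ S', ∃ p ∈ S, G.d p q ≤ G.lam q - G.lam p)
      (next : Win k h' r' S' φ') : Win k h r S φ
  | coin {h r S φ h₁ h₂ φ₁ φ₂} (st : G.State k h r S φ)
      (hle₁ : h₁ ≤ h) (hge₁ : h - 1 ≤ h₁) (hle₂ : h₂ ≤ h) (hge₂ : h - 1 ≤ h₂)
      (avg : ∀ p ∈ r, φ p ≤ (φ₁ p + φ₂ p) / 2)
      (next₁ : Win k h₁ r S φ₁) (next₂ : Win k h₂ r S φ₂) : Win k h r S φ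

variable {G}

theorem Win.state {k : ℕ} {h : ℝ} {r S : Finset M} {φ : M → ℝ} (w : G.Win k h r S φ) :
    G.State k h r S φ := by
  cases w <;> assumption

theorem Win.nonneg {k : ℕ} {h : ℝ} {r S : Finset M} {φ : M → ℝ} (w : G.Win k h r S φ) :
    0 ≤ h := by
  induction w with
  | done => exact le_rfl
  | req _ hle _ _ _ _ ih => exact ih.trans hle
  | coin _ hle₁ _ _ _ _ _ _ ih _ => exact ih.trans hle₁

/-! ### The composite gadget -/

section Comp

variable (G)

/-- The position of a point of the composite gadget within the first copy. -/
noncomputable def fst (x : Bool × Fin 3 × M) : M := if x.2.1 = 0 then x.2.2 else G.t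

/-- The position of a point of the composite gadget within the middle copies. -/
noncomputable def mid (x : Bool × Fin 3 × M) : M :=
  if x.2.1 = 0 then G.s else if x.2.1 = 1 then x.2.2 else G.t

/-- The position of a point of the composite gadget within the last copy. -/
noncomputable def lst (x : Bool × Fin 3 × M) : M := if x.2.1 = 2 then x.2.2 else G.s

/-- The signed coordinate separating the two arms of the composite gadget. -/
noncomputable def side (x : Bool × Fin 3 × M) : ℝ :=
  (if x.1 then 1 else -1) * (2 / 5 * (G.lam (G.fst x) - G.lam (G.lst x)))

/-- The potential of the composite gadget. -/
noncomputable def compLam (x : Bool × Fin 3 × M) : ℝ :=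
  2 / 5 * G.lam (G.fst x) + 1 / 5 * G.lam (G.mid x) + 2 / 5 * G.lam (G.lst x)

/-- The distance of the composite gadget. -/
noncomputable def compDist (x y : Bool × Fin 3 × M) : ℝ :=
  max (2 / 5 * G.d (G.fst x) (G.fst y)) <| max (1 / 5 * G.d (G.mid x) (G.mid y)) <|
    max (2 / 5 * G.d (G.lst x) (G.lst y)) <| max |G.side x - G.side y| |G.compLam x - G.compLam y|

theorem compDist_le_iff {x y : Bool × Fin 3 × M} {c : ℝ} : G.compDist x y ≤ c ↔
    2 / 5 * G.d (G.fst x) (G.fst y) ≤ c ∧ 1 / 5 * G.d (G.mid x) (G.mid y) ≤ c ∧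
      2 / 5 * G.d (G.lst x) (G.lst y) ≤ c ∧ |G.side x - G.side y| ≤ c ∧
        |G.compLam x - G.compLam y| ≤ c := by
  simp only [compDist, max_le_iff]

/-- Two copies of `G` scaled by `2/5`, a middle copy scaled by `1/5` and again a copy scaled by
`2/5` are concatenated into an arm, and two such arms are glued at their common ends. -/
noncomputable def comp : Gadget (Bool × Fin 3 × M) where
  d := G.compDist
  lam := G.compLam
  s := (true, 0, G.s)
  t := (true, 2, G.t)
  d_self x := by simp [compDist, G.d_self]
  d_comm x y := by
    simp only [compDist]
    rw [G.d_comm (G.fst x), G.d_comm (G.mid x), G.d_comm (G.lst x), abs_sub_comm (G.side x),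
      abs_sub_comm (G.compLam x)]
  d_tri x y z := by
    obtain ⟨a₁, a₂, a₃, a₄, a₅⟩ := G.compDist_le_iff.1 (le_refl (G.compDist x y))
    obtain ⟨b₁, b₂, b₃, b₄, b₅⟩ := G.compDist_le_iff.1 (le_refl (G.compDist y z))
    refine G.compDist_le_iff.2 ⟨?_, ?_, ?_, ?_, ?_⟩
    · linarith [G.d_tri (G.fst x) (G.fst y) (G.fst z)]
    · linarith [G.d_tri (G.mid x) (G.mid y) (G.mid z)]
    · linarith [G.d_tri (G.lst x) (G.lst y) (G.lst z)]
    · exact (abs_sub_le _ _ _).trans (add_le_add a₄ b₄)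
    · exact (abs_sub_le _ _ _).trans (add_le_add a₅ b₅)
  lam_le x y := by
    have h := (G.compDist_le_iff.1 (le_refl (G.compDist x y))).2.2.2.2
    rw [abs_sub_comm] at h
    exact (le_abs_self _).trans h
  lam_s := by simp [compLam, fst, mid, lst, G.lam_s]
  lam_t := by simp [compLam, fst, mid, lst, G.lam_t]; norm_num

/-- The scale of the copies of `G` in phase `i`. -/
noncomputable def scale (i : Fin 3) : ℝ := if i = 1 then 1 / 5 else 2 / 5

theorem comp_d_le (z : Bool) (i : Fin 3) (p q : M) :
    G.comp.d (z, i, p) (z, i, q) ≤ scale i * G.d p q := by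
  have h₁ := G.lam_le p q
  have h₂ := G.lam_le q p
  rw [G.d_comm] at h₂
  have h₀ := G.d_nonneg p q
  refine G.compDist_le_iff.2 ?_
  fin_cases i <;> cases z <;>
    simp [fst, mid, lst, side, compLam, scale, G.d_self, abs_le] <;>
    (repeat' constructor) <;> linarith

theorem comp_lam_sub (z z' : Bool) (i : Fin 3) (p q : M) :
    G.comp.lam (z', i, q) - G.comp.lam (z, i, p) = scale i * (G.lam q - G.lam p) := by
  fin_cases i <;> simp [comp, fst, mid, lst, compLam, scale] <;> ring

theorem scale_mul_le_comp_d (z z' : Bool) (i : Fin 3) (p q : M) :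
    scale i * G.d p q ≤ G.comp.d (z, i, p) (z', i, q) := by
  obtain ⟨h₁, h₂, h₃, -, -⟩ := G.compDist_le_iff.1 (le_refl (G.compDist (z, i, p) (z', i, q)))
  change _ ≤ G.compDist _ _
  fin_cases i <;> simp [fst, mid, lst, scale] at * <;> assumption

theorem le_comp_d_cross (z : Bool) (p q : M) :
    4 / 5 ≤ G.comp.d (z, 1, p) (!z, 1, q) := by
  obtain ⟨-, -, -, h, -⟩ := G.compDist_le_iff.1 (le_refl (G.compDist (z, 1, p) (!z, 1, q)))
  change _ ≤ G.compDist _ _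
  refine le_trans ?_ h
  cases z <;> simp [side, fst, lst, G.lam_s, G.lam_t, le_abs] <;> norm_num

theorem comp_d_port₀₁ (z : Bool) : G.comp.d (z, 0, G.t) (z, 1, G.s) ≤ 0 :=
  G.compDist_le_iff.2 (by simp [fst, mid, lst, side, compLam, G.d_self])

theorem comp_d_port₁₂ (z : Bool) : G.comp.d (z, 1, G.t) (z, 2, G.s) ≤ 0 :=
  G.compDist_le_iff.2 (by simp [fst, mid, lst, side, compLam, G.d_self])

theorem comp_d_source (z z' : Bool) : G.comp.d (z, 0, G.s) (z', 0, G.s) ≤ 0 :=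
  G.compDist_le_iff.2 (by simp [fst, mid, lst, side, compLam, G.d_self])

theorem comp_d_sink (z z' : Bool) : G.comp.d (z, 2, G.t) (z', 2, G.t) ≤ 0 :=
  G.compDist_le_iff.2 (by simp [fst, mid, lst, side, compLam, G.d_self])

end Comp

section Phases

variable {k : ℕ}

/-- The points of the arms in `Z` and the phase `i` lying over `r`. -/
def layer (Z : Finset Bool) (i : Fin 3) (r : Finset M) : Finset (Bool × Fin 3 × M) :=
  Z ×ˢ ({i} ×ˢ r)

theorem mem_layer {Z : Finset Bool} {i : Fin 3} {r : Finset M} {x : Bool × Fin 3 × M} :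
    x ∈ layer Z i r ↔ x.1 ∈ Z ∧ x.2.1 = i ∧ x.2.2 ∈ r := by
  simp only [layer, Finset.mem_product, Finset.mem_singleton]

theorem card_layer (Z : Finset Bool) (i : Fin 3) (r : Finset M) :
    (layer Z i r).card = Z.card * r.card := by
  simp [layer]

/-- A set `rA` in the middle of the arm `z` together with a set `rB` in the middle of the other
arm. -/
noncomputable def pair (z : Bool) (rA rB : Finset M) : Finset (Bool × Fin 3 × M) :=
  layer {z} 1 rA ∪ layer {!z} 1 rB

theorem mem_pair {z : Bool} {rA rB : Finset M} {x : Bool × Fin 3 × M} :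
    x ∈ pair z rA rB ↔ x.1 = z ∧ x.2.1 = 1 ∧ x.2.2 ∈ rA ∨ x.1 = !z ∧ x.2.1 = 1 ∧ x.2.2 ∈ rB := by
  simp [pair, mem_layer]

theorem forall_mem_pair {z : Bool} {rA rB : Finset M} {P : Bool × Fin 3 × M → Prop} :
    (∀ x ∈ pair z rA rB, P x) ↔ (∀ p ∈ rA, P (z, 1, p)) ∧ ∀ p ∈ rB, P (!z, 1, p) := by
  simp only [mem_pair]
  constructor
  · intro h
    exact ⟨fun p hp => h _ (by simp [hp]), fun p hp => h _ (by simp [hp])⟩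
  · rintro ⟨h₁, h₂⟩ ⟨x, i, p⟩ (⟨rfl, rfl, hp⟩ | ⟨rfl, rfl, hp⟩)
    exacts [h₁ _ hp, h₂ _ hp]

theorem pair_not (z : Bool) (rA rB : Finset M) : pair (!z) rB rA = pair z rA rB := by
  ext x
  simp only [mem_pair, Bool.not_not]
  exact or_comm

/-- The lower bound on the middle phase: functions `f` and `g` on the arms `z` and `!z`. -/
noncomputable def midBound (z : Bool) (K : ℝ) (f g : M → ℝ) (x : Bool × Fin 3 × M) : ℝ :=
  K + (if x.1 = z then f x.2.2 else g x.2.2) / 5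

theorem midBound_left (z : Bool) (K : ℝ) (f g : M → ℝ) (i : Fin 3) (p : M) :
    midBound z K f g (z, i, p) = K + f p / 5 := by
  simp [midBound]

theorem midBound_right (z : Bool) (K : ℝ) (f g : M → ℝ) (i : Fin 3) (p : M) :
    midBound z K f g (!z, i, p) = K + g p / 5 := by
  simp [midBound]

theorem midBound_not (z : Bool) (K : ℝ) (f g : M → ℝ) :
    midBound (!z) K g f = midBound z K f g := by
  ext ⟨x, i, p⟩
  cases x <;> cases z <;> simp [midBound]

variable (G) in
/-- The conditions on one arm during the middle phase. -/
structure Arm (k : ℕ) (w : ℝ) (r S : Finset M) (f : M → ℝ) : Prop where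
  nonempty : r.Nonempty
  card_le : r.card ≤ k
  subset : S ⊆ r
  lower : ∀ p ∈ r, w - 2 ≤ f p
  upper : ∀ p ∈ r, f p ≤ w + 2
  lip : ∀ p ∈ r, ∀ q ∈ r, f p ≤ f q + G.d p q

theorem State.arm {h c w : ℝ} {r S : Finset M} {φ : M → ℝ} (st : G.State k h r S φ)
    (h₁ : w ≤ h + c + 1) (h₂ : h + c ≤ w + 2) : G.Arm k w r S (fun p => φ p + c) where
  nonempty := st.nonempty
  card_le := st.card_le
  subset := st.subset
  lower p hp := by linarith [st.lower p hp]
  upper p hp := by linarith [st.upper p hp]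
  lip p hp q hq := by linarith [st.lip p hp q hq]

theorem Arm.state {w K : ℝ} {z : Bool} {rA SA rB SB : Finset M} {f g : M → ℝ}
    (hA : G.Arm k w rA SA f) (hB : G.Arm k w rB SB g) :
    G.comp.State (2 * k) (K + (w + 2) / 5) (pair z rA rB) (pair z SA SB) (midBound z K f g) where
  nonempty := by
    obtain ⟨p, hp⟩ := hA.nonempty
    exact ⟨(z, 1, p), by simp [mem_pair, hp]⟩
  card_le := by
    refine (Finset.card_union_le _ _).trans ?_
    have h₁ := hA.card_le
    have h₂ := hB.card_le
    simp only [card_layer, Finset.card_singleton]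
    omega
  subset := by
    rw [Finset.subset_iff, forall_mem_pair]
    constructor
    · intro p hp
      simp [mem_pair, hA.subset hp]
    · intro p hp
      simp [mem_pair, hB.subset hp]
  lower := by
    simp only [forall_mem_pair, midBound_left, midBound_right]
    exact ⟨fun p hp => by linarith [hA.lower p hp], fun p hp => by linarith [hB.lower p hp]⟩
  upper := by
    simp only [forall_mem_pair, midBound_left, midBound_right]
    exact ⟨fun p hp => by linarith [hA.upper p hp], fun p hp => by linarith [hB.upper p hp]⟩
  lip := by
    simp only [forall_mem_pair, midBound_left, midBound_right]
    refine ⟨fun p hp => ⟨fun q hq => ?_, fun q hq => ?_⟩, fun p hp => ⟨fun q hq => ?_, fun q hq => ?_⟩⟩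
    · have h := G.scale_mul_le_comp_d z z 1 p q
      simp only [scale, if_true] at h
      linarith [hA.lip p hp q hq]
    · linarith [hA.upper p hp, hB.lower q hq, G.le_comp_d_cross z p q]
    · have h := G.le_comp_d_cross z q p
      rw [G.comp.d_comm] at h
      linarith [hB.upper p hp, hA.lower q hq]
    · have h := G.scale_mul_le_comp_d (!z) (!z) 1 p q
      simp only [scale, if_true] at h
      linarith [hB.lip p hp q hq]

variable (G) in
/-- The conditions on one arm for a request during the middle phase. -/
structure Step (r S : Finset M) (f : M → ℝ) (r' S' : Finset M) (f' : M → ℝ) : Prop where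
  cert : ∀ p ∈ r, ∀ q ∈ r', f p ≤ G.d p q + f' q
  off : ∀ q ∈ S', ∃ p ∈ S, G.d p q ≤ G.lam q - G.lam p

theorem Arm.stay {w : ℝ} {r S : Finset M} {f : M → ℝ} (h : G.Arm k w r S f) :
    G.Step r S f r S f where
  cert p hp q hq := by linarith [h.lip p hp q hq]
  off q hq := ⟨q, hq, by simp [G.d_self]⟩

/-- The state before a request is winning if the state after it is, provided that either arm
obeys the conditions and `f` (resp. `g`) exceeds the new bound on the other arm by at most `4`. -/
theorem Win.midStep {H H' K w w' : ℝ} {z : Bool} {rA SA rB SB rA' SA' rB' SB' : Finset M}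
    {f g f' g' : M → ℝ} (hA : G.Arm k w rA SA f) (hB : G.Arm k w rB SB g)
    (sA : G.Step rA SA f rA' SA' f') (sB : G.Step rB SB g rB' SB' g')
    (hw : w' ≤ w) (hw' : w - 2 ≤ w')
    (cAB : ∀ p ∈ rA, ∀ q ∈ rB', f p ≤ g' q + 4) (cBA : ∀ p ∈ rB, ∀ q ∈ rA', g p ≤ f' q + 4)
    (hH : H = K + (w + 2) / 5) (hH' : H' = K + (w' + 2) / 5)
    (next : G.comp.Win (2 * k) H' (pair z rA' rB') (pair z SA' SB') (midBound z K f' g')) :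
    G.comp.Win (2 * k) H (pair z rA rB) (pair z SA SB) (midBound z K f g) := by
  subst hH hH'
  refine .req (hA.state hB) (by linarith) (by linarith) ?_ ?_ next
  · simp only [forall_mem_pair, midBound_left, midBound_right]
    refine ⟨fun p hp => ⟨fun q hq => ?_, fun q hq => ?_⟩, fun p hp => ⟨fun q hq => ?_, fun q hq => ?_⟩⟩
    · have h := G.scale_mul_le_comp_d z z 1 p q
      simp only [scale, if_true] at h
      linarith [sA.cert p hp q hq]
    · linarith [cAB p hp q hq, G.le_comp_d_cross z p q]
    · have h := G.le_comp_d_cross z q p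
      rw [G.comp.d_comm] at h
      linarith [cBA p hp q hq]
    · have h := G.scale_mul_le_comp_d (!z) (!z) 1 p q
      simp only [scale, if_true] at h
      linarith [sB.cert p hp q hq]
  · rw [forall_mem_pair]
    constructor <;> intro q hq
    · obtain ⟨p, hp, h⟩ := sA.off q hq
      refine ⟨(z, 1, p), by simp [mem_pair, hp], ?_⟩
      rw [comp_lam_sub]
      exact (G.comp_d_le z 1 p q).trans (mul_le_mul_of_nonneg_left h (by simp [scale]))
    · obtain ⟨p, hp, h⟩ := sB.off q hq
      refine ⟨(!z, 1, p), by simp [mem_pair, hp], ?_⟩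
      rw [comp_lam_sub]
      exact (G.comp_d_le (!z) 1 p q).trans (mul_le_mul_of_nonneg_left h (by simp [scale]))

/-- Playing the game of the arm `z` until its window reaches the threshold `thr`. -/
theorem Win.hit {K thr c w h : ℝ} {z : Bool} {r S rI SI : Finset M} {φ g : M → ℝ}
    (hthr : 0 ≤ thr) (hw : w = thr + c) (hI : G.Arm k w rI SI g)
    (cont : ∀ h r S φ, thr - 1 ≤ h → h ≤ thr → G.Win k h r S φ →
      G.comp.Win (2 * k) (K + (w + 2) / 5) (pair z r rI) (pair z S SI)
        (midBound z K (fun p => φ p + c) g))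
    (W : G.Win k h r S φ) (h₁ : thr - 1 ≤ h) (h₂ : h ≤ thr + 2) :
    G.comp.Win (2 * k) (K + (w + 2) / 5) (pair z r rI) (pair z S SI)
      (midBound z K (fun p => φ p + c) g) := by
  induction W with
  | done st ht => exact cont _ _ _ _ h₁ hthr (.done st ht)
  | @req h r S φ h' r' S' φ' st hle hge cert off next ih =>
    rcases le_or_gt h thr with hh | hh
    · exact cont _ _ _ _ h₁ hh (.req st hle hge cert off next)
    have a₁ : G.Arm k w r S (fun p => φ p + c) := st.arm (by linarith) (by linarith)
    have a₂ : G.Arm k w r' S' (fun p => φ' p + c) := next.state.arm (by linarith) (by linarith)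
    exact midStep a₁ hI ⟨fun p hp q hq => by linarith [cert p hp q hq], off⟩ hI.stay le_rfl
      (by linarith) (fun p hp q hq => by linarith [a₁.upper p hp, hI.lower q hq])
      (fun p hp q hq => by linarith [hI.upper p hp, a₂.lower q hq]) rfl rfl
      (ih (by linarith) (by linarith))
  | @coin h r S φ h₁ h₂ φ₁ φ₂ st hle₁ hge₁ hle₂ hge₂ avg next₁ next₂ ih₁ ih₂ =>
    rcases le_or_gt h thr with hh | hh
    · exact cont _ _ _ _ h₁ hh (.coin st hle₁ hge₁ hle₂ hge₂ avg next₁ next₂)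
    have a₁ : G.Arm k w r S (fun p => φ p + c) := st.arm (by linarith) (by linarith)
    refine .coin (a₁.state hI) le_rfl (by linarith) le_rfl (by linarith) ?_
      (ih₁ (by linarith) (by linarith)) (ih₂ (by linarith) (by linarith))
    simp only [forall_mem_pair, midBound_left, midBound_right]
    exact ⟨fun p hp => by linarith [avg p hp], fun p hp => by linarith⟩

theorem singleton_arm (hk : 1 ≤ k) {w a : ℝ} (h₁ : w - 2 ≤ a) (h₂ : a ≤ w + 2) (p : M) :
    G.Arm k w {p} ∅ (fun _ => a) where
  nonempty := Finset.singleton_nonempty p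
  card_le := by simpa using hk
  subset := Finset.empty_subset _
  lower _ _ := h₁
  upper _ _ := h₂
  lip p _ q _ := by linarith [G.d_nonneg p q]

/-- Playing out the game of the arm `!z` once the arm `z` has lost, up to the last phase. -/
theorem Win.complete {C h₀ h : ℝ} {z : Bool} {rL SL r S : Finset M} {f φ : M → ℝ}
    (hC : C ≤ h₀) (hC' : h₀ ≤ C + 1) (hL : G.Arm k 0 rL SL f) (hf : ∀ p ∈ rL, f p ≤ 0)
    (last : G.comp.Win (2 * k) (h₀ * (2 / 5)) (layer Finset.univ 2 {G.s}) (layer {!z} 2 {G.s})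
      (fun _ => C * (2 / 5)))
    (W : G.Win k h r S φ) (hh : h ≤ 0) :
    G.comp.Win (2 * k) (C * (2 / 5) + 2 / 5) (pair z rL r) (pair z SL S)
      (midBound z (C * (2 / 5)) f φ) := by
  have arm : ∀ {h r S φ}, G.Win k h r S φ → h ≤ 0 → G.Arm k 0 r S φ := fun W hh => by
    simpa using W.state.arm (c := 0) (w := 0) (by linarith [W.nonneg]) (by linarith)
  have cap : C * (2 / 5) + 2 / 5 = C * (2 / 5) + (0 + 2) / 5 := by norm_num
  induction W with
  | done st ht =>
    rw [cap]
    refine .req (hL.state (arm (.done st ht) hh)) (by linarith) (by linarith) ?_ ?_ last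
    · simp only [forall_mem_pair, midBound_left, midBound_right]
      exact ⟨fun p hp q _ => by linarith [hf p hp, G.comp.d_nonneg (z, 1, p) q],
        fun p hp q _ => by linarith [st.upper p hp, G.comp.d_nonneg (!z, 1, p) q]⟩
    · rintro ⟨z', i, q⟩ hq
      simp only [mem_layer, Finset.mem_singleton] at hq
      obtain ⟨rfl, rfl, rfl⟩ := hq
      refine ⟨(!z, 1, G.t), by simp [mem_pair, ht], (G.comp_d_port₁₂ _).trans ?_⟩
      simp [comp, compLam, fst, mid, lst]
  | @req h r S φ h' r' S' φ' st hle hge cert off next ih =>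
    have a₁ := arm (.req st hle hge cert off next) hh
    have a₂ := arm next (hle.trans hh)
    exact midStep hL a₁ hL.stay ⟨cert, off⟩ le_rfl (by norm_num)
      (fun p hp q hq => by linarith [hL.upper p hp, a₂.lower q hq])
      (fun p hp q hq => by linarith [a₁.upper p hp, hL.lower q hq]) cap cap (ih (hle.trans hh))
  | @coin h r S φ h₁ h₂ φ₁ φ₂ st hle₁ hge₁ hle₂ hge₂ avg next₁ next₂ ih₁ ih₂ =>
    have a₁ := arm (.coin st hle₁ hge₁ hle₂ hge₂ avg next₁ next₂) hh
    have st' := hL.state (K := C * (2 / 5)) (z := z) a₁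
    rw [← cap] at st'
    refine .coin st' le_rfl (by linarith) le_rfl (by linarith) ?_
      (ih₁ (hle₁.trans hh)) (ih₂ (hle₂.trans hh))
    simp only [forall_mem_pair, midBound_left, midBound_right]
    exact ⟨fun p hp => by linarith, fun p hp => by linarith [avg p hp]⟩

/-- The end of a race: the arm `z` has lost and is hit until the game of `!z` is played out. -/
theorem Win.final {C h₀ y : ℝ} {z : Bool} (hk : 1 ≤ k) (hC : C ≤ h₀) (hC' : h₀ ≤ C + 1)
    (hy : 1 ≤ y) (hy' : y ≤ 2)
    (last : G.comp.Win (2 * k) (h₀ * (2 / 5)) (layer Finset.univ 2 {G.s}) (layer {!z} 2 {G.s})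
      (fun _ => C * (2 / 5))) (β : ℕ) :
    ∀ {h : ℝ} {rL SL r S : Finset M} {f φ : M → ℝ}, G.Arm k (β * y) rL SL f →
      (∀ p ∈ rL, f p ≤ β * y) → G.Win k h r S φ → β * y - 1 ≤ h → h ≤ β * y →
      G.comp.Win (2 * k) (C * (2 / 5) + (β * y + 2) / 5) (pair z rL r) (pair z SL S)
        (midBound z (C * (2 / 5)) f φ) := by
  induction β with
  | zero =>
    intro h rL SL r S f φ hL hf W _ hh
    simp only [Nat.cast_zero, zero_mul, zero_add] at *
    exact complete hC hC' hL hf last W hh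
  | succ β ih =>
    intro h rL SL r S f φ hL hf W h₁ h₂
    push_cast at *
    set w : ℝ := (β + 1) * y with hw
    have hw' : (β : ℝ) * y = w - y := by rw [hw]; ring
    have hβ : 0 ≤ (β : ℝ) * y := by positivity
    have aR : G.Arm k w r S φ := by
      simpa using W.state.arm (c := 0) (w := w) (by linarith) (by linarith)
    have step : ∀ {r S : Finset M} {f : M → ℝ} {a : ℝ} {q : M},
        (∀ p ∈ r, f p ≤ G.d p q + a) → G.Step r S f {q} ∅ (fun _ => a) := fun H =>
      ⟨fun p hp q' hq' => by rw [Finset.mem_singleton.1 hq']; exact H p hp, by simp⟩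
    have hd := G.one_le_d
    have arm₀ := singleton_arm (G := G) hk (w := w) (a := w) (by linarith) (by linarith) G.s
    have arm₁ := singleton_arm (G := G) hk (w := w) (a := w - 1) (by linarith) (by linarith) G.t
    have arm₂ := singleton_arm (G := G) hk (w := w - y) (a := w - 2) (by linarith) (by linarith) G.s
    have lowR : ∀ q ∈ r, w - 2 ≤ φ q := aR.lower
    have upR : ∀ q ∈ r, φ q ≤ w := fun q hq => by linarith [W.state.upper q hq]
    refine midStep hL aR (step (a := w) (q := G.s) fun p hp => by linarith [hf p hp, G.d_nonneg p G.s]) aR.stay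
      le_rfl (by linarith) (fun p hp q hq => by linarith [hf p hp, lowR q hq])
      (fun p hp q _ => by linarith [upR p hp]) rfl rfl ?_
    refine midStep arm₀ aR (step (a := w - 1) (q := G.t) fun p hp => ?_) aR.stay
      le_rfl (by linarith) (fun p hp q hq => by linarith [lowR q hq])
      (fun p hp q _ => by linarith [upR p hp]) rfl rfl ?_
    · rw [Finset.mem_singleton.1 hp]; linarith
    refine midStep (w' := w - y) arm₁ aR (step (a := w - 2) (q := G.s) fun p hp => ?_) aR.stay
      (by linarith) (by linarith) (fun p hp q hq => by linarith [lowR q hq])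
      (fun p hp q _ => by linarith [upR p hp]) rfl rfl ?_
    · rw [Finset.mem_singleton.1 hp, G.d_comm]; linarith
    have key := W.hit (K := C * (2 / 5)) (thr := w - y) (c := 0) (w := w - y) (z := !z)
      (by linarith) (by ring) arm₂ ?_ (by linarith) (by linarith)
    · rw [pair_not, pair_not, midBound_not] at key
      simpa using key
    · intro h r S φ h₁ h₂ W
      simp only [add_zero, pair_not, midBound_not]
      rw [hw'] at ih
      exact ih arm₂ (fun _ _ => by linarith) W h₁ h₂

/-- The race between the two arms, which have `a` and `b` progress hits left. -/
theorem Win.race {C h₀ y : ℝ} (hk : 1 ≤ k) (hC : C ≤ h₀) (hC' : h₀ ≤ C + 1)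
    (hy : 1 ≤ y) (hy' : y ≤ 2)
    (last : ∀ z, G.comp.Win (2 * k) (h₀ * (2 / 5)) (layer Finset.univ 2 {G.s}) (layer {z} 2 {G.s})
      (fun _ => C * (2 / 5))) (n : ℕ) :
    ∀ (a b : ℕ) (z : Bool) {h h' : ℝ} {r S r' S' : Finset M} {φ φ' : M → ℝ}, a + b = n →
      G.Win k h r S φ → a * y - 1 ≤ h → h ≤ a * y →
      G.Win k h' r' S' φ' → b * y - 1 ≤ h' → h' ≤ b * y →
      G.comp.Win (2 * k) (C * (2 / 5) + (raceValue a b * y + 2) / 5) (pair z r r') (pair z S S')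
        (midBound z (C * (2 / 5)) (fun p => φ p + (raceValue a b * y - a * y))
          (fun p => φ' p + (raceValue a b * y - b * y))) := by
  have fin : ∀ (b : ℕ) (z : Bool) {h h' : ℝ} {r S r' S' : Finset M} {φ φ' : M → ℝ},
      G.Win k h r S φ → -1 ≤ h → h ≤ 0 →
      G.Win k h' r' S' φ' → b * y - 1 ≤ h' → h' ≤ b * y →
      G.comp.Win (2 * k) (C * (2 / 5) + (b * y + 2) / 5) (pair z r r') (pair z S S')
        (midBound z (C * (2 / 5)) (fun p => φ p + b * y) φ') :=
    fun b z {h h' r S r' S' φ φ'} W h₁ h₂ W' h₁' h₂' =>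
      final hk hC hC' hy hy' (last _) b (W.state.arm (by linarith) (by linarith))
        (fun p hp => by linarith [W.state.upper p hp]) W' h₁' h₂'
  induction n with
  | zero =>
    intro a b z h h' r S r' S' φ φ' hab W h₁ h₂ W' h₁' h₂'
    obtain ⟨rfl, rfl⟩ : a = 0 ∧ b = 0 := by omega
    simpa [raceValue_zero_left] using fin 0 z W (by simpa using h₁) (by simpa using h₂) W' h₁' h₂'
  | succ n ih =>
    intro a b z h h' r S r' S' φ φ' hab W h₁ h₂ W' h₁' h₂'
    rcases a with _ | a
    · simpa [raceValue_zero_left] using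
        fin b z W (by simpa using h₁) (by simpa using h₂) W' h₁' h₂'
    rcases b with _ | b
    · have key := fin (a + 1) (!z) W' (by simpa using h₁') (by simpa using h₂') W h₁ h₂
      rw [pair_not, pair_not, midBound_not] at key
      simpa [raceValue_zero_right] using key
    set v := raceValue (a + 1) (b + 1) with hv
    set v₁ := raceValue a (b + 1) with hv₁
    set v₂ := raceValue (a + 1) b with hv₂
    have hvv : v = (v₁ + v₂) / 2 + 1 / 2 := raceValue_succ_succ a b
    have b₁ := raceValue_succ_left a (b + 1)
    have b₂ := raceValue_succ_right (a + 1) b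
    rw [← hv, ← hv₁] at b₁
    rw [← hv, ← hv₂] at b₂
    have m₁ : v * y - 2 ≤ v₁ * y := by nlinarith
    have m₁' : v₁ * y ≤ v * y := by nlinarith
    have m₂ : v * y - 2 ≤ v₂ * y := by nlinarith
    have m₂' : v₂ * y ≤ v * y := by nlinarith
    have hay : 0 ≤ (a : ℝ) * y := by positivity
    have hby : 0 ≤ (b : ℝ) * y := by positivity
    push_cast at h₁ h₂ h₁' h₂'
    have w₁ := W.hit (K := C * (2 / 5)) (thr := a * y) (c := v₁ * y - a * y) (w := v₁ * y) (z := z)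
      hay (by ring) (W'.state.arm (c := v₁ * y - (b + 1) * y) (by linarith) (by linarith))
      (fun h r S φ h₁ h₂ W => by
        have := ih a (b + 1) z (by omega) W h₁ h₂ W' (by push_cast; linarith)
          (by push_cast; linarith)
        push_cast at this
        exact this) (by linarith) (by linarith)
    have w₂ := W'.hit (K := C * (2 / 5)) (thr := b * y) (c := v₂ * y - b * y) (w := v₂ * y)
      (z := !z) hby (by ring) (W.state.arm (c := v₂ * y - (a + 1) * y) (by linarith) (by linarith))
      (fun h r S φ h₁ h₂ W' => by
        have := ih (a + 1) b z (by omega) W (by push_cast; linarith) (by push_cast; linarith)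
          W' h₁ h₂
        push_cast at this
        rw [pair_not, pair_not, midBound_not]
        exact this) (by linarith) (by linarith)
    rw [pair_not, pair_not, midBound_not] at w₂
    push_cast
    refine .coin ((W.state.arm (by linarith) (by linarith)).state
      (W'.state.arm (by linarith) (by linarith))) (by linarith) (by linarith) (by linarith)
      (by linarith) ?_ w₁ w₂
    have hvy : v * y = (v₁ * y + v₂ * y) / 2 + y / 2 := by rw [hvv]; ring
    simp only [forall_mem_pair, midBound_left, midBound_right]
    exact ⟨fun p _ => by linarith, fun p _ => by linarith⟩

theorem State.sync {H K h : ℝ} {i : Fin 3} (hi : i ≠ 1) {Z : Finset Bool} {r S : Finset M}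
    {φ : M → ℝ} (hK : K ≤ H) (hK' : H ≤ K + 3 / 5) (st : G.State k h r S φ) :
    G.comp.State (2 * k) (h * (2 / 5) + H) (layer Finset.univ i r) (layer Z i S)
      (fun x => φ x.2.2 * (2 / 5) + K) where
  nonempty := by
    obtain ⟨p, hp⟩ := st.nonempty
    exact ⟨(true, i, p), by simp [mem_layer, hp]⟩
  card_le := by
    rw [card_layer]
    exact Nat.mul_le_mul (by simp) st.card_le
  subset x := by
    simp only [mem_layer, Finset.mem_univ, true_and]
    exact fun ⟨_, h₂, h₃⟩ => ⟨h₂, st.subset h₃⟩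
  lower x hx := by linarith [st.lower _ (mem_layer.1 hx).2.2]
  upper x hx := by linarith [st.upper _ (mem_layer.1 hx).2.2]
  lip := by
    rintro ⟨z, j, p⟩ hx ⟨z', j', q⟩ hy
    obtain ⟨-, rfl, hp⟩ := mem_layer.1 hx
    obtain ⟨-, rfl, hq⟩ := mem_layer.1 hy
    have h := G.scale_mul_le_comp_d z z' j' p q
    rw [show scale j' = 2 / 5 by simp [scale, show j' ≠ 1 from hi]] at h
    linarith [st.lip p hp q hq]

/-- Playing the same game in both arms of the first or the last phase. -/
theorem Win.sync {H K h : ℝ} {i : Fin 3} (hi : i ≠ 1) {Z : Finset Bool} {r S : Finset M}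
    {φ : M → ℝ} (hK : K ≤ H) (hK' : H ≤ K + 3 / 5)
    (cont : ∀ r S φ, G.State k 0 r S φ → G.t ∈ S →
      G.comp.Win (2 * k) H (layer Finset.univ i r) (layer Z i S)
        (fun x => φ x.2.2 * (2 / 5) + K))
    (W : G.Win k h r S φ) :
    G.comp.Win (2 * k) (h * (2 / 5) + H) (layer Finset.univ i r) (layer Z i S)
      (fun x => φ x.2.2 * (2 / 5) + K) := by
  have hs : scale i = 2 / 5 := by simp [scale, hi]
  induction W with
  | @done r S φ st ht => simpa using cont r S φ st ht
  | @req h r S φ h' r' S' φ' st hle hge cert off next ih =>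
    refine .req (st.sync hi hK hK') (by linarith) (by linarith) ?_ ?_ ih
    · rintro ⟨z, j, p⟩ hx ⟨z', j', q⟩ hy
      obtain ⟨-, rfl, hp⟩ := mem_layer.1 hx
      obtain ⟨-, rfl, hq⟩ := mem_layer.1 hy
      have h := G.scale_mul_le_comp_d z z' j' p q
      rw [hs] at h
      linarith [cert p hp q hq]
    · rintro ⟨z, j, q⟩ hy
      obtain ⟨hz, rfl, hq⟩ := mem_layer.1 hy
      obtain ⟨p, hp, h⟩ := off q hq
      refine ⟨(z, j, p), mem_layer.2 ⟨hz, rfl, hp⟩, (G.comp_d_le z j p q).trans ?_⟩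
      rw [comp_lam_sub, hs]
      linarith
  | @coin h r S φ h₁ h₂ φ₁ φ₂ st hle₁ hge₁ hle₂ hge₂ avg next₁ next₂ ih₁ ih₂ =>
    refine .coin (st.sync hi hK hK') (by linarith) (by linarith) (by linarith) (by linarith) ?_ ih₁ ih₂
    intro x hx
    linarith [avg _ (mem_layer.1 hx).2.2]

theorem singleton_state {h c : ℝ} (hk : 1 ≤ k) (h₁ : h - 1 ≤ c) (h₂ : c ≤ h) (p : M) :
    G.State k h {p} {p} (fun _ => c) where
  nonempty := Finset.singleton_nonempty p
  card_le := by simpa using hk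
  subset := subset_rfl
  lower _ _ := h₁
  upper _ _ := h₂
  lip p _ q _ := by linarith [G.d_nonneg p q]

/-- The last phase of the composite game. -/
theorem Win.lastPhase {C h₀ : ℝ} (hk : 1 ≤ k) (W : G.Win k h₀ {G.s} {G.s} (fun _ => C))
    (z : Bool) :
    G.comp.Win (2 * k) (h₀ * (2 / 5)) (layer Finset.univ 2 {G.s}) (layer {z} 2 {G.s})
      (fun _ => C * (2 / 5)) := by
  have key := W.sync (H := 0) (K := 0) (i := 2) (Z := {z}) (by decide) le_rfl (by norm_num) ?_
  · simpa using key
  intro r S φ st ht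
  refine .req (h' := 0) (r' := {G.comp.t}) (S' := {G.comp.t}) (φ' := fun _ => 0) ?_ le_rfl
    (by norm_num) ?_ ?_ (.done (singleton_state (by omega) (by norm_num) le_rfl _) (by simp))
  · simpa using st.sync (H := 0) (K := 0) (i := 2) (by decide) le_rfl (by norm_num)
  · intro x hx y _
    linarith [st.upper _ (mem_layer.1 hx).2.2, G.comp.d_nonneg x y]
  · intro q hq
    rw [Finset.mem_singleton.1 hq]
    refine ⟨(z, 2, G.t), by simp [mem_layer, ht], (G.comp_d_sink z true).trans ?_⟩
    simp [comp, compLam, fst, mid, lst]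

end Phases

/-- The lower bound grows by a multiple of its square root in the composite gadget. -/
theorem Win.exists_comp {k : ℕ} {C h₀ : ℝ} (hk : 1 ≤ k)
    (W : G.Win k h₀ {G.s} {G.s} (fun _ => C)) (hC₁ : 1 ≤ C) (hC : C ≤ h₀) (hC' : h₀ ≤ C + 1) :
    ∃ C' h₀', C + √C / 40 ≤ C' ∧ C' ≤ h₀' ∧ h₀' ≤ C' + 1 ∧
      G.comp.Win (2 * k) h₀' {G.comp.s} {G.comp.s} (fun _ => C') := by
  obtain ⟨N, y, hN, hy, hy', rfl⟩ : ∃ (N : ℕ) (y : ℝ), 1 ≤ N ∧ 1 ≤ y ∧ y ≤ 2 ∧ h₀ = N * y := by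
    have h₁ : 1 ≤ ⌊h₀⌋₊ := Nat.one_le_floor_iff h₀ |>.2 (by linarith)
    have h₂ : (1 : ℝ) ≤ ⌊h₀⌋₊ := by exact_mod_cast h₁
    refine ⟨⌊h₀⌋₊, h₀ / ⌊h₀⌋₊, h₁, ?_, ?_, ?_⟩
    · rw [le_div_iff₀ (by linarith), one_mul]
      exact Nat.floor_le (by linarith)
    · rw [div_le_iff₀ (by linarith)]
      linarith [Nat.lt_floor_add_one h₀]
    · field_simp
  set v := raceValue N N with hv
  have hvN := add_sqrt_le_raceValue hN
  rw [← hv] at hvN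
  have hsqrt : √C ≤ y * √(2 * N) := by
    rw [← Real.sqrt_sq (by linarith : 0 ≤ y), ← Real.sqrt_mul (sq_nonneg y)]
    refine Real.sqrt_le_sqrt ?_
    nlinarith [Nat.cast_nonneg (α := ℝ) N]
  have race := Win.race hk hC hC' hy hy' (W.lastPhase hk) (N + N) N N true rfl W (by linarith) le_rfl
    W (by linarith) le_rfl
  rw [← hv] at race
  set K := C * (2 / 5) + (v * y + C - N * y) / 5 with hK
  set H := C * (2 / 5) + (v * y + 2) / 5 with hH
  have first := W.sync (H := H) (K := K) (i := 0) (Z := Finset.univ) (by decide) (by linarith)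
    (by linarith) ?_
  · refine ⟨C * (2 / 5) + K, N * y * (2 / 5) + H, ?_, by linarith, by linarith, ?_⟩
    · nlinarith
    refine .req (singleton_state (by omega) (by linarith) (by linarith) _) le_rfl (by linarith)
      (fun p _ q _ => by linarith [G.comp.d_nonneg p q]) ?_ first
    rintro ⟨z, i, q⟩ hq
    simp only [mem_layer, Finset.mem_singleton] at hq
    obtain ⟨-, rfl, rfl⟩ := hq
    refine ⟨G.comp.s, Finset.mem_singleton_self _, (G.comp_d_source true z).trans ?_⟩
    rw [show G.comp.s = (true, 0, G.s) from rfl, comp_lam_sub]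
    simp
  · intro r S φ st ht
    have st' := st.sync (H := H) (K := K) (i := 0) (Z := Finset.univ) (by decide) (by linarith)
      (by linarith)
    rw [zero_mul, zero_add] at st'
    refine .req st' le_rfl (by linarith) ?_ ?_ race
    · intro x hx
      have h₁ := st.upper _ (mem_layer.1 hx).2.2
      have h₂ := fun y => G.comp.d_nonneg x y
      simp only [forall_mem_pair, midBound_left, midBound_right]
      exact ⟨fun p _ => by linarith [h₂ (true, 1, p)], fun p _ => by linarith [h₂ (!true, 1, p)]⟩
    · have port : ∀ z, ∃ p ∈ layer Finset.univ 0 S,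
          G.comp.d p (z, 1, G.s) ≤ G.comp.lam (z, 1, G.s) - G.comp.lam p := fun z =>
        ⟨(z, 0, G.t), by simp [mem_layer, ht], (G.comp_d_port₀₁ z).trans
          (by simp [comp, compLam, fst, mid, lst])⟩
      simp only [forall_mem_pair, Finset.mem_singleton, forall_eq]
      exact ⟨port true, port (!true)⟩

end Gadget

/-- The gadget consisting of a source and a sink only. -/
noncomputable def Gadget.edge : Gadget Bool where
  d p q := if p = q then 0 else 1
  lam p := if p then 1 else 0
  s := false
  t := true
  d_self p := by simp
  d_comm p q := by simp only [eq_comm]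
  d_tri p q r := by cases p <;> cases q <;> cases r <;> norm_num
  lam_le p q := by cases p <;> cases q <;> norm_num
  lam_s := by simp
  lam_t := by simp

theorem Gadget.win_edge :
    edge.Win 1 1 {edge.s} {edge.s} (fun _ => 1) := by
  refine .req (h' := 0) (r' := {edge.t}) (S' := {edge.t}) (φ' := fun _ => 0)
    (singleton_state le_rfl (by norm_num) le_rfl _) (by norm_num) (by norm_num) ?_ ?_
    (.done (singleton_state le_rfl (by norm_num) le_rfl _) (by simp)) <;> simp [edge]

theorem Gadget.exists_win (w : ℕ) : ∃ (M : Type) (_ : Fintype M) (G : Gadget M) (C h₀ : ℝ),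
    Fintype.card M = 2 * 6 ^ w ∧ (1 + w / 100) ^ 2 ≤ C ∧ C ≤ h₀ ∧ h₀ ≤ C + 1 ∧
      G.Win (2 ^ w) h₀ {G.s} {G.s} (fun _ => C) := by
  induction w with
  | zero => exact ⟨Bool, inferInstance, edge, 1, 1, by simp, by simp, le_rfl, by norm_num, win_edge⟩
  | succ w ih =>
    obtain ⟨M, _, G, C, h₀, hM, hw, hC, hC', W⟩ := ih
    have hw₀ : (0 : ℝ) ≤ w := Nat.cast_nonneg w
    obtain ⟨C', h₀', h₁, h₂, h₃, W'⟩ :=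
      W.exists_comp Nat.one_le_two_pow (by nlinarith) hC hC'
    refine ⟨_, inferInstance, G.comp, C', h₀', ?_, ?_, h₂, h₃, by rwa [pow_succ']⟩
    · simp [hM]; ring
    · have h : 1 + w / 100 ≤ √C := Real.le_sqrt_of_sq_le hw
      push_cast
      nlinarith

/-! ### Request sequences -/

section Costs

variable {M : Type}

/-- The cost of `A` on `σ` after the history `l`, starting at `p`. -/
def onlineCost (d : M → M → ℝ) (A : List (Finset M) → M) :
    List (Finset M) → M → List (Finset M) → ℝ
  | _, _, [] => 0
  | l, p, r :: σ => d p (A (l ++ [r])) + onlineCost d A (l ++ [r]) (A (l ++ [r])) σ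

theorem onlineCost_eq_sum (d : M → M → ℝ) (A : List (Finset M) → M) (l σ : List (Finset M))
    (p : M) : onlineCost d A l p σ = ∑ t ∈ Finset.range σ.length,
      d (if t = 0 then p else A (l ++ σ.take t)) (A (l ++ σ.take (t + 1))) := by
  induction σ generalizing l p with
  | nil => simp [onlineCost]
  | cons r σ ih =>
    rw [onlineCost, ih, List.length_cons, Finset.sum_range_succ', add_comm]
    congr 1
    refine Finset.sum_congr rfl fun t _ => ?_
    rcases t with _ | t <;> simp

theorem mssCost_eq_onlineCost (d : M → M → ℝ) (A : List (Finset M) → M) (s : M)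
    (σ : List (Finset M)) : mssCost d A s σ = onlineCost d A [] s σ := by
  simp [mssCost, mssPoint, onlineCost_eq_sum]

theorem exists_onlineCost_append (d : M → M → ℝ) (A : List (Finset M) → M)
    (l σ : List (Finset M)) (p : M) : ∃ q, ∀ τ,
      onlineCost d A l p (σ ++ τ) = onlineCost d A l p σ + onlineCost d A (l ++ σ) q τ := by
  induction σ generalizing l p with
  | nil => exact ⟨p, fun τ => by simp [onlineCost]⟩
  | cons r σ ih =>
    obtain ⟨q, hq⟩ := ih (l ++ [r]) (A (l ++ [r]))
    refine ⟨q, fun τ => ?_⟩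
    rw [List.cons_append, onlineCost, onlineCost, hq, add_assoc, List.append_assoc,
      List.singleton_append]

/-- `σ` can be served offline from `p`, ending at `q`, at cost at most `c`. -/
def Serves (d : M → M → ℝ) : List (Finset M) → M → M → ℝ → Prop
  | [], p, q, c => p = q ∧ 0 ≤ c
  | r :: σ, p, q, c => ∃ x ∈ r, Serves d σ x q (c - d p x)

theorem Serves.mono {d : M → M → ℝ} {σ : List (Finset M)} {p q : M} {c c' : ℝ}
    (h : Serves d σ p q c) (hc : c ≤ c') : Serves d σ p q c' := by
  induction σ generalizing p c c' with
  | nil => exact ⟨h.1, h.2.trans hc⟩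
  | cons r σ ih =>
    obtain ⟨x, hx, h⟩ := h
    exact ⟨x, hx, ih h (by linarith)⟩

theorem Serves.dist_le {d : M → M → ℝ} (hd : ∀ p, d p p = 0)
    (ht : ∀ p q r, d p r ≤ d p q + d q r) {σ : List (Finset M)} {p q : M} {c : ℝ}
    (h : Serves d σ p q c) : d p q ≤ c := by
  induction σ generalizing p c with
  | nil =>
    obtain ⟨rfl, h⟩ := h
    rwa [hd]
  | cons r σ ih =>
    obtain ⟨x, hx, h⟩ := h
    linarith [ih h, ht p x q]

theorem Serves.append {d : M → M → ℝ} {σ τ : List (Finset M)} {p q m : M} {c c' : ℝ}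
    (h : Serves d σ p m c) (h' : Serves d τ m q c') : Serves d (σ ++ τ) p q (c + c') := by
  induction σ generalizing p c with
  | nil =>
    obtain ⟨rfl, h⟩ := h
    exact h'.mono (by linarith)
  | cons r σ ih =>
    obtain ⟨x, hx, h⟩ := h
    exact ⟨x, hx, (ih h).mono (by linarith)⟩

theorem Serves.exists_of_append {d : M → M → ℝ} (hd : ∀ p q, 0 ≤ d p q)
    {σ τ : List (Finset M)} {p q : M} {c : ℝ} (h : Serves d (σ ++ τ) p q c) :
    ∃ m, Serves d τ m q c := by
  induction σ generalizing p c with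
  | nil => exact ⟨p, h⟩
  | cons r σ ih =>
    obtain ⟨x, hx, h⟩ := h
    obtain ⟨m, hm⟩ := ih h
    exact ⟨m, hm.mono (by linarith [hd p x])⟩

theorem Serves.exists_mssServes {d : M → M → ℝ} {σ : List (Finset M)} {p q : M} {c : ℝ}
    (h : Serves d σ p q c) : ∃ x : ℕ → M, MssServes p σ x ∧
      ∑ t ∈ Finset.range σ.length, d (x t) (x (t + 1)) ≤ c := by
  induction σ generalizing p c with
  | nil => exact ⟨fun _ => p, ⟨rfl, fun t h => by simp at h⟩, by simpa using h.2⟩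
  | cons r σ ih =>
    obtain ⟨y, hy, h⟩ := h
    obtain ⟨x, ⟨hx₀, hx⟩, hc⟩ := ih h
    refine ⟨fun t => if t = 0 then p else x (t - 1), ⟨by simp, ?_⟩, ?_⟩
    · rintro (_ | t) ht
      · simpa [hx₀] using hy
      · simpa using hx t (by simpa using ht)
    · rw [List.length_cons, Finset.sum_range_succ']
      simp only [hx₀, Nat.add_eq_zero_iff, one_ne_zero, and_false, if_false,
        Nat.add_sub_cancel, if_true, zero_add, Nat.sub_self]
      linarith

theorem MssServes.exists_serves {d : M → M → ℝ} {σ : List (Finset M)} {p : M} {x : ℕ → M}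
    (h : MssServes p σ x) :
    ∃ q, Serves d σ p q (∑ t ∈ Finset.range σ.length, d (x t) (x (t + 1))) := by
  induction σ generalizing p x with
  | nil => exact ⟨p, rfl, by simp⟩
  | cons r σ ih =>
    obtain ⟨rfl, h⟩ := h
    obtain ⟨q, hq⟩ := ih (p := x 1) (x := fun t => x (t + 1))
      ⟨rfl, fun t ht => by simpa using h (t + 1) (by simpa using ht)⟩
    refine ⟨q, x 1, by simpa using h 0 (by simp), hq.mono ?_⟩
    rw [List.length_cons, Finset.sum_range_succ']
    simp

theorem Serves.mssOpt_le {d : M → M → ℝ} (hd : ∀ p q, 0 ≤ d p q) {σ : List (Finset M)}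
    {p q : M} {c : ℝ} (h : Serves d σ p q c) : mssOpt d p σ ≤ c := by
  obtain ⟨x, hx, hc⟩ := h.exists_mssServes
  refine le_trans (csInf_le ⟨0, ?_⟩ ⟨x, hx, rfl⟩) hc
  rintro _ ⟨y, -, rfl⟩
  exact Finset.sum_nonneg fun t _ => hd _ _

theorem Serves.le_mssOpt {d : M → M → ℝ} {σ : List (Finset M)} {p q : M} {b c : ℝ}
    (h : Serves d σ p q c) (hb : ∀ q c, Serves d σ p q c → b ≤ c) : b ≤ mssOpt d p σ := by
  obtain ⟨x, hx, -⟩ := h.exists_mssServes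
  refine le_csInf ⟨_, x, hx, rfl⟩ ?_
  rintro _ ⟨y, hy, rfl⟩
  obtain ⟨q, hq⟩ := hy.exists_serves (d := d)
  exact hb q _ hq

end Costs

/-- A finitely supported law of request sequences with requests of at most `k` points. -/
structure RequestLaw (M : Type) (k : ℕ) where
  /-- The index set. -/
  ι : Type
  /-- The index set is finite. -/
  fin : Fintype ι
  /-- The probabilities. -/
  P : ι → ℝ
  /-- The request sequences. -/
  ρ : ι → List (Finset M)
  nonneg : ∀ i, 0 ≤ P i
  sum_eq : ∑ i, P i = 1
  valid : ∀ i, ∀ r ∈ ρ i, r.Nonempty ∧ r.card ≤ k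

namespace RequestLaw

attribute [instance] RequestLaw.fin

variable {M : Type} {k : ℕ}

/-- The expectation of a functional of the request sequence. -/
noncomputable def E (L : RequestLaw M k) (f : List (Finset M) → ℝ) : ℝ :=
  ∑ i, L.P i * f (L.ρ i)

theorem E_mono (L : RequestLaw M k) {f g : List (Finset M) → ℝ} (h : ∀ i, f (L.ρ i) ≤ g (L.ρ i)) :
    L.E f ≤ L.E g :=
  Finset.sum_le_sum fun i _ => mul_le_mul_of_nonneg_left (h i) (L.nonneg i)

theorem E_const_add (L : RequestLaw M k) (a : ℝ) (f : List (Finset M) → ℝ) :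
    L.E (fun σ => a + f σ) = a + L.E f := by
  simp only [E, mul_add, Finset.sum_add_distrib, ← Finset.sum_mul, L.sum_eq, one_mul]

theorem E_add_const (L : RequestLaw M k) (a : ℝ) (f : List (Finset M) → ℝ) :
    L.E (fun σ => f σ + a) = L.E f + a := by
  simp only [add_comm _ a, E_const_add]

theorem E_const (L : RequestLaw M k) (a : ℝ) : L.E (fun _ => a) = a := by
  simp only [E, ← Finset.sum_mul, L.sum_eq, one_mul]

/-- The law of the empty sequence. -/
def nil (M : Type) (k : ℕ) : RequestLaw M k where
  ι := Unit
  fin := inferInstance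
  P _ := 1
  ρ _ := []
  nonneg _ := zero_le_one
  sum_eq := by simp
  valid := by simp

/-- Prepending a fixed request. -/
def cons (L : RequestLaw M k) (r : Finset M) (hr : r.Nonempty) (hk : r.card ≤ k) :
    RequestLaw M k where
  ι := L.ι
  fin := L.fin
  P := L.P
  ρ i := r :: L.ρ i
  nonneg := L.nonneg
  sum_eq := L.sum_eq
  valid i := List.forall_mem_cons.2 ⟨⟨hr, hk⟩, L.valid i⟩

theorem E_cons (L : RequestLaw M k) {r : Finset M} (hr : r.Nonempty) (hk : r.card ≤ k)
    (f : List (Finset M) → ℝ) : (L.cons r hr hk).E f = L.E (fun σ => f (r :: σ)) := rfl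

/-- The fair mixture of two laws. -/
noncomputable def mix (L L' : RequestLaw M k) : RequestLaw M k where
  ι := L.ι ⊕ L'.ι
  fin := inferInstance
  P := Sum.elim (fun i => L.P i / 2) (fun i => L'.P i / 2)
  ρ := Sum.elim L.ρ L'.ρ
  nonneg := Sum.rec (fun i => div_nonneg (L.nonneg i) zero_le_two)
    (fun i => div_nonneg (L'.nonneg i) zero_le_two)
  sum_eq := by simp [← Finset.sum_div, L.sum_eq, L'.sum_eq]; norm_num
  valid := Sum.rec L.valid L'.valid

theorem E_mix (L L' : RequestLaw M k) (f : List (Finset M) → ℝ) :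
    (L.mix L').E f = (L.E f + L'.E f) / 2 := by
  refine (Fintype.sum_sum_type _).trans ?_
  simp [E, mix, add_div, Finset.sum_div, div_mul_eq_mul_div]

/-- Concatenating independent sequences. -/
noncomputable def append (L L' : RequestLaw M k) : RequestLaw M k where
  ι := L.ι × L'.ι
  fin := inferInstance
  P i := L.P i.1 * L'.P i.2
  ρ i := L.ρ i.1 ++ L'.ρ i.2
  nonneg i := mul_nonneg (L.nonneg _) (L'.nonneg _)
  sum_eq := by simp [Fintype.sum_prod_type, ← Finset.mul_sum, L.sum_eq, L'.sum_eq]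
  valid i r hr := (List.mem_append.1 hr).elim (L.valid _ r) (L'.valid _ r)

theorem E_append (L L' : RequestLaw M k) (f : List (Finset M) → ℝ) :
    (L.append L').E f = L.E (fun σ => L'.E (fun τ => f (σ ++ τ))) := by
  refine (Fintype.sum_prod_type _).trans ?_
  simp [E, append, Finset.mul_sum, mul_assoc]

end RequestLaw

/-- Every winning state is realized by a law of request sequences. -/
theorem Gadget.Win.exists_law {M : Type} {G : Gadget M} {k : ℕ} {h : ℝ} {r S : Finset M}
    {φ : M → ℝ} (W : G.Win k h r S φ) : ∃ L : RequestLaw M k,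
      (∀ A, MssAlg A → ∀ l, ∀ p ∈ r, φ p ≤ L.E (onlineCost G.d A l p)) ∧
        ∀ i, ∃ p ∈ S, Serves G.d (L.ρ i) p G.t (1 - G.lam p) := by
  induction W with
  | done st ht =>
    refine ⟨.nil M k, fun A _ l p hp => ?_, fun i => ⟨_, ht, rfl, by simp [G.lam_t]⟩⟩
    simpa [RequestLaw.E, RequestLaw.nil, onlineCost] using st.upper p hp
  | @req h r S φ h' r' S' φ' st hle hge cert off next ih =>
    obtain ⟨L, hA, hS⟩ := ih
    refine ⟨L.cons r' next.state.nonempty next.state.card_le, fun A hA' l p hp => ?_, fun i => ?_⟩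
    · have hx := hA' l r' next.state.nonempty
      rw [RequestLaw.E_cons]
      simp only [onlineCost]
      rw [RequestLaw.E_const_add]
      linarith [cert p hp _ hx, hA A hA' (l ++ [r']) _ hx]
    · obtain ⟨q, hq, h⟩ := hS i
      obtain ⟨p, hp, hpq⟩ := off q hq
      exact ⟨p, hp, q, next.state.subset hq, h.mono (by linarith)⟩
  | @coin h r S φ h₁ h₂ φ₁ φ₂ st hle₁ hge₁ hle₂ hge₂ avg next₁ next₂ ih₁ ih₂ =>
    obtain ⟨L₁, hA₁, hS₁⟩ := ih₁
    obtain ⟨L₂, hA₂, hS₂⟩ := ih₂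
    refine ⟨L₁.mix L₂, fun A hA' l p hp => ?_, Sum.rec hS₁ hS₂⟩
    rw [RequestLaw.E_mix]
    linarith [avg p hp, hA₁ A hA' l p hp, hA₂ A hA' l p hp]

/-- Independent repetition of a single play, with the players sent back to the start. -/
theorem RequestLaw.exists_repeat {M : Type} {k : ℕ} {d : M → M → ℝ} (hd : ∀ p q, 0 ≤ d p q)
    {a b : M} (hab : 1 ≤ d b a) (hab' : d b a ≤ 2) (hb : d b b ≤ 2) {C : ℝ} (hk : 1 ≤ k)
    (L : RequestLaw M k)
    (hC : ∀ A, MssAlg A → ∀ l, C ≤ L.E (onlineCost d A l a))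
    (hL : ∀ i, Serves d (L.ρ i) a b 2) (n : ℕ) : ∃ R : RequestLaw M k,
      (∀ A, MssAlg A → ∀ l p, n * C ≤ R.E (onlineCost d A l p)) ∧
      (∀ i p q c, Serves d (R.ρ i) p q c → n ≤ c) ∧
      ∀ i p, d p b ≤ 2 → ∃ q, Serves d (R.ρ i) p q (6 * n) := by
  have leaf : ∀ {σ : List (Finset M)} {p q c}, Serves d σ p q c → 0 ≤ c := by
    intro σ
    induction σ with
    | nil => exact fun h => h.2
    | cons r σ ih =>
      rintro p q c ⟨x, -, h⟩
      linarith [ih h, hd p x]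
  induction n with
  | zero =>
    refine ⟨.nil M k, fun A _ l p => ?_, fun i p q c h => ?_, fun i p _ => ⟨p, rfl, by simp⟩⟩
    · simp [RequestLaw.E, RequestLaw.nil, onlineCost]
    · simpa using h.2
  | succ n ih =>
    obtain ⟨R, hA, hR, hR'⟩ := ih
    refine ⟨((L.append R).cons {a} (by simp) (by simpa using hk)).cons {b} (by simp)
      (by simpa using hk), fun A hA' l p => ?_, ?_, ?_⟩
    · rw [E_cons, E_cons, E_append]
      have h₁ : A (l ++ [{b}] ++ [{a}]) = a :=
        Finset.mem_singleton.1 (hA' (l ++ [{b}]) {a} (by simp))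
      simp only [onlineCost, h₁]
      have h₂ := hC A hA' (l ++ [{b}] ++ [{a}])
      have h₃ : L.E (fun σ => onlineCost d A (l ++ [{b}] ++ [{a}]) a σ + n * C) ≤
          L.E fun σ => R.E fun τ => d p (A (l ++ [{b}])) + (d (A (l ++ [{b}])) a +
            onlineCost d A (l ++ [{b}] ++ [{a}]) a (σ ++ τ)) := by
        refine L.E_mono fun i => ?_
        obtain ⟨q, hq⟩ := exists_onlineCost_append d A (l ++ [{b}] ++ [{a}]) (L.ρ i) a
        simp only [hq, E_const_add]
        linarith [hA A hA' (l ++ [{b}] ++ [{a}] ++ L.ρ i) q, hd p (A (l ++ [{b}])),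
          hd (A (l ++ [{b}])) a]
      rw [E_add_const] at h₃
      push_cast
      linarith
    · rintro i p q c ⟨x, hx, y, hy, h⟩
      obtain ⟨m, hm⟩ := h.exists_of_append hd
      rw [Finset.mem_singleton] at hx hy
      subst hx hy
      have := hR _ _ _ _ hm
      push_cast
      linarith [hd p x]
    · intro i p hp
      obtain ⟨q, hq⟩ := hR' i.2 b hb
      refine ⟨q, b, by simp, a, by simp, ((hL i.1).append hq).mono ?_⟩
      push_cast
      linarith

theorem RequestLaw.mssDLB {n k : ℕ} {d : Fin n → Fin n → ℝ} (hd : IsMetric d) {a b : Fin n}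
    (hab : 1 ≤ d b a) {C : ℝ} (hC₀ : 0 ≤ C) (hk : 1 ≤ k) (L : RequestLaw (Fin n) k)
    (hC : ∀ A, MssAlg A → ∀ l, C ≤ L.E (onlineCost d A l a))
    (hL : ∀ i, Serves d (L.ρ i) a b 2) : MssDLB d a k (C / 6) := by
  intro B hB
  obtain ⟨d_eq, d_comm, d_tri⟩ := hd
  have d_self : ∀ p, d p p = 0 := fun p => (d_eq p p).2 rfl
  have hd₀ : ∀ p q, 0 ≤ d p q := fun p q => by
    have h := d_tri p q p
    rw [d_self, d_comm q p] at h
    linarith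
  have hab' : d b a ≤ 2 := by
    rcases isEmpty_or_nonempty L.ι with h | ⟨⟨i⟩⟩
    · simpa using L.sum_eq
    · rw [d_comm]
      exact (hL i).dist_le d_self d_tri
  obtain ⟨R, hA, hR, hR'⟩ := L.exists_repeat hd₀ hab hab' (by rw [d_self]; norm_num) hk hC hL ⌈B⌉₊
  have lower : ∀ i, (⌈B⌉₊ : ℝ) ≤ mssOpt d a (R.ρ i) := fun i => by
    obtain ⟨q, hq⟩ := hR' i a (by rwa [d_comm])
    exact hq.le_mssOpt fun q c h => hR i a q c h
  have upper : ∀ i, mssOpt d a (R.ρ i) ≤ 6 * ⌈B⌉₊ := fun i => by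
    obtain ⟨q, hq⟩ := hR' i a (by rwa [d_comm])
    exact hq.mssOpt_le hd₀
  have hlow : B ≤ R.E (mssOpt d a) :=
    (Nat.le_ceil B).trans ((R.E_const _).symm.le.trans (R.E_mono lower))
  have hup : R.E (mssOpt d a) ≤ 6 * ⌈B⌉₊ := (R.E_mono upper).trans (R.E_const _).le
  let e := (Fintype.equivFin R.ι).symm
  have hE : ∀ f, ∑ ω, R.P (e ω) * f (R.ρ (e ω)) = R.E f := fun f =>
    e.sum_comp fun i => R.P i * f (R.ρ i)
  refine ⟨_, fun ω => R.P (e ω), fun ω => R.ρ (e ω), fun ω => R.nonneg _, ?_, fun ω => R.valid _,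
    ?_, fun A hA' => ?_⟩
  · rw [e.sum_comp, R.sum_eq]
  · rwa [hE]
  · rw [hE, hE]
    have h : ⌈B⌉₊ * C ≤ R.E (mssCost d A a) := (hA A hA' [] a).trans_eq
      (by simp only [RequestLaw.E, mssCost_eq_onlineCost])
    nlinarith

/-- Enlarging a gadget to a metric on `Fin n`. -/
theorem Gadget.Win.exists_mssDLB {M : Type} [Fintype M] {G : Gadget M} {n k : ℕ} {C h : ℝ}
    (hn : Fintype.card M ≤ n) (hk : 1 ≤ k) (hC : 0 ≤ C) (W : G.Win k h {G.s} {G.s} fun _ => C) :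
    ∃ d : Fin n → Fin n → ℝ, IsMetric d ∧ ∃ s, MssDLB d s k (C / 6) := by
  obtain ⟨L, hA, hS⟩ := W.exists_law
  obtain ⟨f⟩ : Nonempty (M ↪ Fin n) :=
    Function.Embedding.nonempty_of_card_le (by simpa using hn)
  have : Nonempty M := ⟨G.s⟩
  let g : Fin n → M := Function.invFun f
  have hgf : ∀ p, g (f p) = p := Function.leftInverse_invFun f.injective
  let η : ℝ := 1 / (∑ i, (L.ρ i).length + 1)
  have hη : 0 < η := by positivity
  have hlen : ∀ i, (L.ρ i).length * η ≤ 1 := fun i => by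
    rw [mul_one_div, div_le_one (by positivity)]
    have h := Finset.single_le_sum (f := fun i => (L.ρ i).length)
      (fun _ _ => Nat.zero_le _) (Finset.mem_univ i)
    exact_mod_cast Nat.le_succ_of_le h
  let d : Fin n → Fin n → ℝ := fun x y => G.d (g x) (g y) + if x = y then 0 else η
  have hdG : ∀ x y, G.d (g x) (g y) ≤ d x y := fun x y => by
    simp only [d]
    split_ifs <;> linarith
  have hd : IsMetric d := by
    refine ⟨fun x y => ⟨fun h => ?_, ?_⟩, fun x y => ?_, fun x y z => ?_⟩
    · by_contra hxy
      simp only [d, hxy, if_false] at h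
      linarith [G.d_nonneg (g x) (g y)]
    · rintro rfl
      simp [d, G.d_self]
    · simp only [d, G.d_comm (g x), eq_comm]
    · have h := G.d_tri (g x) (g y) (g z)
      simp only [d]
      split_ifs <;> first | linarith | (exfalso; simp_all)
  have hserve : ∀ σ p q c, Serves G.d σ p q c →
      Serves d (σ.map (Finset.map f)) (f p) (f q) (c + σ.length * η) := by
    intro σ
    induction σ with
    | nil =>
      rintro p q c ⟨rfl, h⟩
      exact ⟨rfl, by simpa using h⟩
    | cons r σ ih =>
      rintro p q c ⟨x, hx, h⟩
      refine ⟨f x, by simpa using hx, (ih x q _ h).mono ?_⟩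
      have : d (f p) (f x) ≤ G.d p x + η := by
        simp only [d, hgf]
        split_ifs <;> linarith
      rw [List.length_cons]
      push_cast
      linarith
  have hcost : ∀ A l σ l' p, onlineCost G.d (fun τ => g (A (l ++ τ.map (Finset.map f)))) l' (g p) σ
      ≤ onlineCost d A (l ++ l'.map (Finset.map f)) p (σ.map (Finset.map f)) := by
    intro A l σ
    induction σ with
    | nil => exact fun _ _ => le_rfl
    | cons r σ ih =>
      intro l' p
      have h := ih (l' ++ [r]) (A (l ++ (l' ++ [r]).map (Finset.map f)))
      simp only [onlineCost, List.map_cons, List.map_append, List.map_nil, List.append_assoc]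
        at h ⊢
      exact add_le_add (hdG _ _) h
  refine ⟨d, hd, f G.s, RequestLaw.mssDLB hd (b := f G.t) ?_ hC hk
    ⟨L.ι, L.fin, L.P, fun i => (L.ρ i).map (Finset.map f), L.nonneg, L.sum_eq, ?_⟩ ?_ ?_⟩
  · have h := hdG (f G.t) (f G.s)
    rw [hgf, hgf, G.d_comm] at h
    exact G.one_le_d.trans h
  · intro i r hr
    obtain ⟨r, hr', rfl⟩ := List.mem_map.1 hr
    simpa using L.valid i r hr'
  · intro A hA' l
    refine (hA (fun τ => g (A (l ++ τ.map (Finset.map f)))) ?_ [] _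
      (Finset.mem_singleton_self _)).trans (L.E_mono (g := fun σ =>
        onlineCost d A l (f G.s) (σ.map (Finset.map f))) fun i => ?_)
    · intro τ r hr
      have h := hA' (l ++ τ.map (Finset.map f)) (r.map f) (by simpa using hr)
      obtain ⟨x, hx, h⟩ := Finset.mem_map.1 h
      simp only [List.map_append, List.map_cons, List.map_nil]
      rw [← List.append_assoc, ← h, hgf]
      exact hx
    · simpa [hgf] using hcost A l (L.ρ i) [] (f G.s)
  · intro i
    obtain ⟨p, hp, h⟩ := hS i
    rw [Finset.mem_singleton.1 hp, G.lam_s] at h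
    exact (hserve _ _ _ _ h).mono (by linarith [hlen i])

theorem MssDLB.mono {n k k' : ℕ} {d : Fin n → Fin n → ℝ} {s : Fin n} {C C' : ℝ}
    (h : MssDLB d s k C) (hk : k ≤ k') (hC : C' ≤ C) : MssDLB d s k' C' := by
  intro B hB
  obtain ⟨N, P, ρ, h₁, h₂, h₃, h₄, h₅⟩ := h B hB
  exact ⟨N, P, ρ, h₁, h₂, fun ω r hr => ⟨(h₃ ω r hr).1, (h₃ ω r hr).2.trans hk⟩, h₄,
    fun A hA => (mul_le_mul_of_nonneg_right hC (hB.trans h₄)).trans (h₅ A hA)⟩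

/-- There is an absolute constant `c > 0` such that for every
`n ≥ 2` there is an `n`-point metric space (realized as a metric `d` on `Fin n`)
and a starting point `s` such that `c·(log n)²` is a distributional lower bound
for MSS on it (with request sets of size at most `n - 1`). -/
theorem mss_existential_log_sq_lower_bound :
    ∃ c : ℝ, 0 < c ∧ ∀ n : ℕ, 2 ≤ n →
      ∃ d : Fin n → Fin n → ℝ, IsMetric d ∧
        ∃ s : Fin n, MssDLB d s (n - 1) (c * Real.log n ^ 2) := by
  refine ⟨1 / 540000, by norm_num, fun n hn => ?_⟩
  set w := Nat.log 6 (n / 2) with hw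
  have hw₁ : 2 * 6 ^ w ≤ n := by
    have := Nat.pow_log_le_self 6 (x := n / 2) (by omega)
    rw [← hw] at this
    omega
  have hw₂ : n < 2 * 6 ^ (w + 1) := by
    have := Nat.lt_pow_succ_log_self (b := 6) (by norm_num) (n / 2)
    rw [← hw] at this
    omega
  obtain ⟨M, _, G, C, h₀, hM, hC, -, -, W⟩ := Gadget.exists_win w
  have hC₀ : 0 ≤ C := (sq_nonneg _).trans hC
  obtain ⟨d, hd, s, h⟩ := W.exists_mssDLB (hM.trans_le hw₁) Nat.one_le_two_pow hC₀
  refine ⟨d, hd, s, h.mono ?_ ?_⟩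
  · have h₁ : 2 ^ w ≤ 6 ^ w := Nat.pow_le_pow_left (by norm_num) w
    have h₂ : 1 ≤ 6 ^ w := Nat.one_le_pow _ _ (by norm_num)
    omega
  · have hn₀ : (0 : ℝ) < n := by positivity
    have hlog₀ : 0 ≤ Real.log n := Real.log_nonneg (by exact_mod_cast (by omega : 1 ≤ n))
    have hlog : Real.log n ≤ 3 * (w + 1) := by
      rw [Real.log_le_iff_le_exp hn₀]
      have h₁ : (n : ℝ) ≤ 12 ^ (w + 1) := by
        have : n ≤ 12 ^ (w + 1) := by
          rw [show 12 = 2 * 6 from rfl, mul_pow]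
          exact hw₂.le.trans (Nat.mul_le_mul_right _ (Nat.le_self_pow (by omega) 2))
        exact_mod_cast this
      have h₂ : (12 : ℝ) ≤ Real.exp 3 := by
        have h := Real.exp_one_gt_d9
        rw [show (3 : ℝ) = 1 + 1 + 1 by norm_num, Real.exp_add, Real.exp_add]
        nlinarith [mul_pos (Real.exp_pos 1) (Real.exp_pos 1)]
      calc (n : ℝ) ≤ 12 ^ (w + 1) := h₁
        _ ≤ Real.exp 3 ^ (w + 1) := pow_le_pow_left₀ (by norm_num) h₂ _
        _ = Real.exp (3 * (w + 1)) := by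
          rw [← Real.exp_nat_mul]
          push_cast
          ring_nf
    have hw₀ : (0 : ℝ) ≤ w := Nat.cast_nonneg w
    nlinarith
end

section
/- There exists an absolute constant c > 0 such that for every integer k ≥ 2 there exists a metric space M on k+1 points and an initial configuration of k servers on which c·(log k)² is a distributional lower bound for the k-server problem. Consequently, there exist (k+1)-point metric spaces in which the randomized competitive ratio for the k-server problem is Ω(log² k); this refutes the conjecture that the randomized k-server competitive ratio is Θ(log k) in all metric spaces with at least k+1 points. -/
open scoped Classical

/-- The cost of moving from configuration `S` to configuration `S'`:
since a single step changes at most one server, the symmetric differences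
have at most one element each and this is the distance moved. -/
noncomputable def kStepCost {M : Type*} (d : M → M → ℝ) (S S' : Finset M) : ℝ :=
  ∑ x ∈ S \ S', ∑ y ∈ S' \ S, d x y

/-- The configuration of the online algorithm `A` (with initial configuration
`S₀`) after serving the first `t` requests of `σ`. -/
def kConfig {M : Type*} (A : List M → Finset M) (S₀ : Finset M)
    (σ : List M) (t : ℕ) : Finset M :=
  if t = 0 then S₀ else A (σ.take t)

/-- `A` is a valid deterministic online `k`-server algorithm from `S₀`:
configurations have `k` servers, each request is covered as soon as it arrives,
and at most one server moves per request. -/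
def KServerAlg {M : Type*} (k : ℕ) (S₀ : Finset M) (A : List M → Finset M) : Prop :=
  ∀ (l : List M) (r : M),
    (A (l ++ [r])).card = k ∧ r ∈ A (l ++ [r]) ∧
      ((A (l ++ [r])) \ (if l = [] then S₀ else A l)).card ≤ 1

/-- Online cost of `A` on the request sequence `σ`. -/
noncomputable def kServerCost {M : Type*} (d : M → M → ℝ) (A : List M → Finset M)
    (S₀ : Finset M) (σ : List M) : ℝ :=
  ∑ t ∈ Finset.range σ.length,
    kStepCost d (kConfig A S₀ σ t) (kConfig A S₀ σ (t + 1))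

/-- `S` is a feasible (offline) schedule of `k` servers serving `σ` from `S₀`. -/
def KServerServes {M : Type*} (k : ℕ) (S₀ : Finset M) (σ : List M)
    (S : ℕ → Finset M) : Prop :=
  S 0 = S₀ ∧ ∀ (t : ℕ) (h : t < σ.length),
    (S (t + 1)).card = k ∧ σ.get ⟨t, h⟩ ∈ S (t + 1) ∧
      ((S (t + 1)) \ S t).card ≤ 1

/-- Optimal (offline) cost of serving `σ` from `S₀` with `k` servers. -/
noncomputable def kServerOpt {M : Type*} (d : M → M → ℝ) (k : ℕ) (S₀ : Finset M)
    (σ : List M) : ℝ :=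
  sInf {c | ∃ S : ℕ → Finset M, KServerServes k S₀ σ S ∧
    c = ∑ t ∈ Finset.range σ.length, kStepCost d (S t) (S (t + 1))}

/-- `C` is a distributional lower bound for the `k`-server problem on `(M,d)`
with initial configuration `S₀`. -/
def KServerDLB {M : Type*} (d : M → M → ℝ) (k : ℕ) (S₀ : Finset M) (C : ℝ) : Prop :=
  ∀ B : ℝ, 0 ≤ B → ∃ (N : ℕ) (P : Fin N → ℝ) (ρ : Fin N → List M),
    (∀ ω, 0 ≤ P ω) ∧ (∑ ω, P ω) = 1 ∧
    B ≤ (∑ ω, P ω * kServerOpt d k S₀ (ρ ω)) ∧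
    ∀ A : List M → Finset M, KServerAlg k S₀ A →
      C * (∑ ω, P ω * kServerOpt d k S₀ (ρ ω)) ≤
        ∑ ω, P ω * kServerCost d A S₀ (ρ ω)

namespace KServerLB

/-- The axioms of a pseudometric, for a real-valued function of two variables. -/
structure IsPseudo {V : Type} (d : V → V → ℝ) : Prop where
  self : ∀ x, d x x = 0
  symm : ∀ x y, d x y = d y x
  tri : ∀ x y z, d x z ≤ d x y + d y z

theorem IsPseudo.nonneg {V : Type} {d : V → V → ℝ} (h : IsPseudo d) (x y : V) : 0 ≤ d x y := by
  have h1 := h.tri x y x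
  rw [h.self, h.symm y x] at h1
  linarith

/-- Randomized adversary strategies. `force S a` requires the position to lie in `S`,
`coin a b` tosses a fair coin, and `mark a` records that a round has been completed. -/
inductive Strat (V : Type) : Type
  | halt : Strat V
  | mark : Strat V → Strat V
  | coin : Strat V → Strat V → Strat V
  | force : Set V → Strat V → Strat V

namespace Strat

variable {V W X : Type}

/-- The number of constructors of a strategy. -/
def size : Strat V → ℕ
  | halt => 1
  | mark a => a.size + 1
  | coin a b => a.size + b.size + 1
  | force _ a => a.size + 1

/-- Aggregation over all branches of a function of the number of marks,
with `av` combining the two outcomes of a coin. -/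
def fold (av : X → X → X) : (ℕ → X) → Strat V → X
  | f, halt => f 0
  | f, mark a => fold av (fun m => f (m + 1)) a
  | f, coin a b => av (fold av f a) (fold av f b)
  | f, force _ a => fold av f a

/-- The set sequences that a strategy can produce. -/
def Br : Strat V → List (Set V) → Prop
  | halt, σ => σ = []
  | mark a, σ => Br a σ
  | coin a b, σ => Br a σ ∨ Br b σ
  | force S a, σ => ∃ τ, σ = S :: τ ∧ Br a τ

/-- `LB d β γ a x c`: until the end of the current round of `a`, every player at `x` has
expected cost at least `c` plus `β` times the probability that the round gets completed, even
if it may quit at any `force` for an additional price `γ`. -/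
def LB (d : V → V → ℝ) (β γ : ℝ) : Strat V → V → ℝ → Prop
  | halt, _, c => c ≤ 0
  | mark _, _, c => c ≤ -β
  | coin a b, x, c => ∃ c₁ c₂, c₁ + c₂ = 2 * c ∧ LB d β γ a x c₁ ∧ LB d β γ b x c₂
  | force S a, x, c => c ≤ γ ∧ ∀ y ∈ S, LB d β γ a y (c - d x y)

/-- All rounds of `a` that begin after the current one are fair for all positions in the
current set `S`. -/
def Tail (d : V → V → ℝ) (β γ : ℝ) : Strat V → Set V → Prop
  | halt, _ => True
  | mark a, S => (∀ x ∈ S, LB d β γ a x 0) ∧ Tail d β γ a S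
  | coin a b, S => Tail d β γ a S ∧ Tail d β γ b S
  | force S a, _ => Tail d β γ a S

/-- Every round of `a`, started with position in `S`, costs at least `β` in expectation. -/
def Fair (d : V → V → ℝ) (β γ : ℝ) (a : Strat V) (S : Set V) : Prop :=
  (∀ x ∈ S, LB d β γ a x 0) ∧ Tail d β γ a S

/-- `VL d Γ a x c`: every player at `x` has expected cost at least `c` against `a`, even if it
may quit at any `force` for the price `Γ`. -/
def VL (d : V → V → ℝ) (Γ : ℝ) : Strat V → V → ℝ → Prop
  | halt, _, c => c ≤ 0
  | mark a, x, c => VL d Γ a x c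
  | coin a b, x, c => ∃ c₁ c₂, c₁ + c₂ = 2 * c ∧ VL d Γ a x c₁ ∧ VL d Γ b x c₂
  | force S a, x, c => c ≤ Γ ∧ ∀ y ∈ S, VL d Γ a y (c - d x y)

/-- Sequential composition. -/
def append : Strat V → Strat V → Strat V
  | halt, b => b
  | mark a, b => mark (append a b)
  | coin a a', b => coin (append a b) (append a' b)
  | force S a, b => force S (append a b)

/-- Keep only every third mark, when `i` marks have been dropped since the last one kept. -/
def coarsen : ℕ → Strat V → Strat V
  | _, halt => halt
  | i, mark a => if i = 2 then mark (coarsen 0 a) else coarsen (i + 1) a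
  | i, coin a b => coin (coarsen i a) (coarsen i b)
  | i, force S a => force S (coarsen i a)

/-- Play the same strategy simultaneously on two copies. -/
def mirror (e : Bool → V → W) : Strat V → Strat W
  | halt => halt
  | mark a => mark (mirror e a)
  | coin a b => coin (mirror e a) (mirror e b)
  | force S a => force {w | ∃ i, ∃ x ∈ S, w = e i x} (mirror e a)

/-- The set of positions `e i x` with `x ∈ S` and `e (!i) y` with `y ∈ S'`. -/
def pairSet (e : Bool → V → W) (i : Bool) (S S' : Set V) : Set W :=
  {w | (∃ x ∈ S, w = e i x) ∨ ∃ y ∈ S', w = e (!i) y}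

/-- Play the strategy on copy `i`, while the other copy, whose strategy is over, goes through
the loop `t → s → t` once per round. -/
def solo (e : Bool → V → W) (s t : V) (i : Bool) : Strat V → Set V → Strat W
  | halt, _ => halt
  | mark a, S => force (pairSet e i S {s}) (force (pairSet e i S {t}) (mark (solo e s t i a S)))
  | coin a b, S => coin (solo e s t i a S) (solo e s t i b S)
  | force S a, _ => force (pairSet e i S {t}) (solo e s t i a S)

/-- The race of two strategies on two copies. Copy `i` has to play `2` rounds (if `k`) or `1`
round of `a` before a coin decides which copy plays the next two rounds. Once one of the
strategies is over, the other one is completed in `solo` mode. -/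
def race (e : Bool → V → W) (s t : V) (i k : Bool) (a : Strat V) (Sa : Set V) (b : Strat V)
    (Sb : Set V) : Strat W :=
  match a with
  | halt => force (pairSet e i {s} Sb) (force (pairSet e i {t} Sb) (mark (solo e s t (!i) b Sb)))
  | force S a' => force (pairSet e i S Sb) (race e s t i k a' S b Sb)
  | coin a₁ a₂ => coin (race e s t i k a₁ Sa b Sb) (race e s t i k a₂ Sa b Sb)
  | mark a' =>
    if k then race e s t i false a' Sa b Sb
    else mark (coin (race e s t i true a' Sa b Sb) (race e s t (!i) true b Sb a' Sa))
termination_by a.size + b.size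
decreasing_by all_goals simp only [size]; omega

/-- The race of `a` against itself, where a coin decides who begins. -/
def selfRace (e : Bool → V → W) (s t : V) (a : Strat V) : Strat W :=
  coin (race e s t true true a {s} a {s}) (race e s t false true a {s} a {s})

end Strat

open Strat

variable {V W X : Type}

section LowerBounds

variable {d : V → V → ℝ} {β γ : ℝ}

theorem LB_anti {a : Strat V} : ∀ {x : V} {c c' : ℝ}, LB d β γ a x c → c' ≤ c →
    LB d β γ a x c' := by
  induction a with
  | halt => intro x c c' h hc; simp only [LB] at *; linarith
  | mark a ih => intro x c c' h hc; simp only [LB] at *; linarith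
  | coin a b iha ihb =>
    rintro x c c' ⟨c₁, c₂, h, h1, h2⟩ hc
    exact ⟨c₁ - (c - c'), c₂ - (c - c'), by linarith, iha h1 (by linarith), ihb h2 (by linarith)⟩
  | force S a ih =>
    rintro x c c' ⟨h1, h2⟩ hc
    exact ⟨by linarith, fun y hy => ih (h2 y hy) (by linarith)⟩

theorem LB_mono_quit {γ' : ℝ} (hγ : γ ≤ γ') {a : Strat V} : ∀ {x : V} {c : ℝ},
    LB d β γ a x c → LB d β γ' a x c := by
  induction a with
  | halt => exact fun h => h
  | mark a ih => exact fun h => h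
  | coin a b iha ihb => rintro x c ⟨c₁, c₂, h, h1, h2⟩; exact ⟨c₁, c₂, h, iha h1, ihb h2⟩
  | force S a ih => rintro x c ⟨h1, h2⟩; exact ⟨by linarith, fun y hy => ih (h2 y hy)⟩

theorem LB_of_le_neg (hd : IsPseudo d) (hβ : 0 ≤ β) (hγ : 0 ≤ γ) {a : Strat V} :
    ∀ {x : V} {c : ℝ}, c ≤ -β → LB d β γ a x c := by
  induction a with
  | halt => intro x c h; simp only [LB]; linarith
  | mark a ih => exact fun h => h
  | coin a b iha ihb => intro x c h; exact ⟨c, c, by ring, iha h, ihb h⟩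
  | force S a ih =>
    intro x c h
    exact ⟨by linarith, fun y hy => ih (by linarith [hd.nonneg x y])⟩

theorem VL_anti {a : Strat V} : ∀ {x : V} {c c' : ℝ}, VL d γ a x c → c' ≤ c →
    VL d γ a x c' := by
  induction a with
  | halt => intro x c c' h hc; simp only [VL] at *; linarith
  | mark a ih => exact fun h hc => ih h hc
  | coin a b iha ihb =>
    rintro x c c' ⟨c₁, c₂, h, h1, h2⟩ hc
    exact ⟨c₁ - (c - c'), c₂ - (c - c'), by linarith, iha h1 (by linarith), ihb h2 (by linarith)⟩
  | force S a ih =>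
    rintro x c c' ⟨h1, h2⟩ hc
    exact ⟨by linarith, fun y hy => ih (h2 y hy) (by linarith)⟩

theorem VL_lipschitz (hd : IsPseudo d) {a : Strat V} : ∀ {x y : V} {c : ℝ}, VL d γ a x c →
    VL d γ a y (c - d x y) := by
  induction a with
  | halt => intro x y c h; simp only [VL] at *; linarith [hd.nonneg x y]
  | mark a ih => exact fun h => ih h
  | coin a b iha ihb =>
    rintro x y c ⟨c₁, c₂, h, h1, h2⟩
    exact ⟨c₁ - d x y, c₂ - d x y, by linarith, iha h1, ihb h2⟩
  | force S a ih =>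
    rintro x y c ⟨h1, h2⟩
    exact ⟨by linarith [hd.nonneg x y], fun z hz => VL_anti (h2 z hz) (by linarith [hd.tri x y z])⟩

theorem Tail_mono_quit {γ' : ℝ} (hγ : γ ≤ γ') {a : Strat V} : ∀ {S : Set V},
    Tail d β γ a S → Tail d β γ' a S := by
  induction a with
  | halt => exact fun _ => trivial
  | mark a ih => exact fun h => ⟨fun x hx => LB_mono_quit hγ (h.1 x hx), ih h.2⟩
  | coin a b iha ihb => exact fun h => ⟨iha h.1, ihb h.2⟩
  | force S a ih => exact fun h => ih (S := S) h

theorem Strat.Fair.mono_quit {γ' : ℝ} (hγ : γ ≤ γ') {a : Strat V} {S : Set V}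
    (h : Fair d β γ a S) : Fair d β γ' a S :=
  ⟨fun x hx => LB_mono_quit hγ (h.1 x hx), Tail_mono_quit hγ h.2⟩

theorem Tail_anti {a : Strat V} : ∀ {S S' : Set V}, S' ⊆ S → Tail d β γ a S →
    Tail d β γ a S' := by
  induction a with
  | halt => exact fun _ _ => trivial
  | mark a ih => exact fun hS h => ⟨fun x hx => h.1 x (hS hx), ih hS h.2⟩
  | coin a b iha ihb => exact fun hS h => ⟨iha hS h.1, ihb hS h.2⟩
  | force S a ih => exact fun _ h => h

theorem Strat.Fair.anti {a : Strat V} {S S' : Set V} (hS : S' ⊆ S) (h : Fair d β γ a S) :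
    Fair d β γ a S' :=
  ⟨fun x hx => h.1 x (hS hx), Tail_anti hS h.2⟩

theorem LB_append {b : Strat V} (hb : ∀ z, LB d β γ b z 0) {a : Strat V} :
    ∀ {x : V} {c : ℝ}, LB d β γ a x c → LB d β γ (a.append b) x c := by
  induction a with
  | halt => exact fun h => LB_anti (hb _) h
  | mark a ih => exact fun h => h
  | coin a b iha ihb => rintro x c ⟨c₁, c₂, h, h1, h2⟩; exact ⟨c₁, c₂, h, iha h1, ihb h2⟩
  | force S a ih => rintro x c ⟨h1, h2⟩; exact ⟨h1, fun y hy => ih (h2 y hy)⟩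

theorem Strat.Fair.force (hd : IsPseudo d) (hγ : 0 ≤ γ) {S : Set V} {b : Strat V}
    (hb : Fair d β γ b S) (T : Set V) : Fair d β γ (Strat.force S b) T :=
  ⟨fun z _ => ⟨hγ, fun y hy => LB_anti (hb.1 y hy) (by linarith [hd.nonneg z y])⟩, hb.2⟩

theorem Tail_append {b : Strat V} (hb : ∀ T, Fair d β γ b T) {a : Strat V} :
    ∀ {S : Set V}, Tail d β γ a S → Tail d β γ (a.append b) S := by
  induction a with
  | halt => exact fun _ => (hb _).2
  | mark a ih =>
    exact fun h => ⟨fun x hx => LB_append (fun z => (hb Set.univ).1 z trivial) (h.1 x hx), ih h.2⟩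
  | coin a b iha ihb => exact fun h => ⟨iha h.1, ihb h.2⟩
  | force S a ih => exact fun h => ih (S := S) h

theorem Strat.Fair.append {a b : Strat V} {S : Set V} (ha : Fair d β γ a S)
    (hb : ∀ T, Fair d β γ b T) : Fair d β γ (a.append b) S :=
  ⟨fun x hx => LB_append (fun z => (hb Set.univ).1 z trivial) (ha.1 x hx), Tail_append hb ha.2⟩

theorem LB_coarsen (hβ : 0 ≤ β) {a : Strat V} : ∀ {i : ℕ} {S : Set V} {x : V} {c : ℝ},
    i ≤ 2 → x ∈ S → Tail d β γ a S → LB d β γ a x c →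
    LB d (3 * β) γ (coarsen i a) x (c - i * β) := by
  induction a with
  | halt =>
    intro i S x c _ _ _ h
    simp only [LB, coarsen] at *
    nlinarith [mul_nonneg (Nat.cast_nonneg i : (0 : ℝ) ≤ i) hβ]
  | mark a ih =>
    intro i S x c hi hx hT h
    simp only [LB, coarsen] at *
    split_ifs with h2
    · subst h2
      simp only [LB]
      push_cast
      linarith
    · refine LB_anti (ih (i := i + 1) (by omega) hx hT.2 (hT.1 x hx)) ?_
      push_cast
      linarith
  | coin a b iha ihb =>
    rintro i S x c hi hx hT ⟨c₁, c₂, h, h1, h2⟩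
    exact ⟨c₁ - i * β, c₂ - i * β, by linarith, iha hi hx hT.1 h1, ihb hi hx hT.2 h2⟩
  | force S a ih =>
    rintro i S' x c hi hx hT ⟨h1, h2⟩
    refine ⟨by nlinarith [mul_nonneg (Nat.cast_nonneg i : (0 : ℝ) ≤ i) hβ], fun y hy => ?_⟩
    exact LB_anti (ih hi hy hT (h2 y hy)) (by linarith)

theorem Tail_coarsen (hβ : 0 ≤ β) {a : Strat V} : ∀ {i : ℕ} {S : Set V},
    i ≤ 2 → Tail d β γ a S → Tail d (3 * β) γ (coarsen i a) S := by
  induction a with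
  | halt => exact fun _ _ => trivial
  | mark a ih =>
    intro i S hi hT
    simp only [coarsen]
    split_ifs with h2
    · refine ⟨fun x hx => ?_, ih (by omega) hT.2⟩
      have := LB_coarsen (i := 0) hβ (by omega) hx hT.2 (hT.1 x hx)
      simpa using this
    · exact ih (by omega) hT.2
  | coin a b iha ihb => exact fun hi h => ⟨iha hi h.1, ihb hi h.2⟩
  | force S a ih => exact fun hi h => ih (S := S) hi h

theorem Strat.Fair.coarsen (hβ : 0 ≤ β) {a : Strat V} {S : Set V} (h : Fair d β γ a S) :
    Fair d (3 * β) γ (Strat.coarsen 0 a) S := by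
  refine ⟨fun x hx => ?_, Tail_coarsen hβ (by omega) h.2⟩
  have := LB_coarsen (i := 0) hβ (by omega) hx h.2 (h.1 x hx)
  simpa using this

theorem LB_mirror {dW : W → W → ℝ} {e : Bool → V → W}
    (he : ∀ i j x y, d x y ≤ dW (e i x) (e j y)) {a : Strat V} : ∀ {i : Bool} {x : V} {c : ℝ},
    LB d β γ a x c → LB dW β γ (mirror e a) (e i x) c := by
  induction a with
  | halt => exact fun h => h
  | mark a ih => exact fun h => h
  | coin a b iha ihb => rintro i x c ⟨c₁, c₂, h, h1, h2⟩; exact ⟨c₁, c₂, h, iha h1, ihb h2⟩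
  | force S a ih =>
    rintro i x c ⟨h1, h2⟩
    refine ⟨h1, ?_⟩
    rintro _ ⟨j, y, hy, rfl⟩
    exact LB_anti (ih (h2 y hy)) (by linarith [he i j x y])

theorem Tail_mirror {dW : W → W → ℝ} {e : Bool → V → W}
    (he : ∀ i j x y, d x y ≤ dW (e i x) (e j y)) {a : Strat V} : ∀ {S : Set V},
    Tail d β γ a S → Tail dW β γ (mirror e a) {w | ∃ i, ∃ x ∈ S, w = e i x} := by
  induction a with
  | halt => exact fun _ => trivial
  | mark a ih =>
    refine fun h => ⟨?_, ih h.2⟩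
    rintro _ ⟨j, y, hy, rfl⟩
    exact LB_mirror he (h.1 y hy)
  | coin a b iha ihb => exact fun h => ⟨iha h.1, ihb h.2⟩
  | force S a ih => exact fun h => ih (S := S) h

theorem Strat.Fair.mirror {dW : W → W → ℝ} {e : Bool → V → W}
    (he : ∀ i j x y, d x y ≤ dW (e i x) (e j y)) {a : Strat V} {S : Set V}
    (h : Fair d β γ a S) :
    Fair dW β γ (Strat.mirror e a) {w | ∃ i, ∃ x ∈ S, w = e i x} := by
  refine ⟨?_, Tail_mirror he h.2⟩
  rintro _ ⟨j, y, hy, rfl⟩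
  exact LB_mirror he (h.1 y hy)

end LowerBounds

theorem pairSet_not (e : Bool → V → W) (i : Bool) (S S' : Set V) :
    pairSet e (!i) S S' = pairSet e i S' S := by
  ext w
  simp only [pairSet, Bool.not_not, Set.mem_ofPred_eq]
  exact or_comm

/-- The geometric requirements for racing on the two copies `e true`, `e false` of `V`. -/
structure RaceGeometry (d : V → V → ℝ) (dW : W → W → ℝ) (e : Bool → V → W) (s t : V)
    (β : ℝ) : Prop where
  pseudo : IsPseudo d
  pseudo' : IsPseudo dW
  side : ∀ i x y, d x y ≤ dW (e i x) (e i y)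
  cross : ∀ i x y, 3 * β ≤ dW (e i x) (e (!i) y)
  loop : 2 * β ≤ d s t
  nonneg : 0 ≤ β

section RaceFair

variable {d : V → V → ℝ} {dW : W → W → ℝ} {e : Bool → V → W} {s t : V} {β : ℝ}

theorem RaceGeometry.cross' (G : RaceGeometry d dW e s t β) (i : Bool) (x y : V) :
    3 * β ≤ dW (e (!i) x) (e i y) := by
  simpa using G.cross (!i) x y

theorem RaceGeometry.LB_of_le_neg (G : RaceGeometry d dW e s t β) {a : Strat W} {w : W} {c : ℝ}
    (hc : c ≤ -β) : LB dW β (3 * β) a w c :=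
  KServerLB.LB_of_le_neg G.pseudo' G.nonneg (by linarith [G.nonneg]) hc

theorem LB_solo_active (G : RaceGeometry d dW e s t β) {i : Bool} {b : Strat V} :
    ∀ {S : Set V} {y : V} {c : ℝ}, LB d β β b y c →
      LB dW β (3 * β) (solo e s t i b S) (e i y) c := by
  have hβ := G.nonneg
  induction b with
  | halt => exact fun h => h
  | mark b ih => exact fun h => G.LB_of_le_neg h
  | coin a b iha ihb =>
    rintro S y c ⟨c₁, c₂, h, h1, h2⟩
    exact ⟨c₁, c₂, h, iha h1, ihb h2⟩
  | force S b ih =>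
    rintro S' y c ⟨h1, h2⟩
    refine ⟨by linarith, ?_⟩
    rintro _ (⟨x, hx, rfl⟩ | ⟨x, rfl, rfl⟩)
    · exact LB_anti (ih (h2 x hx)) (by linarith [G.side i y x])
    · exact G.LB_of_le_neg (by linarith [G.cross i y x])

theorem LB_solo_idle (G : RaceGeometry d dW e s t β) {i : Bool} {b : Strat V} :
    ∀ {S : Set V}, LB dW β (3 * β) (solo e s t i b S) (e (!i) t) 0 := by
  have hβ := G.nonneg
  induction b with
  | halt => exact le_refl (0 : ℝ)
  | mark b ih =>
    intro S
    refine ⟨by linarith, ?_⟩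
    rintro _ (⟨x, hx, rfl⟩ | ⟨x, rfl, rfl⟩)
    · exact G.LB_of_le_neg (by linarith [G.cross' i t x])
    · exact G.LB_of_le_neg
        (by linarith [G.side (!i) t x, G.loop, G.pseudo.symm x t])
  | coin a b iha ihb => exact ⟨0, 0, by norm_num, iha, ihb⟩
  | force S b ih =>
    intro S'
    refine ⟨by linarith, ?_⟩
    rintro _ (⟨x, hx, rfl⟩ | ⟨x, rfl, rfl⟩)
    · exact G.LB_of_le_neg (by linarith [G.cross' i t x])
    · exact LB_anti ih (by linarith [G.pseudo'.nonneg (e (!i) x) (e (!i) x)])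

theorem Tail_solo (G : RaceGeometry d dW e s t β) {i : Bool} {b : Strat V} :
    ∀ {S : Set V}, Tail d β β b S →
      Tail dW β (3 * β) (solo e s t i b S) (pairSet e i S {t}) := by
  induction b with
  | halt => exact fun _ => trivial
  | mark b ih =>
    refine fun h => ⟨?_, ih h.2⟩
    rintro _ (⟨x, hx, rfl⟩ | ⟨x, rfl, rfl⟩)
    · exact LB_solo_active G (h.1 x hx)
    · exact LB_solo_idle G
  | coin a b iha ihb => exact fun h => ⟨iha h.1, ihb h.2⟩
  | force S b ih => exact fun h => ih (S := S) h

theorem Fair_solo (G : RaceGeometry d dW e s t β) {i : Bool} {b : Strat V} {S : Set V}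
    (h : Fair d β β b S) : Fair dW β (3 * β) (solo e s t i b S) (pairSet e i S {t}) := by
  refine ⟨?_, Tail_solo G h.2⟩
  rintro _ (⟨x, hx, rfl⟩ | ⟨x, rfl, rfl⟩)
  · exact LB_solo_active G (h.1 x hx)
  · exact LB_solo_idle G

theorem LB_race_active (G : RaceGeometry d dW e s t β) {i k : Bool} {a b : Strat V}
    {Sb : Set V} : ∀ {Sa : Set V} {x : V} {c : ℝ}, x ∈ Sa → Tail d β β a Sa → LB d β β a x c →
      LB dW β (3 * β) (race e s t i k a Sa b Sb) (e i x) (c + if k then β else 0) := by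
  have hβ := G.nonneg
  have hk : (if k then β else 0) ≤ β := by split_ifs <;> linarith
  induction a generalizing k with
  | halt =>
    intro Sa x c _ _ h
    simp only [LB] at h
    rw [race]
    refine ⟨by linarith, ?_⟩
    rintro _ (⟨y, rfl, rfl⟩ | ⟨y, hy, rfl⟩)
    · have h1 := G.pseudo'.nonneg (e i x) (e i y)
      refine ⟨by linarith, ?_⟩
      rintro _ (⟨z, rfl, rfl⟩ | ⟨z, hz, rfl⟩)
      · exact G.LB_of_le_neg (by linarith [G.side i y z, G.loop])
      · exact G.LB_of_le_neg (by linarith [G.cross i y z])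
    · exact G.LB_of_le_neg (by linarith [G.cross i x y])
  | mark a ih =>
    intro Sa x c hx hT h
    simp only [LB] at h
    rw [race]
    cases k with
    | true =>
      have := ih (k := false) (by simpa using hβ) hx hT.2 (hT.1 x hx)
      exact LB_anti this (by simp; linarith)
    | false =>
      simpa [LB] using h
  | coin a₁ a₂ ih₁ ih₂ =>
    rintro Sa x c hx hT ⟨c₁, c₂, h, h1, h2⟩
    rw [race]
    exact ⟨_, _, by linarith, ih₁ hk hx hT.1 h1, ih₂ hk hx hT.2 h2⟩
  | force S a ih =>
    rintro Sa x c hx hT ⟨h1, h2⟩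
    rw [race]
    refine ⟨by linarith, ?_⟩
    rintro _ (⟨y, hy, rfl⟩ | ⟨y, hy, rfl⟩)
    · exact LB_anti (ih hk hy hT (h2 y hy)) (by linarith [G.side i x y])
    · exact G.LB_of_le_neg (by linarith [G.cross i x y])

theorem LB_race_coin (G : RaceGeometry d dW e s t β) {i : Bool} {a b : Strat V}
    {Sa Sb : Set V} (ha : Fair d β β a Sa) (hb : Fair d β β b Sb) {w : W}
    (hw : w ∈ pairSet e i Sa Sb) :
    LB dW β (3 * β) (coin (race e s t i true a Sa b Sb) (race e s t (!i) true b Sb a Sa)) w 0 := by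
  rcases hw with ⟨x, hx, rfl⟩ | ⟨x, hx, rfl⟩
  · have h := LB_race_active G (i := i) (k := true) (b := b) (Sb := Sb) hx ha.2 (ha.1 x hx)
    exact ⟨β, -β, by ring, by simpa using h, G.LB_of_le_neg le_rfl⟩
  · have h := LB_race_active G (i := !i) (k := true) (b := a) (Sb := Sa) hx hb.2 (hb.1 x hx)
    exact ⟨-β, β, by ring, G.LB_of_le_neg le_rfl, by simpa using h⟩

theorem Tail_race (G : RaceGeometry d dW e s t β) : ∀ (n : ℕ) {i k : Bool} {a b : Strat V}
    {Sa Sb : Set V}, a.size + b.size ≤ n → Tail d β β a Sa → Fair d β β b Sb →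
      Tail dW β (3 * β) (race e s t i k a Sa b Sb) (pairSet e i Sa Sb) := by
  intro n
  induction n with
  | zero =>
    intro i k a b Sa Sb hn
    cases a <;> simp [size] at hn
  | succ n ih =>
    intro i k a b Sa Sb hn ha hb
    cases a with
    | halt =>
      rw [race]
      have := Fair_solo G (i := !i) hb
      rwa [pairSet_not] at this
    | mark a =>
      rw [race]
      simp only [size] at hn
      cases k with
      | true => exact ih (by omega) ha.2 hb
      | false =>
        refine ⟨fun w hw => LB_race_coin G ha hb hw, ih (by omega) ha.2 hb, ?_⟩
        rw [← pairSet_not]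
        exact ih (by omega) hb.2 ha
    | coin a₁ a₂ =>
      rw [race]
      simp only [size] at hn
      exact ⟨ih (by omega) ha.1 hb, ih (by omega) ha.2 hb⟩
    | force S a =>
      rw [race]
      simp only [size] at hn
      exact ih (a := a) (Sa := S) (by omega) ha hb

theorem Fair_selfRace (G : RaceGeometry d dW e s t β) {a : Strat V} (ha : Fair d β β a {s}) :
    Fair dW β (3 * β) (selfRace e s t a) (pairSet e true {s} {s}) := by
  refine ⟨fun w hw => LB_race_coin G ha ha hw, Tail_race G _ le_rfl ha.2 ha, ?_⟩
  rw [← pairSet_not]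
  exact Tail_race G _ le_rfl ha.2 ha

end RaceFair

section Offline

/-- Starting in `x` one can visit the sets of `σ` in order and end in `y` at cost at most `c`. -/
def Off (d : V → V → ℝ) : List (Set V) → V → V → ℝ → Prop
  | [], x, y, c => d x y ≤ c
  | S :: σ, x, y, c => ∃ z ∈ S, Off d σ z y (c - d x z)

variable {d : V → V → ℝ} {dW : W → W → ℝ} {e : Bool → V → W} {s t : V}

theorem Off_mono {σ : List (Set V)} : ∀ {x y : V} {c c' : ℝ}, Off d σ x y c → c ≤ c' →
    Off d σ x y c' := by
  induction σ with
  | nil => exact fun h hc => le_trans h hc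
  | cons S σ ih => rintro x y c c' ⟨z, hz, h⟩ hc; exact ⟨z, hz, ih h (by linarith)⟩

theorem Off_tri (hd : IsPseudo d) {σ : List (Set V)} {y z : V} {c : ℝ} (x : V)
    (h : Off d σ y z c) : Off d σ x z (c + d x y) := by
  cases σ with
  | nil => exact (hd.tri x y z).trans (by simp only [Off] at h; linarith)
  | cons S σ =>
    obtain ⟨w, hw, h⟩ := h
    exact ⟨w, hw, Off_mono h (by linarith [hd.tri x y w])⟩

theorem Off_append (hd : IsPseudo d) {σ τ : List (Set V)} {y z : V} {c' : ℝ}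
    (h' : Off d τ y z c') : ∀ {x : V} {c : ℝ}, Off d σ x y c → Off d (σ ++ τ) x z (c + c') := by
  induction σ with
  | nil =>
    intro x c h
    simp only [Off] at h
    exact Off_mono (Off_tri hd x h') (by linarith)
  | cons S σ ih =>
    rintro x c ⟨w, hw, h⟩
    exact ⟨w, hw, Off_mono (ih h) (by linarith)⟩

theorem Off_map {f : V → W} {F : Set V → Set W} (hf : ∀ x y, dW (f x) (f y) ≤ d x y)
    (hF : ∀ S, ∀ x ∈ S, f x ∈ F S) {σ : List (Set V)} : ∀ {x y : V} {c : ℝ}, Off d σ x y c →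
      Off dW (σ.map F) (f x) (f y) c := by
  induction σ with
  | nil => exact fun h => (hf _ _).trans h
  | cons S σ ih =>
    rintro x y c ⟨z, hz, h⟩
    exact ⟨f z, hF S z hz, Off_mono (ih h) (by linarith [hf x z])⟩

theorem Br_append {a b : Strat V} : ∀ {σ : List (Set V)}, Br (a.append b) σ →
    ∃ σ₁ σ₂, σ = σ₁ ++ σ₂ ∧ Br a σ₁ ∧ Br b σ₂ := by
  induction a with
  | halt => exact fun {σ} h => ⟨[], σ, rfl, rfl, h⟩
  | mark a ih => exact fun h => ih h
  | coin a₁ a₂ ih₁ ih₂ =>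
    rintro σ (h | h)
    · obtain ⟨σ₁, σ₂, h, h1, h2⟩ := ih₁ h
      exact ⟨σ₁, σ₂, h, Or.inl h1, h2⟩
    · obtain ⟨σ₁, σ₂, h, h1, h2⟩ := ih₂ h
      exact ⟨σ₁, σ₂, h, Or.inr h1, h2⟩
  | force S a ih =>
    rintro _ ⟨τ, rfl, h⟩
    obtain ⟨σ₁, σ₂, rfl, h1, h2⟩ := ih h
    exact ⟨S :: σ₁, σ₂, rfl, ⟨σ₁, rfl, h1⟩, h2⟩

theorem Br_coarsen {a : Strat V} : ∀ {i : ℕ} {σ : List (Set V)}, Br (a.coarsen i) σ → Br a σ := by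
  induction a with
  | halt => exact fun h => h
  | mark a ih =>
    intro i σ h
    simp only [coarsen] at h
    split_ifs at h
    · exact ih (i := 0) h
    · exact ih h
  | coin a₁ a₂ ih₁ ih₂ => exact fun h => h.imp ih₁ ih₂
  | force S a ih => rintro i _ ⟨τ, rfl, h⟩; exact ⟨τ, rfl, ih h⟩

theorem Br_mirror {a : Strat V} : ∀ {σ : List (Set W)}, Br (a.mirror e) σ →
    ∃ τ, Br a τ ∧ σ = τ.map fun S => {w | ∃ i, ∃ x ∈ S, w = e i x} := by
  induction a with
  | halt => rintro _ rfl; exact ⟨[], rfl, rfl⟩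
  | mark a ih => exact fun h => ih h
  | coin a₁ a₂ ih₁ ih₂ =>
    rintro σ (h | h)
    · obtain ⟨τ, h', rfl⟩ := ih₁ h
      exact ⟨τ, Or.inl h', rfl⟩
    · obtain ⟨τ, h', rfl⟩ := ih₂ h
      exact ⟨τ, Or.inr h', rfl⟩
  | force S a ih =>
    rintro _ ⟨τ, rfl, h⟩
    obtain ⟨τ, h', rfl⟩ := ih h
    exact ⟨S :: τ, ⟨τ, rfl, h'⟩, rfl⟩

theorem Off_mirror (he : ∀ i x y, dW (e i x) (e i y) ≤ d x y) {a : Strat V} {x y : V} {c : ℝ}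
    (ha : ∀ σ, Br a σ → Off d σ x y c) (i : Bool) {σ : List (Set W)} (h : Br (a.mirror e) σ) :
    Off dW σ (e i x) (e i y) c := by
  obtain ⟨τ, hτ, rfl⟩ := Br_mirror h
  refine Off_map (he i) (fun S z hz => ?_) (ha τ hτ)
  exact ⟨i, z, hz, rfl⟩

theorem Off_solo (hW : IsPseudo dW) (he : ∀ i x y, dW (e i x) (e i y) ≤ d x y) {i : Bool}
    {b : Strat V} : ∀ {S : Set V} {σ : List (Set W)}, Br (solo e s t i b S) σ →
      ∃ τ, Br b τ ∧ ∀ y ∈ S, ∀ q, Off d τ y t q → Off dW σ (e i y) (e i t) q := by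
  induction b with
  | halt => rintro S _ rfl; exact ⟨[], rfl, fun y _ q h => (he _ _ _).trans h⟩
  | mark b ih =>
    rintro S _ ⟨_, rfl, _, rfl, h⟩
    obtain ⟨τ, hτ, h⟩ := ih h
    refine ⟨τ, hτ, fun y hy q hq => ⟨e i y, Or.inl ⟨y, hy, rfl⟩, e i y, Or.inl ⟨y, hy, rfl⟩, ?_⟩⟩
    simpa [hW.self] using h y hy q hq
  | coin a₁ a₂ ih₁ ih₂ =>
    rintro S σ (h | h)
    · obtain ⟨τ, hτ, h⟩ := ih₁ h
      exact ⟨τ, Or.inl hτ, h⟩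
    · obtain ⟨τ, hτ, h⟩ := ih₂ h
      exact ⟨τ, Or.inr hτ, h⟩
  | force S b ih =>
    rintro S' _ ⟨σ, rfl, h⟩
    obtain ⟨τ, hτ, h⟩ := ih h
    refine ⟨S :: τ, ⟨τ, rfl, hτ⟩, ?_⟩
    rintro y _ q ⟨z, hz, hq⟩
    exact ⟨e i z, Or.inl ⟨z, hz, rfl⟩, Off_mono (h z hz _ hq) (by linarith [he i y z])⟩

theorem Off_race (hW : IsPseudo dW) (he : ∀ i x y, dW (e i x) (e i y) ≤ d x y) : ∀ (n : ℕ)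
    {i k : Bool} {a b : Strat V} {Sa Sb : Set V} {σ : List (Set W)}, a.size + b.size ≤ n →
    Br (race e s t i k a Sa b Sb) σ →
      (∃ τ, Br a τ ∧ ∀ y ∈ Sa, ∀ q, Off d τ y t q → Off dW σ (e i y) (e i t) q) ∨
      (∃ τ, Br b τ ∧ ∀ y ∈ Sb, ∀ q, Off d τ y t q → Off dW σ (e (!i) y) (e (!i) t) q) := by
  intro n
  induction n with
  | zero =>
    intro i k a b Sa Sb σ hn
    cases a <;> simp [size] at hn
  | succ n ih =>
    intro i k a b Sa Sb σ hn h
    cases a with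
    | halt =>
      rw [race] at h
      obtain ⟨_, rfl, _, rfl, h⟩ := h
      obtain ⟨τ, hτ, h⟩ := Off_solo hW he h
      refine Or.inr ⟨τ, hτ, fun y hy q hq =>
        ⟨e (!i) y, Or.inr ⟨y, hy, rfl⟩, e (!i) y, Or.inr ⟨y, hy, rfl⟩, ?_⟩⟩
      simpa [hW.self] using h y hy q hq
    | mark a =>
      rw [race] at h
      simp only [size] at hn
      cases k with
      | true => exact ih (k := false) (a := a) (by omega) h
      | false =>
        rcases h with h | h
        · exact ih (a := a) (by omega) h
        · have := ih (by omega) h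
          rw [Bool.not_not] at this
          exact this.symm
    | coin a₁ a₂ =>
      rw [race] at h
      simp only [size] at hn
      rcases h with h | h
      · exact (ih (by omega) h).imp_left fun ⟨τ, hτ, h⟩ => ⟨τ, Or.inl hτ, h⟩
      · exact (ih (by omega) h).imp_left fun ⟨τ, hτ, h⟩ => ⟨τ, Or.inr hτ, h⟩
    | force S a =>
      rw [race] at h
      simp only [size] at hn
      obtain ⟨σ, rfl, h⟩ := h
      rcases ih (by omega) h with ⟨τ, hτ, h⟩ | ⟨τ, hτ, h⟩
      · refine Or.inl ⟨S :: τ, ⟨τ, rfl, hτ⟩, ?_⟩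
        rintro y _ q ⟨z, hz, hq⟩
        exact ⟨e i z, Or.inl ⟨z, hz, rfl⟩, Off_mono (h z hz _ hq) (by linarith [he i y z])⟩
      · refine Or.inr ⟨τ, hτ, fun y hy q hq => ⟨e (!i) y, Or.inr ⟨y, hy, rfl⟩, ?_⟩⟩
        simpa [hW.self] using h y hy q hq

theorem Off_selfRace (hW : IsPseudo dW) (he : ∀ i x y, dW (e i x) (e i y) ≤ d x y)
    {a : Strat V} {c : ℝ} (ha : ∀ σ, Br a σ → Off d σ s t c) {σ : List (Set W)}
    (h : Br (selfRace e s t a) σ) : ∃ i, Off dW σ (e i s) (e i t) c := by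
  rcases h with h | h
  all_goals
    rcases Off_race hW he _ le_rfl h with ⟨τ, hτ, h⟩ | ⟨τ, hτ, h⟩
    all_goals exact ⟨_, h s rfl c (ha τ hτ)⟩

end Offline

section Counting

variable {av : X → X → X}

theorem fold_mirror (f : ℕ → X) (e : Bool → V → W) (a : Strat V) :
    fold av f (a.mirror e) = fold av f a := by
  induction a generalizing f <;> simp_all [fold, Strat.mirror]

theorem fold_append (f : ℕ → X) (a b : Strat V) :
    fold av f (a.append b) = fold av (fun i => fold av (fun j => f (i + j)) b) a := by
  induction a generalizing f with
  | halt => simp [fold, Strat.append]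
  | mark a ih => simp only [fold, Strat.append, ih, Nat.add_right_comm]
  | coin a₁ a₂ ih₁ ih₂ => simp only [fold, Strat.append, ih₁, ih₂]
  | force S a ih => simp only [fold, Strat.append, ih]

theorem fold_coarsen (f : ℕ → X) (a : Strat V) {i : ℕ} (hi : i ≤ 2) :
    fold av f (a.coarsen i) = fold av (fun m => f ((m + i) / 3)) a := by
  induction a generalizing f i with
  | halt => simp only [fold, Strat.coarsen]; congr 1; omega
  | mark a ih =>
    simp only [fold, Strat.coarsen]
    split_ifs with h
    · subst h
      simp only [fold]
      rw [ih _ (by omega)]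
      congr 1
      ext m
      congr 1
      omega
    · rw [ih _ (by omega)]
      congr 1
      ext m
      congr 1
      omega
  | coin a₁ a₂ ih₁ ih₂ => simp only [fold, Strat.coarsen, ih₁ _ hi, ih₂ _ hi]
  | force S a ih => simp only [fold, Strat.coarsen, ih _ hi]

theorem fold_solo (f : ℕ → X) (e : Bool → V → W) (s t : V) (i : Bool) (b : Strat V)
    (S : Set V) : fold av f (solo e s t i b S) = fold av f b := by
  induction b generalizing f S <;> simp_all [fold, solo]

/-- The value of `f` at the number of rounds of a race, averaged with `av`, when the copy
that moves has `p` rounds left, to be played in blocks of two, and the other one `q`. -/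
def raceVal (av : X → X → X) (f : ℕ → X) (p q : ℕ) (k : Bool) : X :=
  match p with
  | 0 => f (q + 1)
  | p + 1 =>
    if k then raceVal av f p q false
    else av (raceVal av (fun m => f (m + 1)) p q true) (raceVal av (fun m => f (m + 1)) q p true)
termination_by p + q

theorem fold_av (hav : ∀ x y z w, av (av x y) (av z w) = av (av x z) (av y w))
    (f g : ℕ → X) (a : Strat V) :
    fold av (fun m => av (f m) (g m)) a = av (fold av f a) (fold av g a) := by
  induction a generalizing f g with
  | halt => rfl
  | mark a ih => exact ih _ _
  | coin a₁ a₂ ih₁ ih₂ => simp only [fold, ih₁, ih₂]; exact hav _ _ _ _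
  | force S a ih => exact ih _ _

theorem fold_comm (hav : ∀ x y z w, av (av x y) (av z w) = av (av x z) (av y w))
    (f : ℕ → ℕ → X) (a : Strat V) (b : Strat W) :
    fold av (fun p => fold av (f p) b) a = fold av (fun q => fold av (fun p => f p q) a) b := by
  induction a generalizing f with
  | halt => rfl
  | mark a ih => exact ih _
  | coin a₁ a₂ ih₁ ih₂ => simp only [fold, ih₁, ih₂, fold_av hav]
  | force S a ih => exact ih _

theorem fold_race (hav : ∀ x y z w, av (av x y) (av z w) = av (av x z) (av y w))
    (e : Bool → V → W) (s t : V) : ∀ (n : ℕ) (f : ℕ → X) {i k : Bool}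
    {a b : Strat V} {Sa Sb : Set V}, a.size + b.size ≤ n →
      fold av f (race e s t i k a Sa b Sb) =
        fold av (fun p => fold av (fun q => raceVal av f p q k) b) a := by
  intro n
  induction n with
  | zero =>
    intro f i k a b Sa Sb hn
    cases a <;> simp [size] at hn
  | succ n ih =>
    intro f i k a b Sa Sb hn
    cases a with
    | halt => simp [race, fold, raceVal, fold_solo]
    | mark a =>
      simp only [size] at hn
      rw [race]
      cases k with
      | true => simp [fold, raceVal, ih f (a := a) (b := b) (by omega)]
      | false =>
        simp only [Bool.false_eq_true, if_false, fold, raceVal, fold_av hav,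
          ih _ (a := a) (b := b) (by omega), ih _ (a := b) (b := a) (by omega)]
        rw [fold_comm hav (fun q p => raceVal av _ q p true) b a]
    | coin a₁ a₂ =>
      simp only [size] at hn
      rw [race]
      simp only [fold, ih _ (a := a₁) (b := b) (by omega), ih _ (a := a₂) (b := b) (by omega)]
    | force S a =>
      simp only [size] at hn
      rw [race]
      simp only [fold, ih _ (a := a) (b := b) (by omega)]

end Counting

section Expectation

/-- The average of two real numbers. -/
noncomputable def mean (x y : ℝ) : ℝ := (x + y) / 2

theorem mean_medial (x y z w : ℝ) :
    mean (mean x y) (mean z w) = mean (mean x z) (mean y w) := by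
  simp only [mean]; ring

/-- The expectation of a function of the number of marks. -/
noncomputable def Ex (f : ℕ → ℝ) (a : Strat V) : ℝ := fold mean f a

/-- A property of the number of marks that holds on all branches. -/
def AllM (P : ℕ → Prop) (a : Strat V) : Prop := fold And P a

theorem and_medial (x y z w : Prop) : ((x ∧ y) ∧ z ∧ w) = ((x ∧ z) ∧ y ∧ w) :=
  propext and_and_and_comm

theorem AllM.imp {P Q : ℕ → Prop} {a : Strat V} (h : AllM P a) (hPQ : ∀ m, P m → Q m) :
    AllM Q a := by
  induction a generalizing P Q with
  | halt => exact hPQ 0 h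
  | mark a ih => exact ih (P := fun m => P (m + 1)) h fun m => hPQ (m + 1)
  | coin a b iha ihb => exact ⟨iha h.1 hPQ, ihb h.2 hPQ⟩
  | force S a ih => exact ih (P := P) h hPQ

theorem Ex_le {f g : ℕ → ℝ} {a : Strat V} (h : AllM (fun m => f m ≤ g m) a) : Ex f a ≤ Ex g a := by
  induction a generalizing f g with
  | halt => exact h
  | mark a ih => exact ih h
  | coin a b iha ihb =>
    have h1 := iha h.1
    have h2 := ihb h.2
    simp only [Ex, fold, mean] at *
    linarith
  | force S a ih => exact ih h

theorem Ex_affine (u v : ℝ) (f : ℕ → ℝ) (a : Strat V) :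
    Ex (fun m => u * f m + v) a = u * Ex f a + v := by
  induction a generalizing f with
  | halt => rfl
  | mark a ih => exact ih _
  | coin a b iha ihb =>
    simp only [Ex, fold, mean] at *
    rw [iha, ihb]
    ring
  | force S a ih => exact ih _

theorem sq_Ex_le (f : ℕ → ℝ) (a : Strat V) : Ex f a ^ 2 ≤ Ex (fun m => f m ^ 2) a := by
  induction a generalizing f with
  | halt => exact le_rfl
  | mark a ih => exact ih _
  | coin a b iha ihb =>
    have h1 := iha f
    have h2 := ihb f
    simp only [Ex, fold, mean] at *
    nlinarith [sq_nonneg (fold mean f a - fold mean f b)]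
  | force S a ih => exact ih _

theorem raceVal_and_of_le (B : ℕ) : ∀ (n p q t : ℕ) (k : Bool), p + q ≤ n →
    2 * B ≤ p + q + 2 * t + (if k then 0 else 1) →
      raceVal And (fun z => B ≤ z + t) p q k := by
  intro n
  induction n with
  | zero =>
    intro p q t k hn h
    obtain rfl : p = 0 := by omega
    rw [raceVal]
    split_ifs at h <;> omega
  | succ n ih =>
    intro p q t k hn h
    cases p with
    | zero => rw [raceVal]; split_ifs at h <;> omega
    | succ p =>
      rw [raceVal]
      cases k with
      | true =>
        simp only [if_true] at h ⊢
        exact ih _ _ _ _ (by omega) (by simp; omega)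
      | false =>
        simp only [Bool.false_eq_true, if_false] at h ⊢
        simp only [Nat.add_assoc, Nat.add_comm 1 t]
        exact ⟨ih p q (t + 1) true (by omega) (by simp; omega),
          ih q p (t + 1) true (by omega) (by simp; omega)⟩

theorem AllM_selfRace {B : ℕ} {a : Strat V} (h : AllM (fun m => B ≤ m) a) (e : Bool → V → W)
    (s t : V) : AllM (fun m => B ≤ m) (selfRace e s t a) := by
  have key : AllM (fun p => AllM (fun q => raceVal And (fun z => B ≤ z) p q true) a) a :=
    h.imp fun p hp => h.imp fun q hq =>
      raceVal_and_of_le B _ p q 0 true le_rfl (by simp; omega)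
  constructor
  all_goals
    rw [fold_race (av := And) and_medial e s t _ _ le_rfl]
    exact key

end Expectation

section RaceGain

/-- The expected square root of `t` plus the number of rounds of a race. -/
noncomputable def sqrtRace (t p q : ℕ) : ℝ := raceVal mean (fun z => √(t + z : ℕ)) p q true

theorem sqrtRace_of_le_one (t q : ℕ) {p : ℕ} (hp : p ≤ 1) :
    sqrtRace t p q = √(t + (q + 1) : ℕ) := by
  interval_cases p <;> simp [sqrtRace, raceVal]

theorem sqrtRace_add_two (t p q : ℕ) :
    sqrtRace t (p + 2) q = mean (sqrtRace (t + 1) p q) (sqrtRace (t + 1) q p) := by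
  simp [sqrtRace, raceVal, Nat.add_assoc, Nat.add_comm 1]

theorem add_div_le_sqrt_add {m y : ℝ} (hm : 0 < m) (hy : 0 ≤ y) (hy2 : y ≤ 2 * m) :
    √m + y / (3 * √m) ≤ √(m + y) := by
  have hr : 0 < √m := Real.sqrt_pos.2 hm
  have hs : √m ^ 2 = m := Real.sq_sqrt hm.le
  apply Real.le_sqrt_of_sq_le
  have h1 : (√m + y / (3 * √m)) ^ 2 = m + 2 / 3 * y + y * y / (9 * m) := by
    rw [add_sq, hs, div_pow, mul_pow, hs]
    field_simp
    ring
  have h2 : y * y / (9 * m) ≤ y * (1 / 3) := by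
    rw [mul_div_assoc]
    refine mul_le_mul_of_nonneg_left ?_ hy
    rw [div_le_iff₀ (by positivity)]
    linarith
  linarith

theorem sqrtRace_ge_linear {m : ℝ} (hm : 1 ≤ m) : ∀ (n t p q : ℕ), p + q ≤ n →
    t + (p + q : ℝ) / 2 = m → √m + |(p : ℝ) - q - 2| / 6 / √m ≤ sqrtRace t p q := by
  have base : ∀ t p q : ℕ, p ≤ 1 → t + (p + q : ℝ) / 2 = m →
      √m + |(p : ℝ) - q - 2| / 6 / √m ≤ sqrtRace t p q := by
    intro t p q hp h
    have hp' : (p : ℝ) ≤ 1 := by exact_mod_cast hp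
    have hq : (0 : ℝ) ≤ q := q.cast_nonneg
    have ht : (0 : ℝ) ≤ t := t.cast_nonneg
    rw [sqrtRace_of_le_one _ _ hp, abs_of_nonpos (by linarith)]
    have := add_div_le_sqrt_add (m := m) (y := (q + 2 - p) / 2) (by linarith) (by linarith)
      (by interval_cases p <;> push_cast at * <;> linarith)
    calc _ = √m + (q + 2 - p : ℝ) / 2 / (3 * √m) := by rw [div_div, div_div]; congr 1; ring_nf
      _ ≤ _ := this
      _ = _ := by congr 1; push_cast; linarith
  intro n
  induction n with
  | zero => exact fun t p q hn h => base t p q (by omega) h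
  | succ n ih =>
    intro t p q hn h
    rcases p with _ | _ | p
    · exact base _ _ _ (by omega) h
    · exact base _ _ _ (by omega) h
    · have h1 := ih (t + 1) p q (by omega) (by push_cast at *; linarith)
      have h2 := ih (t + 1) q p (by omega) (by push_cast at *; linarith)
      rw [sqrtRace_add_two, mean]
      have h3 : |((p + 1 + 1 : ℕ) : ℝ) - q - 2| ≤
          (|(p : ℝ) - q - 2| + |(q : ℝ) - p - 2|) / 2 := by
        push_cast
        rw [show (p : ℝ) + 1 + 1 - q - 2 = ((p - q - 2) - (q - p - 2)) / 2 by ring, abs_div,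
          abs_two]
        linarith [abs_sub (p - q - 2 : ℝ) (q - p - 2)]
      have h4 : |((p + 1 + 1 : ℕ) : ℝ) - q - 2| / 6 / √m ≤
          ((|(p : ℝ) - q - 2| + |(q : ℝ) - p - 2|) / 2) / 6 / √m := by gcongr
      have h5 : ((|(p : ℝ) - q - 2| + |(q : ℝ) - p - 2|) / 2) / 6 / √m =
        (|(p : ℝ) - q - 2| / 6 / √m + |(q : ℝ) - p - 2| / 6 / √m) / 2 := by ring
      linarith

/-- The expected square root of the number of rounds of a race where a coin decides who
begins. -/
noncomputable def symRace (t p q : ℕ) : ℝ := mean (sqrtRace t p q) (sqrtRace t q p)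

theorem symRace_ge_linear {m : ℝ} (hm : 1 ≤ m) {t p q : ℕ} (h : t + (p + q : ℝ) / 2 = m) :
    √m + |(p : ℝ) - q| / 6 / √m ≤ symRace t p q := by
  have h1 := sqrtRace_ge_linear hm _ t p q le_rfl h
  have h2 := sqrtRace_ge_linear hm _ t q p le_rfl (by linarith)
  rw [symRace, mean]
  have h3 : |(p : ℝ) - q| ≤ (|(p : ℝ) - q - 2| + |(q : ℝ) - p - 2|) / 2 := by
    rw [show (p : ℝ) - q = ((p - q - 2) - (q - p - 2)) / 2 by ring, abs_div, abs_two]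
    have := abs_sub (p - q - 2 : ℝ) (q - p - 2)
    rw [show ((p : ℝ) - q - 2 - (q - p - 2)) / 2 = p - q by ring]
    linarith
  have h4 : |(p : ℝ) - q| / 6 / √m ≤
      ((|(p : ℝ) - q - 2| + |(q : ℝ) - p - 2|) / 2) / 6 / √m := by gcongr
  have h5 : ((|(p : ℝ) - q - 2| + |(q : ℝ) - p - 2|) / 2) / 6 / √m =
    (|(p : ℝ) - q - 2| / 6 / √m + |(q : ℝ) - p - 2| / 6 / √m) / 2 := by ring
  linarith

/-- A polynomial lower bound for the expected distance from the origin, in units of `s`, of a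
random walk with steps `±2` after `T` steps from `D`. -/
noncomputable def walkBound (s D T : ℝ) : ℝ :=
  (D ^ 2 + 4 * T) / s - (D ^ 4 + 24 * T * D ^ 2 + 48 * T ^ 2) / (4 * s ^ 3)

theorem walkBound_zero_le {s : ℝ} (hs : 0 < s) (D : ℝ) : walkBound s D 0 ≤ |D| := by
  have hu : 0 ≤ |D| / s := by positivity
  have hD : |D| = s * (|D| / s) := by field_simp
  rw [walkBound, ← sq_abs D, show D ^ 4 = |D| ^ 4 by rw [← abs_pow, abs_of_nonneg (by positivity)]]
  generalize |D| / s = u at *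
  rw [hD]
  have : ((s * u) ^ 2 + 4 * 0) / s - ((s * u) ^ 4 + 24 * 0 * (s * u) ^ 2 + 48 * 0 ^ 2) /
      (4 * s ^ 3) = s * (u ^ 2 - u ^ 4 / 4) := by field_simp; ring
  rw [this]
  apply mul_le_mul_of_nonneg_left _ hs.le
  nlinarith [mul_nonneg hu (sq_nonneg (u - 1)), mul_nonneg hu hu,
    mul_nonneg (mul_nonneg hu hu) hu, mul_nonneg hu (sq_nonneg (u - 23 / 20))]

theorem walkBound_succ_le {s : ℝ} (hs : 0 < s) (D T : ℝ) :
    walkBound s D (T + 1) ≤ (walkBound s (D - 2) T + walkBound s (D + 2) T) / 2 := by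
  have : (walkBound s (D - 2) T + walkBound s (D + 2) T) / 2 - walkBound s D (T + 1) =
      8 / s ^ 3 := by
    simp only [walkBound]; field_simp; ring
  have h : 0 < 8 / s ^ 3 := by positivity
  linarith

theorem symRace_ge_walkBound {m : ℝ} (hm : 1 ≤ m) : ∀ (T t p q : ℕ), 2 * T ≤ p → 2 * T ≤ q →
    t + (p + q : ℝ) / 2 = m →
      √m + walkBound (3 * √m) (p - q) T / 6 / √m ≤ symRace t p q := by
  have hr : 0 < √m := Real.sqrt_pos.2 (by linarith)
  intro T
  induction T with
  | zero =>
    intro t p q _ _ h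
    refine le_trans ?_ (symRace_ge_linear hm h)
    have := walkBound_zero_le (s := 3 * √m) (by positivity) (p - q)
    push_cast
    gcongr
  | succ T ih =>
    intro t p q hp hq h
    obtain ⟨p, rfl⟩ : ∃ p', p = p' + 2 := ⟨p - 2, by omega⟩
    obtain ⟨q, rfl⟩ : ∃ q', q = q' + 2 := ⟨q - 2, by omega⟩
    have h1 := ih (t + 1) p (q + 2) (by omega) (by omega) (by push_cast at *; linarith)
    have h2 := ih (t + 1) q (p + 2) (by omega) (by omega) (by push_cast at *; linarith)
    rw [symRace, sqrtRace_add_two t p, sqrtRace_add_two t q, mean]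
    change _ ≤ (symRace (t + 1) p (q + 2) + symRace (t + 1) q (p + 2)) / 2
    have h3 := walkBound_succ_le (s := 3 * √m) (by positivity) (p - q) T
    have h4 : walkBound (3 * √m) (p - q + 2) T = walkBound (3 * √m) (q - (p + 2 : ℕ)) T := by
      rw [show (p - q + 2 : ℝ) = -(q - (p + 2 : ℕ)) by push_cast; ring]
      simp only [walkBound, neg_sq, Even.neg_pow (show Even 4 by decide)]
    rw [h4, show (p - q - 2 : ℝ) = p - (q + 2 : ℕ) by push_cast; ring] at h3
    have h5 : walkBound (3 * √m) ((p + 2 : ℕ) - (q + 2 : ℕ)) (T + 1 : ℕ) / 6 / √m ≤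
        ((walkBound (3 * √m) (p - (q + 2 : ℕ)) T + walkBound (3 * √m) (q - (p + 2 : ℕ)) T) / 2)
          / 6 / √m := by
      have : ((p + 2 : ℕ) - (q + 2 : ℕ) : ℝ) = p - q := by push_cast; ring
      rw [this]
      push_cast at *
      gcongr
    have h7 : ((walkBound (3 * √m) (p - (q + 2 : ℕ)) T + walkBound (3 * √m) (q - (p + 2 : ℕ)) T)
        / 2) / 6 / √m = (walkBound (3 * √m) (p - (q + 2 : ℕ)) T / 6 / √m +
          walkBound (3 * √m) (q - (p + 2 : ℕ)) T / 6 / √m) / 2 := by ring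
    linarith

end RaceGain

section RoundGain

/-- The number of rounds below which the race gain is not claimed. -/
abbrev minRounds : ℕ := 14400

theorem symRace_ge {p q : ℕ} (hp : minRounds ≤ p) (hq : minRounds ≤ q) :
    (√(p : ℝ) + √(q : ℝ)) / 2 + 1 / 30 ≤ symRace 0 p q := by
  have hp' : (14400 : ℝ) ≤ p := by exact_mod_cast hp
  have hq' : (14400 : ℝ) ≤ q := by exact_mod_cast hq
  obtain ⟨m, hm⟩ : ∃ m : ℝ, m = (p + q) / 2 := ⟨_, rfl⟩
  have hm1 : 14400 ≤ m := by linarith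
  have hr : 120 ≤ √m := Real.le_sqrt_of_sq_le (by linarith)
  have hrr : √m ^ 2 = m := Real.sq_sqrt (by linarith)
  have hconc : (√(p : ℝ) + √(q : ℝ)) / 2 ≤ √m := by
    apply Real.le_sqrt_of_sq_le
    have h1 := Real.sq_sqrt (p.cast_nonneg : (0 : ℝ) ≤ p)
    have h2 := Real.sq_sqrt (q.cast_nonneg : (0 : ℝ) ≤ q)
    nlinarith [sq_nonneg (√(p : ℝ) - √(q : ℝ))]
  suffices √m + 1 / 30 ≤ symRace 0 p q by linarith
  rcases le_or_gt (√m) |(p : ℝ) - q| with hD | hD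
  · refine le_trans ?_ (symRace_ge_linear (m := m) (by linarith) (by simp [hm]))
    have : 1 / 30 ≤ |(p : ℝ) - q| / 6 / √m := by
      rw [le_div_iff₀ (by linarith)]
      linarith
    linarith
  · obtain ⟨T, hT⟩ : ∃ T, T = min p q / 2 := ⟨_, rfl⟩
    refine le_trans ?_ (symRace_ge_walkBound (m := m) (by linarith) T 0 p q (by omega)
      (by omega) (by simp [hm]))
    obtain ⟨hD1, hD2⟩ := abs_lt.1 hD
    have hmin : m - √m / 2 ≤ (min p q : ℕ) := by
      rcases min_choice p q with h | h <;> rw [h] <;> linarith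
    have hmin2 : ((min p q : ℕ) : ℝ) ≤ m := by
      have h1 : ((min p q : ℕ) : ℝ) ≤ p := by exact_mod_cast min_le_left p q
      have h2 : ((min p q : ℕ) : ℝ) ≤ q := by exact_mod_cast min_le_right p q
      linarith
    have hT1 : ((min p q : ℕ) : ℝ) ≤ 2 * T + 1 := by
      have : min p q ≤ 2 * T + 1 := by omega
      exact_mod_cast this
    have hT2 : (2 * T : ℝ) ≤ (min p q : ℕ) := by
      have : 2 * T ≤ min p q := by omega
      exact_mod_cast this
    have hrm : 120 * √m ≤ m := by nlinarith
    obtain ⟨δ, hδ⟩ : ∃ δ : ℝ, (p - q : ℝ) ^ 2 = δ * m :=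
      ⟨(p - q : ℝ) ^ 2 / m, by field_simp⟩
    obtain ⟨τ, hτ⟩ : ∃ τ : ℝ, (T : ℝ) = τ * m := ⟨T / m, by field_simp⟩
    have hm0 : 0 < m := by linarith
    have hδ0 : 0 ≤ δ := nonneg_of_mul_nonneg_left (hδ ▸ sq_nonneg _) hm0
    have hδ1 : δ ≤ 1 := by
      have : (p - q : ℝ) ^ 2 ≤ m := by rw [← hrr]; exact sq_le_sq' hD1.le hD2.le
      exact le_of_mul_le_mul_right (by linarith) hm0
    have hτ1 : 1 / 3 ≤ τ := le_of_mul_le_mul_right (by linarith) hm0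
    have hτ2 : τ ≤ 1 / 2 := le_of_mul_le_mul_right (by linarith) hm0
    have key : walkBound (3 * √m) (p - q) T / 6 / √m =
        ((δ + 4 * τ) / 3 - (δ ^ 2 + 24 * τ * δ + 48 * τ ^ 2) / 108) / 6 := by
      rw [walkBound, show ((p : ℝ) - q) ^ 4 = ((p - q : ℝ) ^ 2) ^ 2 by ring, hδ, hτ]
      generalize √m = r at *
      subst hrr
      field_simp
      ring
    rw [key]
    have h1 := mul_nonneg hδ0 (sub_nonneg.2 hδ1)
    have h2 := mul_nonneg hδ0 (sub_nonneg.2 hτ2)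
    have h3 := mul_nonneg (sub_nonneg.2 hτ1) (sub_nonneg.2 hτ2)
    linarith

theorem Ex_sqrt_selfRace {a : Strat V} (h : AllM (fun m => minRounds ≤ m) a) (e : Bool → V → W)
    (s t : V) : Ex (fun m => √(m : ℝ)) a + 1 / 30 ≤
      Ex (fun m => √(m : ℝ)) (selfRace e s t a) := by
  have h1 : Ex (fun m => √(m : ℝ)) (selfRace e s t a) =
      Ex (fun p => Ex (fun q => symRace 0 p q) a) a := by
    have hr : ∀ i, fold mean (fun m => √(m : ℝ)) (race e s t i true a {s} a {s}) =
        fold mean (fun p => fold mean (fun q => sqrtRace 0 p q) a) a := by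
      intro i
      rw [fold_race mean_medial e s t _ _ le_rfl]
      simp [sqrtRace]
    simp only [Ex, selfRace, fold, hr, symRace]
    simp only [fold_av mean_medial]
    rw [fold_comm mean_medial (fun p q => sqrtRace 0 q p)]
  rw [h1]
  have h2 : Ex (fun p => Ex (fun q => 1 / 2 * √(q : ℝ) + (1 / 2 * √(p : ℝ) + 1 / 30)) a) a ≤
      Ex (fun p => Ex (fun q => symRace 0 p q) a) a :=
    Ex_le (h.imp fun p hp => Ex_le (h.imp fun q hq => by linarith [symRace_ge hp hq]))
  refine le_trans (le_of_eq ?_) h2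
  simp only [Ex_affine]
  have h3 := Ex_affine (1 / 2) (1 / 2 * Ex (fun m => √(m : ℝ)) a + 1 / 30)
    (fun m => √(m : ℝ)) a
  have h4 : (fun p : ℕ => 1 / 2 * Ex (fun m => √(m : ℝ)) a + (1 / 2 * √(p : ℝ) + 1 / 30)) =
    fun p : ℕ => 1 / 2 * √(p : ℝ) + (1 / 2 * Ex (fun m => √(m : ℝ)) a + 1 / 30) := by
    ext p; ring
  rw [h4, h3]
  ring

theorem sqrt_third_ge {x y z : ℕ} (hz : minRounds ≤ z) :
    (√(x : ℝ) + √(y : ℝ) + √(z : ℝ)) / 3 - 1 / 180 ≤ √(((x + (z + y)) / 3 : ℕ) : ℝ) := by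
  have hz' : (14400 : ℝ) ≤ z := by exact_mod_cast hz
  have h1 := Real.sq_sqrt (x.cast_nonneg : (0 : ℝ) ≤ x)
  have h2 := Real.sq_sqrt (y.cast_nonneg : (0 : ℝ) ≤ y)
  have h3 : √(z - 2 : ℝ) ^ 2 = z - 2 := Real.sq_sqrt (by linarith)
  have h4 : √(z : ℝ) - 1 / 60 ≤ √(z - 2 : ℝ) := by
    apply Real.le_sqrt_of_sq_le
    have : 120 ≤ √(z : ℝ) := Real.le_sqrt_of_sq_le (by linarith)
    have := Real.sq_sqrt (z.cast_nonneg : (0 : ℝ) ≤ z)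
    nlinarith
  have h5 : (x + (z + y) - 2 : ℝ) / 3 ≤ ((x + (z + y)) / 3 : ℕ) := by
    have : x + (z + y) ≤ 3 * ((x + (z + y)) / 3) + 2 := by omega
    have : (x + (z + y) : ℝ) ≤ 3 * ((x + (z + y)) / 3 : ℕ) + 2 := by exact_mod_cast this
    linarith
  suffices (√(x : ℝ) + √(y : ℝ) + √(z - 2 : ℝ)) / 3 ≤ √(((x + (z + y)) / 3 : ℕ) : ℝ) by linarith
  apply Real.le_sqrt_of_sq_le
  nlinarith [sq_nonneg (√(x : ℝ) - √(y : ℝ)), sq_nonneg (√(x : ℝ) - √(z - 2 : ℝ)),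
    sq_nonneg (√(y : ℝ) - √(z - 2 : ℝ))]

end RoundGain

/-- A strategy `a` that leads the offline player from `s` to `t` along a shortest path, whereas
every round costs `β` to an online player. -/
structure IsGadget (d : V → V → ℝ) (s t : V) (β l : ℝ) (a : Strat V) : Prop where
  pseudo : IsPseudo d
  fair : Fair d β β a {s}
  dist : d s t = l
  off : ∀ σ, Br a σ → Off d σ s t l

section Triple

/-- Two parallel chains, each consisting of three copies of `V`. -/
abbrev Triple (V : Type) : Type := Bool × Fin 3 × V

variable (d : V → V → ℝ) (s t : V)

/-- The projection of the chains to their `c`-th copies of `V`. -/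
def proj (c : Fin 3) (w : Triple V) : V :=
  if w.2.1 = c then w.2.2 else if w.2.1 < c then s else t

/-- The distance within a chain. -/
noncomputable def chainDist (w w' : Triple V) : ℝ :=
  d (proj s t 0 w) (proj s t 0 w') + d (proj s t 1 w) (proj s t 1 w') +
    d (proj s t 2 w) (proj s t 2 w')

/-- Half the separation of the two chains at `w`. -/
noncomputable def separation (w : Triple V) : ℝ :=
  min (d s (proj s t 0 w)) (d (proj s t 2 w) t)

/-- The separation with a sign depending on the chain. -/
noncomputable def height (w : Triple V) : ℝ :=
  if w.1 then separation d s t w else -separation d s t w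

/-- The distance on the two chains, which meet in both end points. -/
noncomputable def tripleDist (w w' : Triple V) : ℝ :=
  max (chainDist d s t w w') |height d s t w - height d s t w'|

/-- The `c`-th copies of `V` in the two chains. -/
def copy (c : Fin 3) (i : Bool) (x : V) : Triple V := (i, c, x)

/-- Play `a` in the first copies, then a race in the middle copies, then `a` in the last copies,
and declare three rounds to be one. -/
def tripleStrat (a : Strat V) : Strat (Triple V) :=
  ((a.mirror (copy 0)).append <| force (pairSet (copy 1) true {s} {s}) <|
    (selfRace (copy 1) s t a).append <| force {w | ∃ i, ∃ x ∈ ({s} : Set V), w = copy 2 i x} <|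
      a.mirror (copy 2)).coarsen 0

variable {d s t}

theorem IsPseudo.chainDist (hd : IsPseudo d) : IsPseudo (chainDist d s t) where
  self x := by simp [KServerLB.chainDist, hd.self]
  symm x y := by
    simp only [KServerLB.chainDist]
    rw [hd.symm (proj s t 0 x), hd.symm (proj s t 1 x), hd.symm (proj s t 2 x)]
  tri x y z := by
    simp only [KServerLB.chainDist]
    linarith [hd.tri (proj s t 0 x) (proj s t 0 y) (proj s t 0 z),
      hd.tri (proj s t 1 x) (proj s t 1 y) (proj s t 1 z),
      hd.tri (proj s t 2 x) (proj s t 2 y) (proj s t 2 z)]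

theorem IsPseudo.tripleDist (hd : IsPseudo d) : IsPseudo (tripleDist d s t) where
  self x := by simp [KServerLB.tripleDist, hd.chainDist.self]
  symm x y := by
    simp only [KServerLB.tripleDist]
    rw [hd.chainDist.symm, abs_sub_comm]
  tri x y z := by
    simp only [KServerLB.tripleDist]
    refine max_le ?_ ?_
    · exact (hd.chainDist.tri x y z).trans (add_le_add (le_max_left _ _) (le_max_left _ _))
    · exact (abs_sub_le _ (height d s t y) _).trans
        (add_le_add (le_max_right _ _) (le_max_right _ _))

theorem separation_le (hd : IsPseudo d) (w w' : Triple V) :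
    separation d s t w ≤ separation d s t w' + chainDist d s t w w' := by
  have h0 := hd.nonneg (proj s t 0 w) (proj s t 0 w')
  have h1 := hd.nonneg (proj s t 1 w) (proj s t 1 w')
  have h2 := hd.nonneg (proj s t 2 w) (proj s t 2 w')
  simp only [separation, chainDist]
  rw [min_def (d s (proj s t 0 w'))]
  split_ifs
  · refine (min_le_left _ _).trans ?_
    linarith [hd.tri s (proj s t 0 w') (proj s t 0 w), hd.symm (proj s t 0 w) (proj s t 0 w')]
  · refine (min_le_right _ _).trans ?_
    linarith [hd.tri (proj s t 2 w) (proj s t 2 w') t]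

theorem tripleDist_same (hd : IsPseudo d) (i : Bool) (w w' : Fin 3 × V) :
    tripleDist d s t (i, w) (i, w') = chainDist d s t (i, w) (i, w') := by
  refine max_eq_left ?_
  have h1 := separation_le (s := s) (t := t) hd (i, w) (i, w')
  have h2 := separation_le (s := s) (t := t) hd (i, w') (i, w)
  rw [hd.chainDist.symm] at h2
  rw [abs_le]
  cases i <;> simp only [height, if_true, Bool.false_eq_true, if_false] <;>
    constructor <;> linarith

theorem tripleDist_copy (hd : IsPseudo d) (c : Fin 3) (i : Bool) (x y : V) :
    tripleDist d s t (copy c i x) (copy c i y) = d x y := by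
  rw [copy, copy, tripleDist_same hd]
  fin_cases c <;> simp [chainDist, proj, hd.self]

theorem le_tripleDist_copy (hd : IsPseudo d) (c : Fin 3) (i j : Bool) (x y : V) :
    d x y ≤ tripleDist d s t (copy c i x) (copy c j y) := by
  refine le_trans (le_of_eq ?_) (le_max_left _ _)
  fin_cases c <;> simp [chainDist, proj, copy, hd.self]

theorem le_tripleDist_cross (hd : IsPseudo d) (i : Bool) (x y : V) :
    2 * d s t ≤ tripleDist d s t (copy 1 i x) (copy 1 (!i) y) := by
  refine le_trans ?_ (le_max_right _ _)
  have h := hd.nonneg s t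
  cases i <;> simp [height, separation, proj, copy]
  · rw [abs_of_nonpos] <;> linarith
  · rw [abs_of_nonneg] <;> linarith

theorem tripleDist_copy_succ (hd : IsPseudo d) (i : Bool) :
    tripleDist d s t (copy 0 i t) (copy 1 i s) = 0 ∧
      tripleDist d s t (copy 1 i t) (copy 2 i s) = 0 := by
  simp only [copy, tripleDist_same hd]
  simp [chainDist, proj, hd.self]

theorem tripleDist_ends (hd : IsPseudo d) (i : Bool) :
    tripleDist d s t (copy 0 true s) (copy 0 i s) = 0 ∧
      tripleDist d s t (copy 2 i t) (copy 2 true t) = 0 := by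
  have h := hd.nonneg s t
  cases i <;> simp [tripleDist, chainDist, proj, copy, height, separation, hd.self, h]

theorem IsGadget.triple {β l : ℝ} {a : Strat V} (h : IsGadget d s t β l a) (hβ : 0 ≤ β)
    (hl : 2 * β ≤ l) :
    IsGadget (tripleDist d s t) (copy 0 true s) (copy 2 true t) (3 * β) (3 * l)
      (tripleStrat s t a) where
  pseudo := h.pseudo.tripleDist
  dist := by
    have hn := h.pseudo.nonneg s t
    rw [← h.dist]
    simp [tripleDist, chainDist, proj, copy, height, separation, h.pseudo.self, hn]
    ring_nf
    simp [hn]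
  fair := by
    have hd := h.pseudo.tripleDist (s := s) (t := t)
    have hm : β ≤ 3 * β := by linarith
    have G : RaceGeometry d (tripleDist d s t) (copy 1) s t β :=
      { pseudo := h.pseudo
        pseudo' := hd
        side := fun i x y => (tripleDist_copy h.pseudo 1 i x y).ge
        cross := fun i x y => by linarith [le_tripleDist_cross (s := s) (t := t) h.pseudo i x y, h.dist]
        loop := by linarith [h.dist]
        nonneg := hβ }
    have h2 := (h.fair.mirror (le_tripleDist_copy (s := s) (t := t) h.pseudo 2)).mono_quit hm
    have h1 := (Fair_selfRace G h.fair).append fun T => h2.force hd (by linarith) T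
    have h0 := (h.fair.mirror (le_tripleDist_copy (s := s) (t := t) h.pseudo 0)).mono_quit hm
    refine ((h0.append fun T => h1.force hd (by linarith) T).coarsen hβ).anti ?_
    rintro _ rfl
    exact ⟨true, s, rfl, rfl⟩
  off σ hσ := by
    have hd := h.pseudo.tripleDist (s := s) (t := t)
    have he : ∀ c i x y, tripleDist d s t (copy c i x) (copy c i y) ≤ d x y :=
      fun c i x y => (tripleDist_copy h.pseudo c i x y).le
    obtain ⟨σ₀, _, rfl, h0, _, rfl, hτ⟩ := Br_append (Br_coarsen hσ)
    obtain ⟨σ₁, _, rfl, h1, σ₂, rfl, h2⟩ := Br_append hτ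
    obtain ⟨i, o1⟩ := Off_selfRace hd (he 1) h.off h1
    have o0 := Off_mirror (he 0) h.off i h0
    have o2 := Off_mirror (he 2) h.off i h2
    have o2 := Off_append hd (σ := σ₂) (τ := []) (le_of_eq (tripleDist_ends h.pseudo i).2) o2
    rw [List.append_nil] at o2
    have o2' : Off (tripleDist d s t) ({w | ∃ i, ∃ x ∈ ({s} : Set V), w = copy 2 i x} :: σ₂)
        (copy 1 i t) (copy 2 true t) l := by
      refine ⟨copy 2 i s, ⟨i, s, rfl, rfl⟩, Off_mono o2 ?_⟩
      rw [(tripleDist_copy_succ h.pseudo i).2]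
      simp
    have o1' : Off (tripleDist d s t) (pairSet (copy 1) true {s} {s} ::
        (σ₁ ++ ({w | ∃ i, ∃ x ∈ ({s} : Set V), w = copy 2 i x} :: σ₂)))
        (copy 0 i t) (copy 2 true t) (l + l) := by
      refine ⟨copy 1 i s, ?_, Off_mono (Off_append hd o2' o1) ?_⟩
      · cases i
        · exact Or.inr ⟨s, rfl, rfl⟩
        · exact Or.inl ⟨s, rfl, rfl⟩
      · rw [(tripleDist_copy_succ h.pseudo i).1]
        simp
    have o := Off_tri hd (copy 0 true s) (Off_append hd o1' o0)
    rw [(tripleDist_ends h.pseudo i).1] at o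
    exact Off_mono o (by linarith)

end Triple

section TripleCount

variable {s t : V} {a : Strat V}

theorem fold_tripleStrat {av : X → X → X} (f : ℕ → X) :
    fold av f (tripleStrat s t a) = fold av (fun x => fold av (fun z => fold av (fun y =>
      f ((x + (z + y)) / 3)) a) (selfRace (copy 1) s t a)) a := by
  simp [tripleStrat, fold_coarsen, fold_append, fold_mirror, fold]

theorem AllM_tripleStrat {B : ℕ} (h : AllM (fun m => B ≤ m) a) :
    AllM (fun m => B ≤ m) (tripleStrat s t a) := by
  rw [AllM, fold_tripleStrat]
  exact h.imp fun x hx => (AllM_selfRace h _ s t).imp fun z hz => h.imp fun y hy => by omega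

theorem Ex_sqrt_tripleStrat (h : AllM (fun m => minRounds ≤ m) a) :
    Ex (fun m => √(m : ℝ)) a + 1 / 180 ≤ Ex (fun m => √(m : ℝ)) (tripleStrat s t a) := by
  have h1 := Ex_sqrt_selfRace h (copy 1) s t
  rw [Ex, Ex, fold_tripleStrat]
  have h2 : Ex (fun x => Ex (fun z => Ex (fun y =>
      1 / 3 * √(y : ℝ) + (1 / 3 * √(z : ℝ) + (1 / 3 * √(x : ℝ) - 1 / 180))) a)
        (selfRace (copy 1) s t a)) a ≤
      Ex (fun x => Ex (fun z => Ex (fun y => √(((x + (z + y)) / 3 : ℕ) : ℝ)) a)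
        (selfRace (copy 1) s t a)) a :=
    Ex_le (h.imp fun x hx => Ex_le ((AllM_selfRace h _ s t).imp fun z hz =>
      Ex_le (h.imp fun y hy => by linarith [sqrt_third_ge (x := x) (y := y) hz])))
  refine le_trans ?_ h2
  have e1 : ∀ x z : ℕ, Ex (fun y : ℕ =>
      1 / 3 * √(y : ℝ) + (1 / 3 * √(z : ℝ) + (1 / 3 * √(x : ℝ) - 1 / 180))) a =
      1 / 3 * √(z : ℝ) + (1 / 3 * √(x : ℝ) + (1 / 3 * Ex (fun m => √(m : ℝ)) a - 1 / 180)) := by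
    intro x z; rw [Ex_affine]; ring
  simp only [e1]
  have e2 : ∀ x : ℕ, Ex (fun z : ℕ =>
      1 / 3 * √(z : ℝ) + (1 / 3 * √(x : ℝ) + (1 / 3 * Ex (fun m => √(m : ℝ)) a - 1 / 180)))
        (selfRace (copy 1) s t a) =
      1 / 3 * √(x : ℝ) + (1 / 3 * Ex (fun m => √(m : ℝ)) (selfRace (copy 1) s t a) +
        (1 / 3 * Ex (fun m => √(m : ℝ)) a - 1 / 180)) := by
    intro x; rw [Ex_affine]; ring
  simp only [e2, Ex_affine]
  change Ex _ _ + _ ≤ _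
  linarith

end TripleCount

section Line

/-- Visit `p (j + 1), …, p (j + r)` and record a round for each of these points. -/
def walk (p : ℕ → V) (j : ℕ) : ℕ → Strat V
  | 0 => halt
  | r + 1 => force {p (j + 1)} (mark (walk p (j + 1) r))

variable {d : V → V → ℝ} {p : ℕ → V}

theorem Fair_walk (r : ℕ) : ∀ j, (∀ i, j ≤ i → i < j + r → d (p i) (p (i + 1)) = 1) →
    Fair d 1 1 (walk p j r) {p j} := by
  induction r with
  | zero => exact fun j _ => ⟨fun x _ => le_refl (0 : ℝ), trivial⟩
  | succ r ih =>
    intro j h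
    refine ⟨?_, ih (j + 1) fun i hi hi' => h i (by omega) (by omega)⟩
    rintro _ rfl
    refine ⟨zero_le_one, ?_⟩
    rintro _ rfl
    simp [LB, h j le_rfl (by omega)]

theorem Off_walk (hd : IsPseudo d) (r : ℕ) : ∀ j,
    (∀ i, j ≤ i → i < j + r → d (p i) (p (i + 1)) = 1) → ∀ σ, Br (walk p j r) σ →
      Off d σ (p j) (p (j + r)) r := by
  induction r with
  | zero => rintro j _ _ rfl; simp [Off, hd.self]
  | succ r ih =>
    rintro j h _ ⟨σ, rfl, hσ⟩
    have := ih (j + 1) (fun i hi hi' => h i (by omega) (by omega)) σ hσ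
    refine ⟨_, rfl, ?_⟩
    rw [h j le_rfl (by omega), Nat.cast_succ, add_sub_cancel_right, ← Nat.add_assoc,
      Nat.add_right_comm]
    exact this

theorem fold_walk (av : X → X → X) (f : ℕ → X) (r j : ℕ) : fold av f (walk p j r) = f r := by
  induction r generalizing f j with
  | zero => rfl
  | succ r ih => exact ih _ _

/-- The gadget formed by a path of length `K`. -/
theorem isGadget_walk (K : ℕ) :
    IsGadget (fun x y : Fin (K + 1) => |(x : ℝ) - y|) ⟨min 0 K, by omega⟩ ⟨min (0 + K) K, by omega⟩
      1 K (walk (fun j => ⟨min j K, by omega⟩) 0 K) := by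
  have hd : IsPseudo (fun x y : Fin (K + 1) => |(x : ℝ) - y|) :=
    ⟨fun x => by simp, fun x y => abs_sub_comm _ _, fun x y z => abs_sub_le _ _ _⟩
  have h : ∀ i, 0 ≤ i → i < 0 + K →
      |(((⟨min i K, by omega⟩ : Fin (K + 1)) : ℕ) : ℝ) -
        ((⟨min (i + 1) K, by omega⟩ : Fin (K + 1)) : ℕ)| = 1 := by
    intro i _ hi
    simp only [min_eq_left (show i ≤ K by omega), min_eq_left (show i + 1 ≤ K by omega)]
    push_cast
    norm_num
  exact ⟨hd, Fair_walk K 0 h, by simp, Off_walk hd K 0 h⟩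

end Line

/-- The gadgets obtained by iterating the construction of triples. -/
theorem exists_gadget (n : ℕ) : ∃ (V : Type) (_ : Fintype V) (d : V → V → ℝ) (s t : V)
    (a : Strat V), IsGadget d s t (3 ^ n) (minRounds * 3 ^ n) a ∧
      Fintype.card V = 6 ^ n * (minRounds + 1) ∧ AllM (fun m => minRounds ≤ m) a ∧
      120 + n / 180 ≤ Ex (fun m => √(m : ℝ)) a := by
  induction n with
  | zero =>
    refine ⟨_, inferInstance, _, _, _, _, by simpa using isGadget_walk minRounds,
      (Fintype.card_fin _).trans (by simp), ?_, ?_⟩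
    · rw [AllM, fold_walk]
    · rw [Ex, fold_walk]
      exact Real.le_sqrt_of_sq_le (by norm_num)
  | succ n ih =>
    obtain ⟨V, _, d, s, t, a, h, hV, hm, hE⟩ := ih
    refine ⟨Triple V, inferInstance, tripleDist d s t, copy 0 true s, copy 2 true t,
      tripleStrat s t a, ?_, ?_, AllM_tripleStrat hm, ?_⟩
    · have hp : (0 : ℝ) < 3 ^ n := by positivity
      have := h.triple (by positivity) (by push_cast; linarith)
      rwa [← mul_assoc, mul_comm 3 (minRounds : ℝ), mul_assoc, ← pow_succ'] at this
    · simp only [Fintype.card_prod, Fintype.card_bool, Fintype.card_fin, hV]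
      ring
    · have := Ex_sqrt_tripleStrat (s := s) (t := t) hm
      push_cast
      linarith

namespace Strat

/-- Play `a` for `N` times, each time returning from `t` to `s`. -/
def rep (s t : V) (a : Strat V) : ℕ → Strat V
  | 0 => halt
  | N + 1 => a.append (force {t} (force {s} (rep s t a N)))

end Strat

section Value

variable {d : V → V → ℝ} {β γ Γ : ℝ}

theorem AllM_size (a : Strat V) : AllM (fun m => m ≤ a.size) a := by
  induction a with
  | halt => exact Nat.zero_le 1
  | mark a ih =>
    exact AllM.imp (a := a) (Q := fun m => m + 1 ≤ (mark a).size) ih fun m hm => by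
      simp only [size]; omega
  | coin a b iha ihb =>
    exact ⟨iha.imp fun m hm => by simp only [size]; omega,
      ihb.imp fun m hm => by simp only [size]; omega⟩
  | force S a ih => exact AllM.imp ih fun m hm => by simp only [size]; omega

theorem Br_length {a : Strat V} : ∀ {σ : List (Set V)}, Br a σ → σ.length ≤ a.size := by
  induction a with
  | halt => rintro _ rfl; exact Nat.zero_le 1
  | mark a ih => exact fun h => (ih h).trans (Nat.le_succ _)
  | coin a b iha ihb =>
    rintro σ (h | h)
    · exact (iha h).trans (by simp only [size]; omega)
    · exact (ihb h).trans (by simp only [size]; omega)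
  | force S a ih => rintro _ ⟨σ, rfl, h⟩; exact Nat.succ_le_succ (ih h)

/-- The expected number of rounds. -/
noncomputable def rounds (a : Strat V) : ℝ := Ex (fun m => (m : ℝ)) a

theorem rounds_mark (a : Strat V) : rounds (mark a) = rounds a + 1 := by
  have := Ex_affine 1 1 (fun m => (m : ℝ)) a
  simp only [one_mul] at this
  rw [rounds, rounds, ← this]
  simp [Ex, fold]

theorem rounds_le {L : ℕ} {a : Strat V} (h : AllM (fun m => m ≤ L) a) : rounds a ≤ L := by
  refine (Ex_le (g := fun _ => 0 * (0 : ℝ) + L) (h.imp fun m hm => ?_)).trans ?_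
  · simpa using hm
  · rw [Ex_affine]; simp

theorem rounds_nonneg (a : Strat V) : 0 ≤ rounds a := by
  refine le_trans ?_ (Ex_le (f := fun _ => 0 * (0 : ℝ) + 0) ((AllM_size a).imp fun m hm => ?_))
  · rw [Ex_affine]; simp
  · simp

theorem VL_of_LB {L : ℕ} (hβ : 0 ≤ β) (hΓ : γ + β * L ≤ Γ) {a : Strat V} :
    ∀ {S : Set V} {x : V} {c : ℝ}, AllM (fun m => m ≤ L) a → Tail d β γ a S → x ∈ S →
      LB d β γ a x c → VL d Γ a x (c + β * rounds a) := by
  induction a with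
  | halt =>
    intro S x c _ _ _ h
    simp only [LB, VL, rounds, Ex, fold] at *
    simpa using h
  | mark a ih =>
    intro S x c hL hT hx h
    simp only [LB] at h
    have hL' : AllM (fun m => m ≤ L) a :=
      AllM.imp (P := fun m => m + 1 ≤ L) hL fun m hm => by omega
    refine VL_anti (a := a) (ih hL' hT.2 hx (hT.1 x hx)) ?_
    rw [rounds_mark]
    linarith
  | coin a b iha ihb =>
    rintro S x c hL hT hx ⟨c₁, c₂, h, h1, h2⟩
    refine ⟨_, _, ?_, iha hL.1 hT.1 hx h1, ihb hL.2 hT.2 hx h2⟩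
    simp only [rounds, Ex, fold, mean]
    linarith
  | force S a ih =>
    rintro S' x c hL hT hx ⟨h1, h2⟩
    have hr : rounds (force S a) = rounds a := rfl
    rw [hr]
    refine ⟨?_, fun y hy => VL_anti (ih hL hT hy (h2 y hy)) (by linarith)⟩
    have := mul_le_mul_of_nonneg_left (rounds_le (a := a) hL) hβ
    linarith

theorem VL_mono_quit {Γ' : ℝ} (hΓ : Γ ≤ Γ') {a : Strat V} : ∀ {x : V} {c : ℝ},
    VL d Γ a x c → VL d Γ' a x c := by
  induction a with
  | halt => exact fun h => h
  | mark a ih => exact fun h => ih h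
  | coin a b iha ihb => rintro x c ⟨c₁, c₂, h, h1, h2⟩; exact ⟨c₁, c₂, h, iha h1, ihb h2⟩
  | force S a ih => rintro x c ⟨h1, h2⟩; exact ⟨by linarith, fun y hy => ih (h2 y hy)⟩

theorem VL_append {Γ' c' : ℝ} {b : Strat V} (hΓ : Γ + c' ≤ Γ') (hb : ∀ z, VL d Γ' b z c')
    {a : Strat V} : ∀ {x : V} {c : ℝ}, VL d Γ a x c → VL d Γ' (a.append b) x (c + c') := by
  induction a with
  | halt =>
    intro x c h
    simp only [VL] at h
    exact VL_anti (hb x) (by linarith)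
  | mark a ih => exact fun h => ih h
  | coin a b iha ihb =>
    rintro x c ⟨c₁, c₂, h, h1, h2⟩
    exact ⟨c₁ + c', c₂ + c', by linarith, iha h1, ihb h2⟩
  | force S a ih =>
    rintro x c ⟨h1, h2⟩
    exact ⟨by linarith, fun y hy => VL_anti (ih (h2 y hy)) (by linarith)⟩

end Value

section Repeat

variable {d : V → V → ℝ} {s t : V} {a : Strat V}

theorem VL_rep (hd : IsPseudo d) {Γ v : ℝ} (hΓ : 0 ≤ Γ) (hv : 0 ≤ v) (ha : VL d Γ a s v)
    (N : ℕ) : VL d (Γ + N * v) (rep s t a N) s (N * v) := by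
  induction N with
  | zero => simp [VL, rep]
  | succ N ih =>
    have hN : 0 ≤ (N : ℝ) * v := by positivity
    have e : Γ + ((N + 1 : ℕ) : ℝ) * v = Γ + N * v + v := by push_cast; ring
    have e' : ((N + 1 : ℕ) : ℝ) * v = v + N * v := by push_cast; ring
    rw [e, e']
    refine VL_append (b := force {t} (force {s} (rep s t a N))) (by linarith)
      (fun z => ⟨by linarith, ?_⟩) ha
    intro y hy
    rw [Set.mem_singleton_iff.1 hy]
    refine ⟨by linarith [hd.nonneg z t], fun y' hy' => ?_⟩
    rw [Set.mem_singleton_iff.1 hy']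
    exact VL_anti (VL_mono_quit (by linarith) ih) (by linarith [hd.nonneg z t, hd.nonneg t s])

theorem Off_rep (hd : IsPseudo d) {l : ℝ} (hl : d s t = l) (ha : ∀ σ, Br a σ → Off d σ s t l)
    (N : ℕ) : ∀ σ, Br (rep s t a N) σ → Off d σ s s (N * (2 * l)) := by
  induction N with
  | zero => rintro _ rfl; simp [Off, hd.self]
  | succ N ih =>
    intro σ h
    obtain ⟨σ₁, _, rfl, h1, _, rfl, _, rfl, h2⟩ := Br_append h
    have : Off d ({t} :: {s} :: _) t s (l + N * (2 * l)) :=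
      ⟨t, rfl, s, rfl, Off_mono (ih _ h2) (by rw [hd.self, hd.symm, hl]; linarith)⟩
    exact Off_mono (Off_append hd this (ha _ h1)) (by push_cast; linarith)

theorem length_rep (N : ℕ) : ∀ σ, Br (rep s t a N) σ → σ.length ≤ N * (a.size + 2) := by
  induction N with
  | zero => rintro _ rfl; simp
  | succ N ih =>
    intro σ h
    obtain ⟨σ₁, _, rfl, h1, σ₂, rfl, σ₃, rfl, h2⟩ := Br_append h
    have := Br_length h1
    have := ih _ h2
    simp only [List.length_append, List.length_cons]
    linarith

end Repeat

section Distribution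

/-- The expectation of a function of the set sequence produced by a strategy. -/
noncomputable def EBr : Strat V → (List (Set V) → ℝ) → ℝ
  | halt, F => F []
  | mark a, F => EBr a F
  | coin a b, F => mean (EBr a F) (EBr b F)
  | force S a, F => EBr a (fun σ => F (S :: σ))

theorem EBr_const_add (K : ℝ) (a : Strat V) : ∀ F, EBr a (fun σ => K + F σ) = K + EBr a F := by
  induction a with
  | halt => exact fun F => rfl
  | mark a ih => exact ih
  | coin a b iha ihb => intro F; simp only [EBr, mean, iha, ihb]; ring
  | force S a ih => exact fun F => ih _

theorem EBr_nonneg (a : Strat V) : ∀ F, (∀ σ, 0 ≤ F σ) → 0 ≤ EBr a F := by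
  induction a with
  | halt => exact fun F h => h []
  | mark a ih => exact ih
  | coin a b iha ihb =>
    intro F h
    have := iha F h
    have := ihb F h
    simp only [EBr, mean]
    linarith
  | force S a ih => exact fun F h => ih _ fun σ => h _

theorem exists_distribution (a : Strat V) : ∃ (N : ℕ) (P : Fin N → ℝ) (ρ : Fin N → List (Set V)),
    (∀ ω, 0 ≤ P ω) ∧ ∑ ω, P ω = 1 ∧ (∀ ω, Br a (ρ ω)) ∧
      ∀ F : List (Set V) → ℝ, ∑ ω, P ω * F (ρ ω) = EBr a F := by
  induction a with
  | halt =>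
    exact ⟨1, fun _ => 1, fun _ => [], fun _ => zero_le_one, by simp, fun _ => rfl,
      fun F => by simp [EBr]⟩
  | mark a ih => exact ih
  | coin a b iha ihb =>
    obtain ⟨N, P, ρ, hP, h1, hρ, hF⟩ := iha
    obtain ⟨N', P', ρ', hP', h1', hρ', hF'⟩ := ihb
    refine ⟨N + N', Fin.addCases (fun ω => P ω / 2) (fun ω => P' ω / 2), Fin.addCases ρ ρ',
      fun ω => ?_, ?_, fun ω => ?_, fun F => ?_⟩
    · refine Fin.addCases (fun ω => ?_) (fun ω => ?_) ω
      · simp only [Fin.addCases_left]; exact div_nonneg (hP ω) zero_le_two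
      · simp only [Fin.addCases_right]; exact div_nonneg (hP' ω) zero_le_two
    · simp only [Fin.sum_univ_add, Fin.addCases_left, Fin.addCases_right, ← Finset.sum_div, h1, h1']
      norm_num
    · refine Fin.addCases (fun ω => ?_) (fun ω => ?_) ω
      · simp only [Fin.addCases_left]; exact Or.inl (hρ ω)
      · simp only [Fin.addCases_right]; exact Or.inr (hρ' ω)
    · simp only [Fin.sum_univ_add, Fin.addCases_left, Fin.addCases_right, EBr, mean, ← hF, ← hF',
        add_div, Finset.sum_div, div_mul_eq_mul_div]
  | force S a ih =>
    obtain ⟨N, P, ρ, hP, h1, hρ, hF⟩ := ih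
    exact ⟨N, P, fun ω => S :: ρ ω, hP, h1, fun ω => ⟨_, rfl, hρ ω⟩,
      fun F => hF fun σ => F (S :: σ)⟩

end Distribution

section Lift

variable {U : Type} {d : V → V → ℝ} {φ : U → V} {ε : ℝ}

/-- The pseudometric `d`, pulled back along `φ` and turned into a metric by adding `ε` to the
distance of distinct points. -/
noncomputable def liftDist (d : V → V → ℝ) (φ : U → V) (ε : ℝ) (x y : U) : ℝ :=
  d (φ x) (φ y) + if x = y then 0 else ε

theorem liftDist_self (hd : IsPseudo d) (x : U) : liftDist d φ ε x x = 0 := by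
  simp [liftDist, hd.self]

theorem le_liftDist (hε : 0 ≤ ε) (x y : U) : d (φ x) (φ y) ≤ liftDist d φ ε x y := by
  unfold liftDist
  split_ifs <;> linarith

theorem liftDist_le (hε : 0 ≤ ε) (x y : U) : liftDist d φ ε x y ≤ d (φ x) (φ y) + ε := by
  unfold liftDist
  split_ifs <;> linarith

theorem le_liftDist_of_ne (hd : IsPseudo d) {x y : U} (h : x ≠ y) : ε ≤ liftDist d φ ε x y := by
  rw [liftDist, if_neg h]
  linarith [hd.nonneg (φ x) (φ y)]

theorem liftDist_nonneg (hd : IsPseudo d) (hε : 0 ≤ ε) (x y : U) : 0 ≤ liftDist d φ ε x y :=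
  (hd.nonneg _ _).trans (le_liftDist hε x y)

theorem liftDist_symm (hd : IsPseudo d) (x y : U) : liftDist d φ ε x y = liftDist d φ ε y x := by
  simp only [liftDist, hd.symm (φ x), eq_comm (a := x)]

theorem liftDist_tri (hd : IsPseudo d) (hε : 0 ≤ ε) (x y z : U) :
    liftDist d φ ε x z ≤ liftDist d φ ε x y + liftDist d φ ε y z := by
  have := hd.tri (φ x) (φ y) (φ z)
  unfold liftDist
  by_cases h1 : x = y
  · subst h1; rw [hd.self]; simp
  · rw [if_neg h1]
    split_ifs <;> linarith

theorem isMetric_liftDist (hd : IsPseudo d) (hε : 0 < ε) : IsMetric (liftDist d φ ε) := by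
  refine ⟨fun x y => ⟨fun h => ?_, ?_⟩, liftDist_symm hd, liftDist_tri hd hε.le⟩
  · by_contra hxy
    linarith [le_liftDist_of_ne (φ := φ) (ε := ε) hd hxy]
  · rintro rfl
    exact liftDist_self hd x

variable [Fintype U]

/-- Request all points outside `S`, for `M` times. -/
noncomputable def sweep (φ : U → V) (M : ℕ) (S : Set V) : List U :=
  (List.replicate M (Finset.univ.toList.filter fun x => φ x ∉ S)).flatten

/-- The request sequence enforcing a sequence of sets. -/
noncomputable def requests (φ : U → V) (M : ℕ) (σ : List (Set V)) : List U :=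
  σ.flatMap (sweep φ M)

theorem notMem_of_mem_sweep {M : ℕ} {S : Set V} {x : U} (h : x ∈ sweep φ M S) : φ x ∉ S := by
  simp only [sweep, List.mem_flatten, List.mem_replicate] at h
  obtain ⟨l, ⟨-, rfl⟩, h⟩ := h
  simpa using h

theorem mem_sweep {M : ℕ} (hM : M ≠ 0) {S : Set V} {x : U} (h : φ x ∉ S) : x ∈ sweep φ M S := by
  simp only [sweep, List.mem_flatten, List.mem_replicate]
  exact ⟨_, ⟨hM, rfl⟩, by simpa using h⟩

theorem sweep_succ (M : ℕ) (S : Set V) : sweep φ (M + 1) S = sweep φ 1 S ++ sweep φ M S := by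
  simp [sweep, List.replicate_succ]

end Lift

section Online

variable {U : Type} {d : V → V → ℝ} {φ : U → V} {ε : ℝ} {D : U → U → ℝ} {h : List U → U}

/-- The cost of the moves of `h` caused by the requests that follow the history `l`. -/
def pathCost (D : U → U → ℝ) (h : List U → U) : List U → List U → ℝ
  | _, [] => 0
  | l, r :: rs => D (h l) (h (l ++ [r])) + pathCost D h (l ++ [r]) rs

theorem pathCost_append (rs' : List U) : ∀ l rs, pathCost D h l (rs ++ rs') =
    pathCost D h l rs + pathCost D h (l ++ rs) rs' := by
  intro l rs
  induction rs generalizing l with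
  | nil => simp [pathCost]
  | cons r rs ih => simp [pathCost, ih, add_assoc]

theorem pathCost_eq_sum : ∀ rs l : List U, pathCost D h l rs =
    ∑ i ∈ Finset.range rs.length, D (h (l ++ rs.take i)) (h (l ++ rs.take (i + 1))) := by
  intro rs
  induction rs with
  | nil => simp [pathCost]
  | cons r rs ih =>
    intro l
    rw [List.length_cons, Finset.sum_range_succ', pathCost, ih, add_comm]
    simp

theorem pathCost_nonneg (hd : IsPseudo d) (hε : 0 ≤ ε) : ∀ rs l : List U,
    0 ≤ pathCost (liftDist d φ ε) h l rs := by
  intro rs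
  induction rs with
  | nil => exact fun _ => le_rfl
  | cons r rs ih => exact fun l => add_nonneg (liftDist_nonneg hd hε _ _) (ih _)

theorem le_pathCost (hd : IsPseudo d) (hε : 0 ≤ ε) : ∀ rs l : List U,
    d (φ (h l)) (φ (h (l ++ rs))) ≤ pathCost (liftDist d φ ε) h l rs := by
  intro rs
  induction rs with
  | nil => intro l; simp [pathCost, hd.self]
  | cons r rs ih =>
    intro l
    have h1 := ih (l ++ [r])
    have h2 := hd.tri (φ (h l)) (φ (h (l ++ [r]))) (φ (h (l ++ r :: rs)))
    have h3 := le_liftDist (d := d) (φ := φ) hε (h l) (h (l ++ [r]))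
    rw [List.append_assoc, List.singleton_append] at h1
    simp only [pathCost]
    linarith

theorem le_pathCost_of_mem (hd : IsPseudo d) (hε : 0 ≤ ε) (hh : ∀ l r, h (l ++ [r]) ≠ r) :
    ∀ rs l : List U, h l ∈ rs → ε ≤ pathCost (liftDist d φ ε) h l rs := by
  intro rs
  induction rs with
  | nil => intro l hl; simp at hl
  | cons r rs ih =>
    intro l hl
    have h0 := pathCost_nonneg (φ := φ) (h := h) hd hε rs (l ++ [r])
    by_cases e : h l = h (l ++ [r])
    · have : h (l ++ [r]) ∈ rs := by
        rw [← e]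
        exact (List.mem_cons.1 hl).resolve_left fun e' => hh l r (e.symm.trans e')
      have := ih _ this
      have := liftDist_nonneg (φ := φ) hd hε (h l) (h (l ++ [r]))
      simp only [pathCost]
      linarith
    · have := le_liftDist_of_ne (φ := φ) (ε := ε) hd e
      simp only [pathCost]
      linarith

variable [Fintype U]

theorem sweep_alternative (hd : IsPseudo d) (hε : 0 ≤ ε) (hh : ∀ l r, h (l ++ [r]) ≠ r)
    (S : Set V) (M : ℕ) : ∀ l : List U,
    (∃ y ∈ S, d (φ (h l)) y + d y (φ (h (l ++ sweep φ M S))) ≤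
      pathCost (liftDist d φ ε) h l (sweep φ M S)) ∨
      M * ε ≤ pathCost (liftDist d φ ε) h l (sweep φ M S) := by
  induction M with
  | zero => intro l; right; simp [sweep, pathCost]
  | succ M ih =>
    intro l
    by_cases hS : φ (h l) ∈ S
    · exact .inl ⟨_, hS, by rw [hd.self, zero_add]; exact le_pathCost hd hε _ _⟩
    · have h1 := le_pathCost_of_mem (φ := φ) hd hε hh (sweep φ 1 S) l (mem_sweep one_ne_zero hS)
      rw [sweep_succ, pathCost_append, ← List.append_assoc]
      rcases ih (l ++ sweep φ 1 S) with ⟨y, hy, h2⟩ | h2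
      · refine .inl ⟨y, hy, ?_⟩
        have := le_pathCost (φ := φ) (h := h) hd hε (sweep φ 1 S) l
        have := hd.tri (φ (h l)) (φ (h (l ++ sweep φ 1 S))) y
        linarith
      · right
        push_cast
        linarith

theorem VL.le_EBr_pathCost (hd : IsPseudo d) (hε : 0 ≤ ε) (hh : ∀ l r, h (l ++ [r]) ≠ r)
    {M : ℕ} {Γ : ℝ} (hM : Γ ≤ M * ε) {a : Strat V} : ∀ {l : List U} {c : ℝ},
    VL d Γ a (φ (h l)) c →
      c ≤ EBr a fun σ => pathCost (liftDist d φ ε) h l (requests φ M σ) := by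
  induction a with
  | halt => exact fun h => h
  | mark a ih => exact fun h => ih h
  | coin a b iha ihb =>
    rintro l c ⟨c₁, c₂, hc, h1, h2⟩
    have := iha h1
    have := ihb h2
    simp only [EBr, mean]
    linarith
  | force S a ih =>
    rintro l c ⟨hc, hv⟩
    have e : ∀ σ, pathCost (liftDist d φ ε) h l (requests φ M (S :: σ)) =
        pathCost (liftDist d φ ε) h l (sweep φ M S) +
          pathCost (liftDist d φ ε) h (l ++ sweep φ M S) (requests φ M σ) := fun σ => by
      rw [← pathCost_append]; rfl
    simp only [EBr, e, EBr_const_add]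
    rcases sweep_alternative (φ := φ) hd hε hh S M l with ⟨y, hy, h1⟩ | h1
    · have := ih (l := l ++ sweep φ M S) (VL_lipschitz hd (hv y hy))
      linarith
    · have := EBr_nonneg a
        (fun σ => pathCost (liftDist d φ ε) h (l ++ sweep φ M S) (requests φ M σ))
        fun σ => pathCost_nonneg hd hε _ _
      linarith

end Online

section Service

variable {U : Type} {d : V → V → ℝ} {φ : U → V} {ε : ℝ} {D : U → U → ℝ}

/-- The requests `l` can be served at cost at most `c` when the only point without server is
initially `x`. -/
def Serves (D : U → U → ℝ) : List U → U → ℝ → Prop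
  | [], _, c => 0 ≤ c
  | r :: l, x, c => ∃ y, y ≠ r ∧ Serves D l y (c - D x y)

theorem Serves.mono {l : List U} : ∀ {x : U} {c c' : ℝ}, Serves D l x c → c ≤ c' →
    Serves D l x c' := by
  induction l with
  | nil => exact fun h hc => le_trans h hc
  | cons r l ih => rintro x c c' ⟨y, hy, h⟩ hc; exact ⟨y, hy, ih h (by linarith)⟩

theorem Serves.move (hd : IsPseudo d) (hε : 0 ≤ ε) {l : List U} {y : U} {c : ℝ} (x : U)
    (h : Serves (liftDist d φ ε) l y c) :
    Serves (liftDist d φ ε) l x (c + liftDist d φ ε x y) := by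
  cases l with
  | nil => exact add_nonneg h (liftDist_nonneg hd hε x y)
  | cons r l =>
    obtain ⟨z, hz, h⟩ := h
    exact ⟨z, hz, h.mono (by linarith [liftDist_tri (φ := φ) hd hε x y z])⟩

theorem Serves.stay_append (hd : IsPseudo d) {l₂ : List U} {y : U} {c : ℝ}
    (h : Serves (liftDist d φ ε) l₂ y c) :
    ∀ l₁ : List U, y ∉ l₁ → Serves (liftDist d φ ε) (l₁ ++ l₂) y c := by
  intro l₁
  induction l₁ with
  | nil => exact fun _ => h
  | cons r l ih =>
    intro hy
    refine ⟨y, fun e => hy (by simp [e]), (ih fun hl => hy (by simp [hl])).mono ?_⟩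
    rw [liftDist_self hd, sub_zero]

theorem Serves.drop_append (hd : IsPseudo d) (hε : 0 ≤ ε) {l₂ : List U} : ∀ {l₁ : List U} {x : U}
    {c : ℝ}, Serves (liftDist d φ ε) (l₁ ++ l₂) x c → ∃ y, Serves (liftDist d φ ε) l₂ y c := by
  intro l₁
  induction l₁ with
  | nil => exact fun {x c} h => ⟨x, h⟩
  | cons r l ih =>
    rintro x c ⟨y, -, h⟩
    exact ih (h.mono (by linarith [liftDist_nonneg (φ := φ) hd hε x y]))

theorem Serves.drop_append_of_mem (hd : IsPseudo d) (hε : 0 ≤ ε) {l₂ : List U} :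
    ∀ {l₁ : List U} {x : U} {c : ℝ}, Serves (liftDist d φ ε) (l₁ ++ l₂) x c → x ∈ l₁ →
      ∃ y, Serves (liftDist d φ ε) l₂ y (c - ε) := by
  intro l₁
  induction l₁ with
  | nil => intro x c _ hx; simp at hx
  | cons r l ih =>
    rintro x c ⟨y, hy, h⟩ hx
    by_cases e : x = y
    · subst e
      rw [liftDist_self hd, sub_zero] at h
      exact ih h ((List.mem_cons.1 hx).resolve_left hy)
    · exact Serves.drop_append hd hε
        (h.mono (by linarith [le_liftDist_of_ne (φ := φ) (ε := ε) hd e]))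

theorem serves_iff (l : List U) : ∀ (x : U) (c : ℝ), Serves D l x c ↔ ∃ g : ℕ → U, g 0 = x ∧
    (∀ (i : ℕ) (h : i < l.length), g (i + 1) ≠ l.get ⟨i, h⟩) ∧
      ∑ i ∈ Finset.range l.length, D (g i) (g (i + 1)) ≤ c := by
  induction l with
  | nil => exact fun x c => ⟨fun h => ⟨fun _ => x, rfl, by simp, h⟩,
      fun ⟨_, _, _, h⟩ => h⟩
  | cons r l ih =>
    intro x c
    constructor
    · rintro ⟨y, hy, h⟩
      obtain ⟨g, rfl, hg, hc⟩ := (ih _ _).1 h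
      refine ⟨fun i => Nat.casesOn i x g, rfl, fun i hi => ?_, ?_⟩
      · cases i with
        | zero => exact hy
        | succ i => exact hg i (Nat.lt_of_succ_lt_succ hi)
      · rw [List.length_cons, Finset.sum_range_succ']
        simpa using by linarith
    · rintro ⟨g, rfl, hg, hc⟩
      refine ⟨g 1, hg 0 (Nat.succ_pos _), (ih _ _).2 ⟨fun i => g (i + 1), rfl,
        fun i hi => hg (i + 1) (Nat.succ_lt_succ hi), ?_⟩⟩
      rw [List.length_cons, Finset.sum_range_succ'] at hc
      linarith

variable [Fintype U]

theorem Serves.of_Off (hd : IsPseudo d) (hε : 0 ≤ ε) (hφ : Function.Surjective φ) (M : ℕ) {y : V}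
    {σ : List (Set V)} : ∀ {v : V} {c : ℝ}, Off d σ v y c → ∀ x : U,
      Serves (liftDist d φ ε) (requests φ M σ) x (c + d (φ x) v + ε * σ.length) := by
  induction σ with
  | nil =>
    intro v c h x
    simp only [Off] at h
    simp only [requests, List.flatMap_nil, Serves, List.length_nil, Nat.cast_zero, mul_zero]
    linarith [hd.nonneg v y, hd.nonneg (φ x) v]
  | cons S σ ih =>
    rintro v c ⟨z, hz, h⟩ x
    obtain ⟨x', rfl⟩ := hφ z
    have h1 := (ih h x').stay_append hd (sweep φ M S) fun hx => notMem_of_mem_sweep hx hz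
    refine (h1.move hd hε x).mono ?_
    have := liftDist_le (d := d) (φ := φ) hε x x'
    have := hd.tri (φ x) v (φ x')
    rw [hd.self, List.length_cons]
    push_cast
    linarith

theorem Serves.le_of_rep (hd : IsPseudo d) (hε : 0 ≤ ε) {s t : V} (hst : s ≠ t) {M : ℕ}
    (hM : M ≠ 0) {a : Strat V} (N : ℕ) : ∀ {σ : List (Set V)}, Br (rep s t a N) σ →
      ∀ {x : U} {c : ℝ}, Serves (liftDist d φ ε) (requests φ M σ) x c → N * ε ≤ c := by
  induction N with
  | zero =>
    rintro _ rfl x c h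
    simpa [requests, Serves] using h
  | succ N ih =>
    intro σ hσ x c h
    obtain ⟨σ₁, _, rfl, -, _, rfl, σ₂, rfl, h2⟩ := Br_append hσ
    rw [requests, List.flatMap_append, List.flatMap_cons, List.flatMap_cons, ← List.append_assoc]
      at h
    rw [← List.append_assoc] at h
    have hx : x ∈ (σ₁.flatMap (sweep φ M) ++ sweep φ M {t}) ++ sweep φ M {s} := by
      simp only [List.mem_append]
      by_cases hx : φ x = t
      · exact .inr (mem_sweep hM fun e => hst (e.symm.trans hx))
      · exact .inl (.inr (mem_sweep hM hx))
    obtain ⟨y, hy⟩ := h.drop_append_of_mem hd hε hx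
    have := ih h2 hy
    push_cast
    linarith

end Service

section Servers

variable {U : Type} [Fintype U] {D : U → U → ℝ} {k : ℕ}

theorem kStepCost_compl (hs : ∀ x, D x x = 0) (hsymm : ∀ x y, D x y = D y x) (x y : U) :
    kStepCost D {x}ᶜ {y}ᶜ = D x y := by
  have e : ∀ x y : U, x ≠ y → ({x}ᶜ \ {y}ᶜ : Finset U) = {y} := fun x y h => by
    ext z
    simp only [Finset.mem_sdiff, Finset.mem_compl, Finset.mem_singleton, not_not]
    exact ⟨fun h => h.2, fun e => ⟨fun e' => h (e'.symm.trans e), e⟩⟩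
  by_cases h : x = y
  · subst h
    simp [kStepCost, hs]
  · simp [kStepCost, e x y h, e y x (Ne.symm h), hsymm x y]

theorem card_compl_singleton (hU : Fintype.card U = k + 1) (x : U) :
    ({x}ᶜ : Finset U).card = k := by
  rw [Finset.card_compl, Finset.card_singleton, hU, Nat.add_sub_cancel]

theorem exists_eq_compl (hU : Fintype.card U = k + 1) {S : Finset U} (hS : S.card = k) :
    ∃ x, S = {x}ᶜ := by
  have : Sᶜ.card = 1 := by rw [Finset.card_compl, hU, hS, Nat.add_sub_cancel_left]
  obtain ⟨x, hx⟩ := Finset.card_eq_one.1 this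
  exact ⟨x, by rw [← hx, compl_compl]⟩

theorem kServerOpt_le (hD : IsMetric D) (hU : Fintype.card U = k + 1) {l : List U} {x : U} {c : ℝ}
    (h : Serves D l x c) : kServerOpt D k {x}ᶜ l ≤ c := by
  obtain ⟨g, rfl, hg, hc⟩ := (serves_iff l x c).1 h
  have hs : ∀ x, D x x = 0 := fun x => (hD.1 x x).2 rfl
  have hn : ∀ x y, 0 ≤ D x y := fun x y => by
    have := hD.2.2 x y x
    rw [hs, hD.2.1 y x] at this
    linarith
  refine le_trans (csInf_le ⟨0, ?_⟩ ⟨fun i => {g i}ᶜ, ⟨rfl, fun i hi => ⟨card_compl_singleton hU _,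
    ?_, ?_⟩⟩, rfl⟩) ?_
  · rintro _ ⟨S, -, rfl⟩
    exact Finset.sum_nonneg fun _ _ => Finset.sum_nonneg fun _ _ => Finset.sum_nonneg
      fun _ _ => hn _ _
  · simpa using (hg i hi).symm
  · refine Finset.card_le_one.2 fun a ha b hb => ?_
    simp only [Finset.mem_sdiff, Finset.mem_compl, Finset.mem_singleton, not_not] at ha hb
    rw [ha.2, hb.2]
  · simpa only [kStepCost_compl hs hD.2.1] using hc

theorem le_kServerOpt (hD : IsMetric D) (hU : Fintype.card U = k + 1) {l : List U} {x : U} {B c : ℝ}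
    (hc : Serves D l x c) (hB : ∀ c, Serves D l x c → B ≤ c) : B ≤ kServerOpt D k {x}ᶜ l := by
  have hs : ∀ x, D x x = 0 := fun x => (hD.1 x x).2 rfl
  refine le_csInf ?_ ?_
  · obtain ⟨g, rfl, hg, -⟩ := (serves_iff l x c).1 hc
    refine ⟨_, fun i => {g i}ᶜ, ⟨rfl, fun i hi => ⟨card_compl_singleton hU _, ?_, ?_⟩⟩, rfl⟩
    · simpa using (hg i hi).symm
    · refine Finset.card_le_one.2 fun a ha b hb => ?_
      simp only [Finset.mem_sdiff, Finset.mem_compl, Finset.mem_singleton, not_not] at ha hb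
      rw [ha.2, hb.2]
  · rintro _ ⟨S, ⟨h0, hS⟩, rfl⟩
    have : ∀ i, ∃ z, i ≤ l.length → S i = {z}ᶜ := fun i => by
      cases i with
      | zero => exact ⟨x, fun _ => h0⟩
      | succ i =>
        by_cases hi : i < l.length
        · obtain ⟨z, hz⟩ := exists_eq_compl hU (hS i hi).1
          exact ⟨z, fun _ => hz⟩
        · exact ⟨x, fun h => absurd h hi⟩
    choose g hg using this
    refine hB _ ((serves_iff l x _).2 ⟨g, ?_, fun i hi => ?_, ?_⟩)
    · have := (hg 0 (Nat.zero_le _)).symm.trans h0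
      simpa using this
    · have := (hS i hi).2.1
      rw [hg (i + 1) hi] at this
      simpa [eq_comm] using this
    · refine Finset.sum_le_sum fun i hi => ?_
      have hi := Finset.mem_range.1 hi
      rw [hg i hi.le, hg (i + 1) hi, kStepCost_compl hs hD.2.1]

theorem exists_kServerCost_eq (hD : IsMetric D) (hU : Fintype.card U = k + 1) (x : U)
    {A : List U → Finset U} (hA : KServerAlg k {x}ᶜ A) : ∃ h : List U → U, h [] = x ∧
      (∀ l r, h (l ++ [r]) ≠ r) ∧ ∀ l, kServerCost D A {x}ᶜ l = pathCost D h [] l := by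
  have hs : ∀ x, D x x = 0 := fun x => (hD.1 x x).2 rfl
  have : ∀ l, ∃ z, (if l = [] then {x}ᶜ else A l) = {z}ᶜ := fun l => by
    rcases List.eq_nil_or_concat l with rfl | ⟨l, r, rfl⟩
    · exact ⟨x, if_pos rfl⟩
    · obtain ⟨z, hz⟩ := exists_eq_compl hU (hA l r).1
      exact ⟨z, by rw [List.concat_eq_append, if_neg (by simp), hz]⟩
  choose h hh using this
  refine ⟨h, ?_, fun l r e => ?_, fun l => ?_⟩
  · have := hh []
    rw [if_pos rfl] at this
    simpa using this.symm
  · have h1 := (hA l r).2.1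
    have h2 := hh (l ++ [r])
    rw [if_neg (by simp)] at h2
    rw [h2, e] at h1
    simp at h1
  · rw [pathCost_eq_sum, kServerCost]
    have key : ∀ i ≤ l.length, kConfig A {x}ᶜ l i = {h (l.take i)}ᶜ := fun i hi => by
      rw [← hh, kConfig]
      by_cases h0 : i = 0
      · simp [h0]
      · rw [if_neg h0, if_neg]
        rw [List.take_eq_nil_iff]
        rintro (h | rfl)
        · exact h0 h
        · exact h0 (Nat.le_zero.1 hi)
    refine Finset.sum_congr rfl fun i hi => ?_
    have hi := Finset.mem_range.1 hi
    rw [key i hi.le, key (i + 1) hi, kStepCost_compl hs hD.2.1]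
    simp

end Servers

theorem IsGadget.exists_KServerDLB [Fintype V] {d : V → V → ℝ} {s t : V} {β l : ℝ} {a : Strat V}
    (h : IsGadget d s t β l a) (hβ : 0 ≤ β) (hl : 0 < l) {U : Type} [Fintype U] {k : ℕ}
    (hU : Fintype.card U = k + 1) (hk : Fintype.card V ≤ k + 1) {C : ℝ} (hC : 0 ≤ C)
    (hCl : C * (3 * l) ≤ β * rounds a) :
    ∃ D : U → U → ℝ, IsMetric D ∧ ∃ S₀ : Finset U, S₀.card = k ∧ KServerDLB D k S₀ C := by
  have hd := h.pseudo
  have hst : s ≠ t := fun e => by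
    have := h.dist
    rw [e, hd.self] at this
    exact hl.ne this
  have : Nonempty V := ⟨s⟩
  obtain ⟨φ, hφ⟩ : ∃ φ : U → V, Function.Surjective φ := by
    obtain ⟨f⟩ := Function.Embedding.nonempty_of_card_le (hk.trans_eq hU.symm)
    exact ⟨_, Function.invFun_surjective f.injective⟩
  obtain ⟨x, hx⟩ := hφ s
  have hL : (0 : ℝ) < a.size + 2 := by positivity
  obtain ⟨ε, hε, hεl⟩ : ∃ ε : ℝ, 0 < ε ∧ ε * (a.size + 2) = l :=
    ⟨l / (a.size + 2), by positivity, div_mul_cancel₀ _ hL.ne'⟩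
  have hD := isMetric_liftDist (φ := φ) hd hε
  refine ⟨liftDist d φ ε, hD, {x}ᶜ, card_compl_singleton hU x, fun B _ => ?_⟩
  obtain ⟨N, hN⟩ := exists_nat_ge (B / ε)
  have hNB : B ≤ N * ε := (div_le_iff₀ hε).1 hN
  have hv : 0 ≤ β * rounds a := mul_nonneg hβ (rounds_nonneg a)
  have hΓ : 0 ≤ β + β * a.size := by positivity
  have hVL : VL d (β + β * a.size) a s (β * rounds a) := by
    simpa using VL_of_LB hβ le_rfl (AllM_size a) h.fair.2 rfl (h.fair.1 s rfl)
  have hrep := VL_rep hd (t := t) hΓ hv hVL N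
  obtain ⟨M, hM⟩ := exists_nat_ge (((β + β * a.size) + N * (β * rounds a)) / ε)
  have hM' : (β + β * a.size) + N * (β * rounds a) ≤ (M + 1 : ℕ) * ε := by
    rw [div_le_iff₀ hε] at hM
    push_cast
    linarith
  obtain ⟨n, P, ρ, hP, hP1, hρ, hF⟩ := exists_distribution (rep s t a N)
  have hserve : ∀ ω, Serves (liftDist d φ ε) (requests φ (M + 1) (ρ ω)) x (N * (3 * l)) := by
    intro ω
    have h1 := Serves.of_Off hd hε.le hφ (M + 1) (Off_rep hd h.dist h.off N _ (hρ ω)) x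
    refine h1.mono ?_
    have h2 : ((ρ ω).length : ℝ) ≤ N * (a.size + 2) := by exact_mod_cast length_rep N _ (hρ ω)
    have h3 := mul_le_mul_of_nonneg_left h2 hε.le
    rw [hx, hd.self]
    have h4 : ε * (N * (a.size + 2)) = N * l := by rw [← hεl]; ring
    linarith
  have hupper : ∀ ω, kServerOpt (liftDist d φ ε) k {x}ᶜ (requests φ (M + 1) (ρ ω)) ≤ N * (3 * l) :=
    fun ω => kServerOpt_le hD hU (hserve ω)
  have hlower : ∀ ω, B ≤ kServerOpt (liftDist d φ ε) k {x}ᶜ (requests φ (M + 1) (ρ ω)) :=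
    fun ω => le_kServerOpt hD hU (hserve ω) fun c hc =>
      hNB.trans (Serves.le_of_rep hd hε.le hst (Nat.succ_ne_zero M) N (hρ ω) hc)
  refine ⟨n, P, fun ω => requests φ (M + 1) (ρ ω), hP, hP1, ?_, fun A hA => ?_⟩
  · calc B = ∑ ω, P ω * B := by rw [← Finset.sum_mul, hP1, one_mul]
      _ ≤ _ := Finset.sum_le_sum fun ω _ => mul_le_mul_of_nonneg_left (hlower ω) (hP ω)
  · obtain ⟨f, hf0, hf, hcost⟩ := exists_kServerCost_eq hD hU x hA
    have h1 : N * (β * rounds a) ≤ ∑ ω, P ω * kServerCost (liftDist d φ ε) A {x}ᶜ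
        (requests φ (M + 1) (ρ ω)) := by
      simp only [hcost]
      rw [hF fun σ => pathCost (liftDist d φ ε) f [] (requests φ (M + 1) σ)]
      refine VL.le_EBr_pathCost hd hε.le hf hM' ?_
      rwa [hf0, hx]
    have h2 : ∑ ω, P ω * kServerOpt (liftDist d φ ε) k {x}ᶜ (requests φ (M + 1) (ρ ω)) ≤
        N * (3 * l) := by
      calc _ ≤ ∑ ω, P ω * (N * (3 * l)) :=
            Finset.sum_le_sum fun ω _ => mul_le_mul_of_nonneg_left (hupper ω) (hP ω)
        _ = _ := by rw [← Finset.sum_mul, hP1, one_mul]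
    calc _ ≤ C * (N * (3 * l)) := mul_le_mul_of_nonneg_left h2 hC
      _ = N * (C * (3 * l)) := by ring
      _ ≤ N * (β * rounds a) := mul_le_mul_of_nonneg_left hCl (Nat.cast_nonneg N)
      _ ≤ _ := h1

theorem log_le_of_lt_pow {x m : ℕ} (hx : 0 < x) (h : x < 6 ^ m) : Real.log x ≤ 2 * m := by
  have h6 : Real.log 6 ≤ 2 := by
    rw [Real.log_le_iff_le_exp (by norm_num)]
    have := Real.exp_one_gt_d9
    have e : Real.exp 2 = Real.exp 1 * Real.exp 1 := by rw [← Real.exp_add]; norm_num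
    rw [e]
    nlinarith
  calc Real.log x ≤ Real.log ((6 : ℝ) ^ m) :=
        Real.log_le_log (by exact_mod_cast hx) (by exact_mod_cast h.le)
    _ = m * Real.log 6 := Real.log_pow _ _
    _ ≤ m * 2 := mul_le_mul_of_nonneg_left h6 (Nat.cast_nonneg m)
    _ = 2 * m := mul_comm _ _

theorem exists_KServerDLB_log_sq {k : ℕ} (hk : 2 ≤ k) :
    ∃ D : Fin (k + 1) → Fin (k + 1) → ℝ, IsMetric D ∧ ∃ S₀ : Finset (Fin (k + 1)), S₀.card = k ∧
      KServerDLB D k S₀ (1 / 5598720000 * Real.log k ^ 2) := by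
  have hlog : 0 ≤ Real.log k := Real.log_nonneg (by exact_mod_cast (by omega : 1 ≤ k))
  have hU : Fintype.card (Fin (k + 1)) = k + 1 := Fintype.card_fin _
  by_cases hk' : k < minRounds
  · have hb := log_le_of_lt_pow (x := k) (m := 6) (by omega) (hk'.trans (by norm_num))
    refine (isGadget_walk 1).exists_KServerDLB zero_le_one (by norm_num) hU ?_ (by positivity) ?_
    · rw [Fintype.card_fin]; omega
    · rw [rounds, Ex, fold_walk]
      have : Real.log k ^ 2 ≤ 12 ^ 2 := pow_le_pow_left₀ hlog (by norm_num at hb; linarith) 2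
      norm_num at this ⊢
      linarith
  · rw [not_lt] at hk'
    obtain ⟨n, hn1, hn2⟩ : ∃ n, 6 ^ n * (minRounds + 1) ≤ k + 1 ∧
        k + 1 < 6 ^ (n + 1) * (minRounds + 1) := by
      have h0 : (k + 1) / (minRounds + 1) ≠ 0 := (Nat.div_pos (by omega) (by omega)).ne'
      refine ⟨Nat.log 6 ((k + 1) / (minRounds + 1)), ?_, ?_⟩
      · exact (Nat.le_div_iff_mul_le (by omega)).1 (Nat.pow_log_le_self 6 h0)
      · exact (Nat.div_lt_iff_lt_mul (by omega)).1 (Nat.lt_pow_succ_log_self (by norm_num) _)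
    obtain ⟨V, _, d, s, t, a, h, hV, -, hE⟩ := exists_gadget n
    refine h.exists_KServerDLB (by positivity) (by positivity) hU (hV.trans_le hn1)
      (by positivity) ?_
    have hb := log_le_of_lt_pow (x := k) (m := n + 7) (by omega) (by
      have : 6 ^ (n + 1) * (minRounds + 1) ≤ 6 ^ (n + 1) * 6 ^ 6 :=
        Nat.mul_le_mul_left _ (by norm_num)
      rw [← pow_add] at this
      exact (Nat.lt_succ_self k).trans (hn2.trans_le this))
    have hr : Ex (fun m => √(m : ℝ)) a ^ 2 ≤ rounds a :=
      (sq_Ex_le _ a).trans_eq (by simp [rounds])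
    have hlog2 := pow_le_pow_left₀ hlog hb 2
    have hE2 : ((n + 7 : ℝ) / 180) ^ 2 ≤ Ex (fun m => √(m : ℝ)) a ^ 2 :=
      pow_le_pow_left₀ (by positivity) (by linarith) 2
    have key : Real.log k ^ 2 ≤ 4 * 32400 * rounds a := by
      push_cast at hlog2
      linarith
    calc _ = Real.log k ^ 2 * 3 ^ n / (4 * 32400) := by push_cast; ring
      _ ≤ 4 * 32400 * rounds a * 3 ^ n / (4 * 32400) := by gcongr
      _ = 3 ^ n * rounds a := by ring

end KServerLB

/-- There is an absolute constant `c > 0` such that for every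
`k ≥ 2` there exists a metric space on `k+1` points (realized as a metric `d` on
`Fin (k+1)`) and an initial configuration of `k` servers on which `c·(log k)²`
is a distributional lower bound for the `k`-server problem. -/
theorem kserver_existential_log_sq_lower_bound :
    ∃ c : ℝ, 0 < c ∧ ∀ k : ℕ, 2 ≤ k →
      ∃ d : Fin (k + 1) → Fin (k + 1) → ℝ, IsMetric d ∧
        ∃ S₀ : Finset (Fin (k + 1)), S₀.card = k ∧
          KServerDLB d k S₀ (c * Real.log k ^ 2) :=
  ⟨1 / 5598720000, by norm_num, fun _ hk => KServerLB.exists_KServerDLB_log_sq hk⟩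
end
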